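/- Let (u_p)_{p>1} be a family of low energy nodal solutions of (P_p) and define k_{i,p} := p(w_{i,p} − w₀) for i = 1,2. Then for any fixed τ ∈ (0,1) there exists C > 0 such that |k_{i,p}(z)| ≤ C (1 + |z|)^τ for all z ∈ B_{ϱ₀/ε_{i,p}}(0). Consequently, v_{i,p} = U + w₀/p + k_{i,p}/p² = U + w₀/p + O(1)/p² in C²_loc(ℝ²). -/

import Mathlib

open Real MeasureTheory Metric Filter Topology Bornology

noncomputable section

abbrev E2 : Type := EuclideanSpace ℝ (Fin 2)

/-- Laplacian of `u : ℝ² → ℝ` via coordinate second derivatives. -/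
def lap (u : E2 → ℝ) (x : E2) : ℝ :=
  ∑ i : Fin 2,
    fderiv ℝ (fun y => fderiv ℝ u y (EuclideanSpace.single i 1)) x (EuclideanSpace.single i 1)

/-- `u` is a (classical) solution of the Lane–Emden problem `(P_p)` on `Ω`. -/
def IsSolution (Ω : Set E2) (p : ℝ) (u : E2 → ℝ) : Prop :=
  ContDiffOn ℝ 2 u Ω ∧ ContinuousOn u (closure Ω) ∧
    (∀ x ∈ Ω, -lap u x = |u x| ^ (p - 1) * u x) ∧
    (∀ x ∈ frontier Ω, u x = 0)

/-- `u` is a nodal (sign-changing) function on `Ω`. -/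
def IsNodal (Ω : Set E2) (u : E2 → ℝ) : Prop :=
  (∃ x ∈ Ω, 0 < u x) ∧ (∃ x ∈ Ω, u x < 0)

/-- The Green function of `-Δ` on `Ω` with Dirichlet boundary conditions, together with
its regular part `H`, so that `G(x,y) = -(1/2π) log|x-y| + H(x,y)`. -/
structure GreenData (Ω : Set E2) where
  G : E2 → E2 → ℝ
  H : E2 → E2 → ℝ
  decomp : ∀ x y, G x y = -(1 / (2 * π)) * Real.log ‖x - y‖ + H x y
  bdry : ∀ x ∈ Ω, ∀ y ∈ frontier Ω, G x y = 0
  symm : ∀ x y, G x y = G y x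
  smoothH : ContDiffOn ℝ (⊤ : ℕ∞) (fun q : E2 × E2 => H q.1 q.2) (Ω ×ˢ Ω)
  contH : ∀ x ∈ Ω, ContinuousOn (H x) (closure Ω)
  harmH : ∀ x ∈ Ω, ∀ y ∈ Ω, lap (H x) y = 0

/-- The Kirchhoff–Routh type function `Ψ(a₁,a₂) = 2G(a₁,a₂) − R(a₁) − R(a₂)`. -/
def KR {Ω : Set E2} (gd : GreenData Ω) (q : E2 × E2) : ℝ :=
  2 * gd.G q.1 q.2 - gd.H q.1 q.1 - gd.H q.2 q.2

/-- `q` is a non-degenerate critical point of `F`. -/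
def NondegCrit (F : E2 × E2 → ℝ) (q : E2 × E2) : Prop :=
  fderiv ℝ F q = 0 ∧
    ∀ v : E2 × E2, (∀ w : E2 × E2, fderiv ℝ (fun r => fderiv ℝ F r) q v w = 0) → v = 0

/-- Convergence in `C²_loc(S)`: uniform convergence of all derivatives of order `≤ 2`
on compact subsets of `S`. -/
def TendstoC2LocOn (S : Set E2) (F : ℕ → E2 → ℝ) (g : E2 → ℝ) : Prop :=
  ∀ K : Set E2, K ⊆ S → IsCompact K → ∀ k : ℕ, k ≤ 2 →
    TendstoUniformlyOn (fun n x => iteratedFDeriv ℝ k (F n) x)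
      (fun x => iteratedFDeriv ℝ k g x) atTop K

/-- `‖u⁺‖_∞` on `closure Ω`. -/
def supPos (Ω : Set E2) (u : E2 → ℝ) : ℝ := sSup ((fun x => max (u x) 0) '' closure Ω)

/-- `‖u⁻‖_∞` on `closure Ω`. -/
def supNeg (Ω : Set E2) (u : E2 → ℝ) : ℝ := sSup ((fun x => max (-u x) 0) '' closure Ω)

/-- The energy functional `J_p`. -/
def energy (Ω : Set E2) (p : ℝ) (u : E2 → ℝ) : ℝ :=
  (1 / 2) * (∫ x in Ω, ‖fderiv ℝ u x‖ ^ 2) - (1 / (p + 1)) * ∫ x in Ω, |u x| ^ (p + 1)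

/-- The standard bubble `U(z) = −2 log(1 + |z|²/8)`. -/
def Ustd (z : E2) : ℝ := -2 * Real.log (1 + ‖z‖ ^ 2 / 8)

/-- Unit vector at angle `θ`. -/
def circDir (θ : ℝ) : E2 :=
  EuclideanSpace.single 0 (Real.cos θ) + EuclideanSpace.single 1 (Real.sin θ)

/-- Surface integral over the circle `∂B_r(c)`; the integrand may depend on the
outer unit normal (first argument) and on the point (second argument). -/
def surfInt (c : E2) (r : ℝ) (F : E2 → E2 → ℝ) : ℝ :=
  ∫ θ in (0:ℝ)..(2 * π), r * F (circDir θ) (c + r • circDir θ)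

/-- Inner product of gradients `⟨∇f, ∇g⟩`. -/
def gradInner (f g : E2 → ℝ) (x : E2) : ℝ :=
  ∑ j : Fin 2, fderiv ℝ f x (EuclideanSpace.single j 1) *
    fderiv ℝ g x (EuclideanSpace.single j 1)

/-- The quadratic form `P_i` (centred at `c`, radius `r`). -/
def Pform (c : E2) (r : ℝ) (f g : E2 → ℝ) : ℝ :=
  -2 * r * surfInt c r (fun ν x => fderiv ℝ f x ν * fderiv ℝ g x ν) +
    r * surfInt c r (fun _ x => gradInner f g x)

/-- The quadratic form `Q_{ij}` (centred at `c`, radius `r`). -/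
def Qform (c : E2) (r : ℝ) (j : Fin 2) (f g : E2 → ℝ) : ℝ :=
  surfInt c r (fun ν x =>
    -(fderiv ℝ f x (EuclideanSpace.single j 1)) * fderiv ℝ g x ν -
      fderiv ℝ f x ν * fderiv ℝ g x (EuclideanSpace.single j 1) +
      gradInner f g x * ν j)


lemma hasDerivAt_param {G G' : ℝ → ℝ → ℝ} {a b : ℝ}
    (hG : ∀ r ∈ Set.Ioo a b, ∀ θ, HasDerivAt (fun r => G r θ) (G' r θ) r)
    (hGc : ContinuousOn (Function.uncurry G) (Set.Ioo a b ×ˢ Set.univ))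
    (hGc' : ContinuousOn (Function.uncurry G') (Set.Ioo a b ×ˢ Set.univ))
    {r : ℝ} (hr : r ∈ Set.Ioo a b) (s t : ℝ) :
    HasDerivAt (fun r => ∫ θ in s..t, G r θ) (∫ θ in s..t, G' r θ) r := by
  obtain ⟨δ, hδ, hsub⟩ : ∃ δ > 0, closedBall r δ ⊆ Set.Ioo a b :=
    Metric.nhds_basis_closedBall.mem_iff.1 (isOpen_Ioo.mem_nhds hr)
  have hcomp : IsCompact (closedBall r δ ×ˢ Set.uIcc s t) :=
    (isCompact_closedBall r δ).prod isCompact_uIcc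
  obtain ⟨C, hC⟩ := hcomp.exists_bound_of_continuousOn
    (hGc'.mono (Set.prod_mono hsub (Set.subset_univ _)))
  have hslice : ∀ (H : ℝ → ℝ → ℝ), ContinuousOn (Function.uncurry H) (Set.Ioo a b ×ˢ Set.univ) →
      ∀ x ∈ Set.Ioo a b, Continuous (H x) := by
    intro H hH x hx
    have : Continuous fun θ : ℝ => (x, θ) := by fun_prop
    exact hH.comp_continuous this (fun θ => ⟨hx, trivial⟩)
  refine (intervalIntegral.hasDerivAt_integral_of_dominated_loc_of_deriv_le
    (s := closedBall r δ) (bound := fun _ => C) (closedBall_mem_nhds r hδ) ?_ ?_ ?_ ?_ ?_ ?_).2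
  · filter_upwards [isOpen_Ioo.mem_nhds hr] with x hx
    exact (hslice G hGc x hx).aestronglyMeasurable
  · exact (hslice G hGc r hr).intervalIntegrable _ _
  · exact (hslice G' hGc' r hr).aestronglyMeasurable
  · refine Eventually.of_forall fun θ hθ x hx => ?_
    exact hC (x, θ) ⟨hx, Set.uIoc_subset_uIcc hθ⟩
  · exact intervalIntegrable_const
  · exact Eventually.of_forall fun θ _ x hx => hG x (hsub hx) θ

lemma circDir_zero (θ : ℝ) : circDir θ 0 = Real.cos θ := by simp [circDir]
lemma circDir_one (θ : ℝ) : circDir θ 1 = Real.sin θ := by simp [circDir]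

lemma norm_circDir (θ : ℝ) : ‖circDir θ‖ = 1 := by
  rw [EuclideanSpace.norm_eq]
  simp [circDir_zero, circDir_one]

lemma norm_smul_circDir {r : ℝ} (hr : 0 ≤ r) (θ : ℝ) : ‖r • circDir θ‖ = r := by
  rw [norm_smul, norm_circDir, mul_one, Real.norm_of_nonneg hr]

lemma norm_smul_circDir' (r : ℝ) (θ : ℝ) : ‖r • circDir θ‖ = |r| := by
  rw [norm_smul, norm_circDir, mul_one, Real.norm_eq_abs]

/-- rotated direction -/
def circPerp (θ : ℝ) : E2 :=
  EuclideanSpace.single 0 (-Real.sin θ) + EuclideanSpace.single 1 (Real.cos θ)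

lemma single_eq_smul (i : Fin 2) (a : ℝ) :
    (EuclideanSpace.single i a : E2) = a • EuclideanSpace.single i 1 := by
  ext j; simp

lemma circDir_eq (θ : ℝ) : circDir θ = Real.cos θ • (EuclideanSpace.single 0 1 : E2) +
    Real.sin θ • (EuclideanSpace.single 1 1 : E2) := by
  rw [circDir, single_eq_smul 0, single_eq_smul 1]

lemma circPerp_eq (θ : ℝ) : circPerp θ = (-Real.sin θ) • (EuclideanSpace.single 0 1 : E2) +
    Real.cos θ • (EuclideanSpace.single 1 1 : E2) := by
  rw [circPerp, single_eq_smul 0, single_eq_smul 1]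

lemma hasDerivAt_circDir (θ : ℝ) : HasDerivAt circDir (circPerp θ) θ := by
  have : circDir = fun θ => Real.cos θ • (EuclideanSpace.single 0 1 : E2) +
    Real.sin θ • (EuclideanSpace.single 1 1 : E2) := funext circDir_eq
  rw [this, circPerp_eq]
  exact ((Real.hasDerivAt_cos θ).smul_const _).add ((Real.hasDerivAt_sin θ).smul_const _)

lemma hasDerivAt_circPerp (θ : ℝ) : HasDerivAt circPerp (-circDir θ) θ := by
  have : circPerp = fun θ => (-Real.sin θ) • (EuclideanSpace.single 0 1 : E2) +
    Real.cos θ • (EuclideanSpace.single 1 1 : E2) := funext circPerp_eq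
  rw [this, circDir_eq]
  have := ((Real.hasDerivAt_sin θ).neg.smul_const (EuclideanSpace.single 0 1 : E2)).add
    ((Real.hasDerivAt_cos θ).smul_const (EuclideanSpace.single 1 1 : E2))
  convert! this using 1
  rw [neg_add, neg_smul, neg_smul]

lemma continuous_circDir : Continuous circDir :=
  continuous_iff_continuousAt.2 fun θ => (hasDerivAt_circDir θ).continuousAt
lemma continuous_circPerp : Continuous circPerp :=
  continuous_iff_continuousAt.2 fun θ => (hasDerivAt_circPerp θ).continuousAt

lemma circDir_two_pi : circDir (2 * π) = circDir 0 := by simp [circDir]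
lemma circPerp_two_pi : circPerp (2 * π) = circPerp 0 := by simp [circPerp]

lemma circDir_periodic : Function.Periodic circDir (2 * π) := by
  intro θ; simp [circDir]

/-- every vector is in polar form -/
lemma exists_polar (z : E2) : ∃ θ : ℝ, z = ‖z‖ • circDir θ := by
  by_cases hz : z = 0
  · exact ⟨0, by simp [hz]⟩
  let w : ℂ := ⟨z 0, z 1⟩
  have hw : ‖w‖ = ‖z‖ := by
    rw [EuclideanSpace.norm_eq, Complex.norm_def, Complex.normSq_apply]
    simp [w, pow_two]
  refine ⟨Complex.arg w, ?_⟩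
  have hw0 : w ≠ 0 := by
    intro h; rw [h] at hw; simp at hw; exact hz (norm_eq_zero.1 hw.symm)
  ext j
  fin_cases j
  · simp only [Fin.zero_eta, PiLp.smul_apply, circDir_zero, smul_eq_mul]
    rw [Complex.cos_arg hw0, hw]; field_simp [norm_ne_zero_iff.2 hz]; simp [w]
  · simp only [Fin.mk_one, PiLp.smul_apply, circDir_one, smul_eq_mul]
    rw [Complex.sin_arg, hw]; field_simp [norm_ne_zero_iff.2 hz]; simp [w]

/-- second derivative -/
def D2 (k : E2 → ℝ) (z : E2) : E2 →L[ℝ] E2 →L[ℝ] ℝ := fderiv ℝ (fun y => fderiv ℝ k y) z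

lemma lap_eq {k : E2 → ℝ} {z : E2} (h : DifferentiableAt ℝ (fun y => fderiv ℝ k y) z) :
    lap k z = ∑ i : Fin 2, D2 k z (EuclideanSpace.single i 1) (EuclideanSpace.single i 1) := by
  unfold lap D2
  refine Finset.sum_congr rfl fun i _ => ?_
  have := h.hasFDerivAt.clm_apply (hasFDerivAt_const (EuclideanSpace.single i (1:ℝ) : E2) z)
  rw [this.fderiv]
  simp

lemma D2_polar {k : E2 → ℝ} {z : E2} (h : DifferentiableAt ℝ (fun y => fderiv ℝ k y) z) (θ : ℝ) :
    D2 k z (circDir θ) (circDir θ) + D2 k z (circPerp θ) (circPerp θ) = lap k z := by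
  rw [lap_eq h, circDir_eq, circPerp_eq]
  simp only [map_add, map_smul, add_apply, smul_apply,
    smul_eq_mul, Fin.sum_univ_two]
  have := Real.sin_sq_add_cos_sq θ
  linear_combination (D2 k z (EuclideanSpace.single 0 1) (EuclideanSpace.single 0 1) +
    D2 k z (EuclideanSpace.single 1 1) (EuclideanSpace.single 1 1)) * this

lemma c2_facts {k : E2 → ℝ} {S : Set E2} (hS : IsOpen S) (hk : ContDiffOn ℝ 2 k S) :
    ContinuousOn k S ∧ ContinuousOn (fun y => fderiv ℝ k y) S ∧ ContinuousOn (D2 k) S ∧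
    (∀ z ∈ S, HasFDerivAt k (fderiv ℝ k z) z) ∧
    (∀ z ∈ S, HasFDerivAt (fun y => fderiv ℝ k y) (D2 k z) z) := by
  have h1 : ContDiffOn ℝ 1 (fun y => fderiv ℝ k y) S :=
    hk.fderiv_of_isOpen hS (by norm_num)
  refine ⟨hk.continuousOn, h1.continuousOn, ?_, ?_, ?_⟩
  · exact h1.continuousOn_fderiv_of_isOpen hS le_rfl
  · intro z hz
    exact ((hk.differentiableOn (by norm_num)).differentiableAt (hS.mem_nhds hz)).hasFDerivAt
  · intro z hz
    exact ((h1.differentiableOn (by norm_num)).differentiableAt (hS.mem_nhds hz)).hasFDerivAt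

/-- Fourier mode on circles -/
def mode (k : E2 → ℝ) (c : E2) (m : ℕ) (α : ℝ) (r : ℝ) : ℝ :=
  ∫ θ in (0:ℝ)..(2 * π), k (c + r • circDir θ) * Real.cos (m * θ - α)
def mode1 (k : E2 → ℝ) (c : E2) (m : ℕ) (α : ℝ) (r : ℝ) : ℝ :=
  ∫ θ in (0:ℝ)..(2 * π), fderiv ℝ k (c + r • circDir θ) (circDir θ) * Real.cos (m * θ - α)
def mode2 (k : E2 → ℝ) (c : E2) (m : ℕ) (α : ℝ) (r : ℝ) : ℝ :=
  ∫ θ in (0:ℝ)..(2 * π), D2 k (c + r • circDir θ) (circDir θ) (circDir θ) * Real.cos (m * θ - α)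

lemma mem_ball_polar {c : E2} {r R : ℝ} (hr : r ∈ Set.Ioo (-R) R) (θ : ℝ) :
    c + r • circDir θ ∈ ball c R := by
  rw [mem_ball, dist_eq_norm, add_sub_cancel_left, norm_smul_circDir']
  exact abs_lt.2 hr

section
variable {k : E2 → ℝ} {c : E2} {R : ℝ}

lemma contOn_polar {F : Type*} [TopologicalSpace F] {g : E2 → F} (hg : ContinuousOn g (ball c R)) :
    ContinuousOn (fun q : ℝ × ℝ => g (c + q.1 • circDir q.2)) (Set.Ioo (-R) R ×ˢ Set.univ) := by
  refine hg.comp ?_ ?_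
  · have := continuous_circDir
    fun_prop
  · intro q hq; exact mem_ball_polar hq.1 q.2

lemma hasDerivAt_mode (hk : ContDiffOn ℝ 2 k (ball c R)) (m : ℕ) (α : ℝ) {r : ℝ}
    (hr : r ∈ Set.Ioo (-R) R) : HasDerivAt (mode k c m α) (mode1 k c m α r) r := by
  obtain ⟨h0, h1, h2, h3, h4⟩ := c2_facts isOpen_ball hk
  refine hasDerivAt_param (G := fun r θ => k (c + r • circDir θ) * Real.cos (m * θ - α))
    (G' := fun r θ => fderiv ℝ k (c + r • circDir θ) (circDir θ) * Real.cos (m * θ - α))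
    ?_ ?_ ?_ hr _ _
  · intro r hr θ
    refine HasDerivAt.mul_const ?_ _
    have : HasDerivAt (fun r : ℝ => c + r • circDir θ) (circDir θ) r := by
      simpa using ((hasDerivAt_id r).smul_const (circDir θ)).const_add c
    exact (h3 _ (mem_ball_polar hr θ)).comp_hasDerivAt r this
  · refine (contOn_polar h0).mul ?_
    fun_prop
  · refine ((contOn_polar h1).clm_apply ?_).mul ?_
    · exact (continuous_circDir.comp continuous_snd).continuousOn
    · fun_prop

lemma hasDerivAt_mode1 (hk : ContDiffOn ℝ 2 k (ball c R)) (m : ℕ) (α : ℝ) {r : ℝ}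
    (hr : r ∈ Set.Ioo (-R) R) : HasDerivAt (mode1 k c m α) (mode2 k c m α r) r := by
  obtain ⟨h0, h1, h2, h3, h4⟩ := c2_facts isOpen_ball hk
  have hcd : ContinuousOn (fun q : ℝ × ℝ => circDir q.2) (Set.Ioo (-R) R ×ˢ Set.univ) :=
    (continuous_circDir.comp continuous_snd).continuousOn
  refine hasDerivAt_param
    (G := fun r θ => fderiv ℝ k (c + r • circDir θ) (circDir θ) * Real.cos (m * θ - α))
    (G' := fun r θ => D2 k (c + r • circDir θ) (circDir θ) (circDir θ) * Real.cos (m * θ - α))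
    ?_ ?_ ?_ hr _ _
  · intro r hr θ
    refine HasDerivAt.mul_const ?_ _
    have : HasDerivAt (fun r : ℝ => c + r • circDir θ) (circDir θ) r := by
      simpa using ((hasDerivAt_id r).smul_const (circDir θ)).const_add c
    have := (h4 _ (mem_ball_polar hr θ)).comp_hasDerivAt r this
    have h5 := this.clm_apply (hasDerivAt_const r (circDir θ))
    simpa using h5
  · refine ((contOn_polar h1).clm_apply hcd).mul ?_
    fun_prop
  · refine (((contOn_polar h2).clm_apply hcd).clm_apply hcd).mul ?_
    fun_prop

/-- the ODE for modes. -/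
lemma mode_ode (hk : ContDiffOn ℝ 2 k (ball c R)) (m : ℕ) (α : ℝ) {r : ℝ}
    (hr : r ∈ Set.Ioo (-R) R) :
    r ^ 2 * mode2 k c m α r + r * mode1 k c m α r - m ^ 2 * mode k c m α r =
      r ^ 2 * mode (lap k) c m α r := by
  obtain ⟨h0, h1, h2, h3, h4⟩ := c2_facts isOpen_ball hk
  have hcd := continuous_circDir
  have hcp := continuous_circPerp
  have hcont : Continuous fun θ : ℝ => ((c + r • circDir θ : E2)) := by fun_prop
  have hmem : ∀ θ, c + r • circDir θ ∈ ball c R := fun θ => mem_ball_polar hr θ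
  have hk0 : Continuous fun θ => k (c + r • circDir θ) := h0.comp_continuous hcont hmem
  have hk1 : Continuous fun θ => fderiv ℝ k (c + r • circDir θ) := h1.comp_continuous hcont hmem
  have hk2 : Continuous fun θ => D2 k (c + r • circDir θ) := h2.comp_continuous hcont hmem
  set a : ℝ → ℝ := fun θ => k (c + r • circDir θ)
  set a1 : ℝ → ℝ := fun θ => r * fderiv ℝ k (c + r • circDir θ) (circPerp θ)
  set a2 : ℝ → ℝ := fun θ => r ^ 2 * D2 k (c + r • circDir θ) (circPerp θ) (circPerp θ)
    - r * fderiv ℝ k (c + r • circDir θ) (circDir θ)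
  have hpath : ∀ θ, HasDerivAt (fun θ : ℝ => c + r • circDir θ) (r • circPerp θ) θ := fun θ =>
    ((hasDerivAt_circDir θ).const_smul r).const_add c
  have ha : ∀ θ, HasDerivAt a (a1 θ) θ := by
    intro θ
    have := (h3 _ (hmem θ)).comp_hasDerivAt θ (hpath θ)
    convert! this using 1
    simp [a1]
  have ha1 : ∀ θ, HasDerivAt a1 (a2 θ) θ := by
    intro θ
    have := (h4 _ (hmem θ)).comp_hasDerivAt θ (hpath θ)
    have h5 := (this.clm_apply (hasDerivAt_circPerp θ)).const_mul r
    convert! h5 using 1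
    simp [a2]; ring
  have hca1 : Continuous a1 := by
    have := hk1.clm_apply hcp
    fun_prop
  have hca2 : Continuous a2 := by
    have := hk1.clm_apply hcd
    have h' := (hk2.clm_apply hcp).clm_apply hcp
    fun_prop
  set b : ℝ → ℝ := fun θ => Real.cos (m * θ - α)
  set b1 : ℝ → ℝ := fun θ => - (m * Real.sin (m * θ - α))
  set b2 : ℝ → ℝ := fun θ => - (m ^ 2 * Real.cos (m * θ - α))
  have hlin : ∀ θ : ℝ, HasDerivAt (fun θ : ℝ => m * θ - α) m θ := fun θ => by
    simpa using ((hasDerivAt_id θ).const_mul (m : ℝ)).sub_const α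
  have hb : ∀ θ, HasDerivAt b (b1 θ) θ := fun θ => by
    have := (hlin θ).cos
    convert! this using 1; simp [b1]; ring
  have hb1 : ∀ θ, HasDerivAt b1 (b2 θ) θ := fun θ => by
    have := ((hlin θ).sin.const_mul (m : ℝ)).neg
    convert! this using 1; simp [b2]; ring
  have hcb : Continuous b := by fun_prop
  have hcb1 : Continuous b1 := by fun_prop
  have hcb2 : Continuous b2 := by fun_prop
  have hper : m * (2 * π) - α = -α + m * (2 * π) := by ring
  have hb2pi : b (2 * π) = b 0 := by
    simp only [b]; rw [hper, Real.cos_add_nat_mul_two_pi]; simp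
  have hb12pi : b1 (2 * π) = b1 0 := by
    simp only [b1]; rw [hper, Real.sin_add_nat_mul_two_pi]; simp
  have ha2pi : a (2 * π) = a 0 := by simp only [a, circDir_two_pi]
  have ha12pi : a1 (2 * π) = a1 0 := by simp only [a1, circDir_two_pi, circPerp_two_pi]
  have e1 := intervalIntegral.integral_mul_deriv_eq_deriv_mul (a := 0) (b := 2 * π)
    (fun θ _ => ha θ) (fun θ _ => hb1 θ) (hca1.intervalIntegrable _ _)
    (hcb2.intervalIntegrable _ _)
  have e2 := intervalIntegral.integral_mul_deriv_eq_deriv_mul (a := 0) (b := 2 * π)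
    (fun θ _ => ha1 θ) (fun θ _ => hb θ) (hca2.intervalIntegrable _ _)
    (hcb1.intervalIntegrable _ _)
  rw [ha2pi, hb12pi, sub_self, zero_sub] at e1
  rw [ha12pi, hb2pi, sub_self, zero_sub] at e2
  have e3 : ∫ θ in (0:ℝ)..2 * π, a θ * b2 θ = ∫ θ in (0:ℝ)..2 * π, a2 θ * b θ := by
    rw [e1, e2, neg_neg]
  have e4 : ∫ θ in (0:ℝ)..2 * π, a θ * b2 θ = - (m ^ 2 * mode k c m α r) := by
    simp only [mode, ← intervalIntegral.integral_const_mul, ← intervalIntegral.integral_neg]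
    congr 1; ext θ; simp only [b2, a]; ring
  have hc1 : Continuous fun θ => fderiv ℝ k (c + r • circDir θ) (circDir θ) * b θ :=
    (hk1.clm_apply hcd).mul hcb
  have hc2 : Continuous fun θ => D2 k (c + r • circDir θ) (circDir θ) (circDir θ) * b θ :=
    ((hk2.clm_apply hcd).clm_apply hcd).mul hcb
  have e5 : r ^ 2 * mode2 k c m α r + r * mode1 k c m α r + ∫ θ in (0:ℝ)..2 * π, a2 θ * b θ =
      r ^ 2 * mode (lap k) c m α r := by
    simp only [mode2, mode1, mode, ← intervalIntegral.integral_const_mul]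
    rw [← intervalIntegral.integral_add, ← intervalIntegral.integral_add]
    · congr 1; ext θ
      rw [← D2_polar (h4 _ (hmem θ)).differentiableAt θ]
      simp only [a2, b]; ring
    · exact ((hc2.const_mul _).add (hc1.const_mul _)).intervalIntegrable _ _
    · exact (hca2.mul hcb).intervalIntegrable _ _
    · exact (hc2.const_mul _).intervalIntegrable _ _
    · exact (hc1.const_mul _).intervalIntegrable _ _
  rw [← e5, ← e3, e4]; ring

end

lemma max_principle {d d1 d2 : ℝ → ℝ} {a b : ℝ}
    (hc : ContinuousOn d (Set.Icc a b))
    (h1 : ∀ r ∈ Set.Ioo a b, HasDerivAt d (d1 r) r)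
    (h2 : ∀ r ∈ Set.Ioo a b, HasDerivAt d1 (d2 r) r)
    (hpos : ∀ r ∈ Set.Ioo a b, 0 < d r → 0 < r ^ 2 * d2 r + r * d1 r)
    (da : d a ≤ 0) (db : d b ≤ 0) : ∀ r ∈ Set.Icc a b, d r ≤ 0 := by
  by_contra! hcon
  obtain ⟨r0, hr0, hd0⟩ := hcon
  obtain ⟨x, hx, hmax⟩ := isCompact_Icc.exists_isMaxOn ⟨r0, hr0⟩ hc
  have hdx : 0 < d x := lt_of_lt_of_le hd0 (hmax hr0)
  have hxI : x ∈ Set.Ioo a b := by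
    refine ⟨lt_of_le_of_ne hx.1 ?_, lt_of_le_of_ne hx.2 ?_⟩
    · rintro rfl; linarith
    · rintro rfl; linarith
  have hloc : IsLocalMax d x := hmax.isLocalMax (Icc_mem_nhds hxI.1 hxI.2)
  have hd1 : d1 x = 0 := hloc.hasDerivAt_eq_zero (h1 x hxI)
  have hp := hpos x hxI hdx
  rw [hd1, mul_zero, add_zero] at hp
  have hd2 : 0 < d2 x := by
    by_contra! h
    have := mul_nonpos_of_nonneg_of_nonpos (sq_nonneg x) h
    linarith
  have hev : deriv d =ᶠ[𝓝 x] d1 := by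
    filter_upwards [isOpen_Ioo.mem_nhds hxI] with y hy using (h1 y hy).deriv
  have hdd : deriv (deriv d) x = d2 x := by
    rw [hev.deriv_eq, (h2 x hxI).deriv]
  have hmin : IsLocalMin d x := isLocalMin_of_deriv_deriv_pos (by rw [hdd]; exact hd2)
    (by rw [(h1 x hxI).deriv, hd1]) (h1 x hxI).continuousAt
  have hconst : d =ᶠ[𝓝 x] fun _ => d x := by
    filter_upwards [hloc, hmin] with y h h' using le_antisymm h h'
  have : deriv d =ᶠ[𝓝 x] fun _ => 0 := by
    have := hconst.deriv
    simpa using this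
  have h0 : deriv (deriv d) x = 0 := by
    rw [this.deriv_eq]; simp
  linarith

/-- one-sided building block of the Volterra comparison -/
lemma volterra_mono {d d1 d2 : ℝ → ℝ} {a b : ℝ} (ha : 0 < a) (hab : a ≤ b)
    (h1 : ∀ r ∈ Set.Icc a b, HasDerivAt d (d1 r) r)
    (h2 : ∀ r ∈ Set.Icc a b, HasDerivAt d1 (d2 r) r)
    (hd : ∀ r ∈ Set.Ioo a b, 0 ≤ r ^ 2 * d2 r + r * d1 r)
    (h0 : 0 ≤ d1 a) : d a ≤ d b ∧ 0 ≤ d1 b := by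
  have hg : ∀ r ∈ Set.Icc a b, HasDerivAt (fun r => r * d1 r) (1 * d1 r + r * d2 r) r :=
    fun r hr => (hasDerivAt_id r).mul (h2 r hr)
  have hmono : MonotoneOn (fun r => r * d1 r) (Set.Icc a b) := by
    refine monotoneOn_of_hasDerivWithinAt_nonneg (f' := fun r => 1 * d1 r + r * d2 r)
      (convex_Icc a b) (fun r hr => (hg r hr).continuousAt.continuousWithinAt) ?_ ?_
    · intro r hr
      rw [interior_Icc] at hr
      exact (hg r (Set.Ioo_subset_Icc_self hr)).hasDerivWithinAt
    · intro r hr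
      rw [interior_Icc] at hr
      have hr0 : 0 < r := ha.trans hr.1
      have := hd r hr
      have h' : 0 ≤ r * (1 * d1 r + r * d2 r) := by nlinarith
      exact nonneg_of_mul_nonneg_right h' hr0
  have hd1 : ∀ r ∈ Set.Icc a b, 0 ≤ d1 r := by
    intro r hr
    have := hmono (Set.left_mem_Icc.2 hab) hr hr.1
    have hr0 : 0 < r := ha.trans_le hr.1
    have h' : 0 ≤ r * d1 r := le_trans (mul_nonneg ha.le h0) this
    exact nonneg_of_mul_nonneg_right h' hr0
  have hmd : MonotoneOn d (Set.Icc a b) := by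
    refine monotoneOn_of_hasDerivWithinAt_nonneg (f' := d1)
      (convex_Icc a b) (fun r hr => (h1 r hr).continuousAt.continuousWithinAt) ?_ ?_
    · intro r hr
      rw [interior_Icc] at hr
      exact (h1 r (Set.Ioo_subset_Icc_self hr)).hasDerivWithinAt
    · intro r hr
      rw [interior_Icc] at hr
      exact hd1 r (Set.Ioo_subset_Icc_self hr)
  exact ⟨hmd (Set.left_mem_Icc.2 hab) (Set.right_mem_Icc.2 hab) hab,
    hd1 b (Set.right_mem_Icc.2 hab)⟩

lemma volterra {f f1 f2 Φ Φ1 Φ2 : ℝ → ℝ} {a b : ℝ} (ha : 0 ≤ a)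
    (h1 : ∀ r ∈ Set.Ioo a b, HasDerivAt f (f1 r) r)
    (h2 : ∀ r ∈ Set.Ioo a b, HasDerivAt f1 (f2 r) r)
    (H1 : ∀ r ∈ Set.Ioo a b, HasDerivAt Φ (Φ1 r) r)
    (H2 : ∀ r ∈ Set.Ioo a b, HasDerivAt Φ1 (Φ2 r) r)
    (hcmp : ∀ r ∈ Set.Ioo a b, |f r| ≤ Φ r → |r ^ 2 * f2 r + r * f1 r| ≤ r ^ 2 * Φ2 r + r * Φ1 r)
    (hini : ∀ᶠ r in 𝓝[>] a, |f r| < Φ r ∧ |f1 r| ≤ Φ1 r) :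
    ∀ r ∈ Set.Ioo a b, |f r| ≤ Φ r ∧ |f1 r| ≤ Φ1 r := by
  intro r0 hr0
  obtain ⟨a', ⟨hfa, hf1a⟩, ha'⟩ :=
    (hini.and (Ioo_mem_nhdsGT hr0.1)).exists
  have ha'0 : 0 < a' := lt_of_le_of_lt ha ha'.1
  have hsub : ∀ b' ≤ r0, Set.Icc a' b' ⊆ Set.Ioo a b := fun b' hb' y hy =>
    ⟨ha'.1.trans_le hy.1, (hy.2.trans hb').trans_lt hr0.2⟩
  have key : ∀ b', a' ≤ b' → b' ≤ r0 → (∀ r ∈ Set.Ioo a' b', |f r| ≤ Φ r) →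
      |f b'| < Φ b' ∧ |f1 b'| ≤ Φ1 b' := by
    intro b' hb1 hb2 hle
    have hs := hsub b' hb2
    have A := volterra_mono (d := fun r => Φ r - f r) (d1 := fun r => Φ1 r - f1 r)
      (d2 := fun r => Φ2 r - f2 r) ha'0 hb1 (fun r hr => (H1 r (hs hr)).sub (h1 r (hs hr)))
      (fun r hr => (H2 r (hs hr)).sub (h2 r (hs hr)))
      (fun r hr => by
        have := (abs_le.1 (hcmp r (hs (Set.Ioo_subset_Icc_self hr)) (hle r hr))).2
        linarith) (by have := (abs_le.1 hf1a).2; linarith)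
    have B := volterra_mono (d := fun r => Φ r + f r) (d1 := fun r => Φ1 r + f1 r)
      (d2 := fun r => Φ2 r + f2 r) ha'0 hb1 (fun r hr => (H1 r (hs hr)).add (h1 r (hs hr)))
      (fun r hr => (H2 r (hs hr)).add (h2 r (hs hr)))
      (fun r hr => by
        have := (abs_le.1 (hcmp r (hs (Set.Ioo_subset_Icc_self hr)) (hle r hr))).1
        linarith) (by have := (abs_le.1 hf1a).1; linarith)
    have := abs_lt.1 hfa
    refine ⟨abs_lt.2 ⟨?_, ?_⟩, abs_le.2 ⟨?_, ?_⟩⟩ <;>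
      linarith [A.1, A.2, B.1, B.2, this.1, this.2]
  have hcont : ContinuousOn (fun r => |f r| - Φ r) (Set.Icc a' r0) := fun r hr => by
    have hm := hsub r0 le_rfl hr
    exact ((h1 r hm).continuousAt.abs.sub (H1 r hm).continuousAt).continuousWithinAt
  have hall : ∀ r ∈ Set.Icc a' r0, |f r| < Φ r := by
    by_contra! hcon
    obtain ⟨y, hy, hyy⟩ := hcon
    set S := Set.Icc a' r0 ∩ (fun r => |f r| - Φ r) ⁻¹' Set.Ici 0
    have hS : IsClosed S := hcont.preimage_isClosed_of_isClosed isClosed_Icc isClosed_Ici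
    have hne : S.Nonempty := ⟨y, hy, by simpa using hyy⟩
    have hbdd : BddBelow S := ⟨a', fun z hz => hz.1.1⟩
    have hm := hS.csInf_mem hne hbdd
    set t := sInf S
    have := key t hm.1.1 hm.1.2 (fun r hr => by
      by_contra! hc'
      have : r ∈ S := ⟨⟨hr.1.le, hr.2.le.trans hm.1.2⟩, by simpa using hc'.le⟩
      exact absurd (csInf_le hbdd this) (not_le.2 hr.2))
    have h3 := hm.2
    simp at h3
    linarith [this.1]
  have := key r0 ha'.2.le le_rfl (fun r hr => (hall r (Set.Ioo_subset_Icc_self hr)).le)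
  exact ⟨this.1.le, this.2⟩

lemma fourier_sup {q : ℝ → ℝ} (hq : Continuous q) (hper : Function.Periodic q (2 * π))
    {c : ℕ → ℝ} (hc : Summable c)
    (h : ∀ (m : ℕ) (α : ℝ), |∫ θ in (0:ℝ)..(2 * π), q θ * Real.cos (m * θ - α)| ≤ c m) (θ : ℝ) :
    |q θ| ≤ ∑' m, c m := by
  have : Fact (0 < 2 * π) := ⟨by positivity⟩
  have hc0 : ∀ m, 0 ≤ c m := fun m => (abs_nonneg _).trans (h m 0)
  let Q : AddCircle (2 * π) → ℂ := fun x => ((hper.lift x : ℝ) : ℂ)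
  have hQc : Continuous Q := by
    refine Complex.continuous_ofReal.comp ?_
    exact continuous_coinduced_dom.mpr hq
  let F : C(AddCircle (2 * π), ℂ) := ⟨Q, hQc⟩
  have hF : ∀ t : ℝ, F (t : AddCircle (2 * π)) = (q t : ℂ) := fun t => by
    simp [F, Q]
  have hcoef : ∀ n : ℤ, ‖fourierCoeff F n‖ ≤ c n.natAbs / π := by
    intro n
    rw [fourierCoeff_eq_intervalIntegral F n 0, zero_add]
    obtain ⟨σ, hσ1, hσ⟩ : ∃ σ : ℝ, |σ| = 1 ∧ (n : ℝ) = σ * (n.natAbs : ℝ) := by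
      rcases Int.natAbs_eq n with hn | hn
      · exact ⟨1, by simp, by rw [one_mul]; exact (congrArg (Int.cast : ℤ → ℝ) hn).trans (Int.cast_natCast _)⟩
      · exact ⟨-1, by simp, by rw [neg_one_mul]; exact (congrArg (Int.cast : ℤ → ℝ) hn).trans (by rw [Int.cast_neg, Int.cast_natCast])⟩
    set m := n.natAbs
    set I1 : ℝ := ∫ θ in (0:ℝ)..(2 * π), q θ * Real.cos (m * θ - 0)
    set I2 : ℝ := ∫ θ in (0:ℝ)..(2 * π), q θ * Real.cos (m * θ - π / 2)
    have e : (∫ x in (0:ℝ)..(2 * π), (fourier (-n) (x : AddCircle (2 * π)) : ℂ) • F (x : AddCircle (2 * π)))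
        = (I1 : ℂ) - (σ * I2 : ℝ) * Complex.I := by
      have e1 : ∀ x : ℝ, (fourier (-n) (x : AddCircle (2 * π)) : ℂ) • F (x : AddCircle (2 * π)) =
          ((q x * Real.cos (m * x - 0) : ℝ) : ℂ) -
            ((σ * (q x * Real.cos (m * x - π / 2)) : ℝ) : ℂ) * Complex.I := by
        intro x
        rw [hF, fourier_coe_apply]
        have : (2 * π * Complex.I * ((-n : ℤ) : ℂ) * x / ((2 * π : ℝ) : ℂ)) =
            ((-(σ * (m * x)) : ℝ) : ℂ) * Complex.I := by
          have h2 : ((n : ℤ) : ℂ) = ((σ * (m : ℝ) : ℝ) : ℂ) := by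
            rw [← hσ]; simp
          have hpi : (π : ℂ) ≠ 0 := by exact_mod_cast Real.pi_ne_zero
          push_cast at h2 ⊢
          rw [h2]; field_simp
        rw [this, Complex.exp_mul_I, ← Complex.ofReal_cos, ← Complex.ofReal_sin,
          Real.cos_sub_pi_div_two, sub_zero, Real.cos_neg, Real.sin_neg]
        have hs : Real.cos (σ * (m * x)) = Real.cos (m * x) ∧
            Real.sin (σ * (m * x)) = σ * Real.sin (m * x) := by
          rcases (abs_eq (by norm_num)).1 hσ1 with hs | hs <;> rw [hs] <;> simp
        rw [hs.1, hs.2]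
        simp only [smul_eq_mul]
        push_cast; ring
      simp_rw [e1]
      rw [intervalIntegral.integral_sub, intervalIntegral.integral_mul_const,
        intervalIntegral.integral_ofReal, intervalIntegral.integral_ofReal,
        intervalIntegral.integral_const_mul]
      · apply Continuous.intervalIntegrable; fun_prop
      · apply Continuous.intervalIntegrable; fun_prop
    rw [e]
    have n1 : ‖(I1 : ℂ)‖ ≤ c m := by rw [Complex.norm_real]; exact h m 0
    have n2 : ‖((σ * I2 : ℝ) : ℂ) * Complex.I‖ ≤ c m := by
      rw [norm_mul, Complex.norm_I, mul_one, Complex.norm_real, Real.norm_eq_abs, abs_mul, hσ1,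
        one_mul]
      exact h m (π / 2)
    have n3 := (norm_sub_le (I1 : ℂ) (((σ * I2 : ℝ) : ℂ) * Complex.I)).trans (add_le_add n1 n2)
    rw [norm_smul, Real.norm_of_nonneg (by positivity)]
    calc 1 / (2 * π) * ‖(I1 : ℂ) - ((σ * I2 : ℝ) : ℂ) * Complex.I‖ ≤ 1 / (2 * π) * (c m + c m) := by gcongr
      _ = c m / π := by field_simp; ring
  have hs0 : Summable fun m : ℕ => c m / π := hc.div_const π
  have hsZ : HasSum (fun n : ℤ => c n.natAbs / π)
      ((∑' m, c m / π) + (∑' m : ℕ, c (m + 1) / π)) := by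
    have := HasSum.int_rec (f := fun m : ℕ => c m / π) (g := fun m : ℕ => c (m + 1) / π)
      hs0.hasSum (((summable_nat_add_iff 1).2 hs0).hasSum)
    convert! this using 1
    ext n
    cases n <;> simp
  have hsum : Summable (fourierCoeff F) :=
    Summable.of_norm_bounded hsZ.summable hcoef
  have hps := has_pointwise_sum_fourier_series_of_summable hsum (θ : AddCircle (2 * π))
  have hle : ‖F (θ : AddCircle (2 * π))‖ ≤ (∑' m, c m / π) + (∑' m : ℕ, c (m + 1) / π) := by
    rw [← hps.tsum_eq]
    refine tsum_of_norm_bounded hsZ fun n => ?_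
    rw [norm_smul]
    have : ‖fourier n (θ : AddCircle (2 * π))‖ = 1 := by
      rw [fourier_apply]; exact Circle.norm_coe _
    rw [this, mul_one]; exact hcoef n
  rw [hF, Complex.norm_real, Real.norm_eq_abs] at hle
  have h2 : (∑' m : ℕ, c (m + 1) / π) ≤ ∑' m, c m / π := by
    rw [hs0.tsum_eq_zero_add]
    have : 0 ≤ c 0 / π := div_nonneg (hc0 0) pi_pos.le
    linarith
  have h3 : (∑' m, c m / π) = (∑' m, c m) / π := tsum_div_const
  have h4 : 0 ≤ ∑' m, c m := tsum_nonneg hc0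
  have h5 : (∑' m, c m) / π ≤ (∑' m, c m) / 2 :=
    div_le_div_of_nonneg_left h4 (by norm_num) (by linarith [Real.pi_gt_three])
  linarith

/-- data of a Fourier mode of a solution of the linearised problem -/
structure ModeData (τ h b R1 : ℝ) (m : ℕ) (q f f1 f2 : ℝ → ℝ) : Prop where
  hd1 : ∀ r ∈ Set.Icc 0 R1, HasDerivAt f (f1 r) r
  hd2 : ∀ r ∈ Set.Icc 0 R1, HasDerivAt f1 (f2 r) r
  f0 : f 0 = 0
  f10 : f1 0 = 0
  q0 : ∀ r, 0 < r → 0 ≤ q r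
  q2 : ∀ r, 0 < r → q r ≤ 2
  q64 : ∀ r, 0 < r → q r ≤ 64 / r ^ 2
  ode2 : ∀ r ∈ Set.Ioo 0 R1, |r ^ 2 * f2 r + r * f1 r - (m ^ 2 - q r) * f r| ≤ h * r ^ 2
  odet : ∀ r ∈ Set.Ioo 0 R1, |r ^ 2 * f2 r + r * f1 r - (m ^ 2 - q r) * f r| ≤ h * r ^ τ
  bd : |f R1| ≤ b * R1 ^ τ

lemma hasDerivAt_crpow (A s : ℝ) {r : ℝ} (hr : 0 < r) :
    HasDerivAt (fun r => A * r ^ s) (A * s * r ^ (s - 1)) r := by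
  have := (Real.hasDerivAt_rpow_const (p := s) (Or.inl hr.ne')).const_mul A
  simpa [mul_assoc] using this

lemma euler_rpow (A s : ℝ) {r : ℝ} (hr : 0 < r) :
    r ^ 2 * (A * s * (s - 1) * r ^ (s - 1 - 1)) + r * (A * s * r ^ (s - 1)) = s ^ 2 * (A * r ^ s) := by
  rw [Real.rpow_sub_one hr.ne', Real.rpow_sub_one hr.ne']
  field_simp
  ring

/-- `|f|` from two one-sided comparisons -/
lemma ModeData.neg {τ h b R1 : ℝ} {m : ℕ} {q f f1 f2 : ℝ → ℝ} (D : ModeData τ h b R1 m q f f1 f2) :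
    ModeData τ h b R1 m q (fun r => -f r) (fun r => -f1 r) (fun r => -f2 r) where
  hd1 := fun r hr => (D.hd1 r hr).neg
  hd2 := fun r hr => (D.hd2 r hr).neg
  f0 := by simp [D.f0]
  f10 := by simp [D.f10]
  q0 := D.q0
  q2 := D.q2
  q64 := D.q64
  ode2 := fun r hr => by
    rw [← abs_neg]; convert D.ode2 r hr using 2; ring
  odet := fun r hr => by
    rw [← abs_neg]; convert D.odet r hr using 2; ring
  bd := by rw [abs_neg]; exact D.bd

lemma mode_ge_two {τ h b R1 : ℝ} {m : ℕ} {q f f1 f2 : ℝ → ℝ} (hm : 2 ≤ m)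
    (hτ : 0 < τ) (hτ1 : τ < 1) (hh : 0 ≤ h) (hb : 0 ≤ b) (hR1 : 0 < R1)
    (D : ModeData τ h b R1 m q f f1 f2) :
    ∀ r ∈ Set.Icc 0 R1, f r ≤ b * R1 ^ τ * (r / R1) ^ (m - 1) + h / (m ^ 2 - 3) * r ^ τ := by
  have hm2 : (2:ℝ) ≤ m := by exact_mod_cast hm
  obtain ⟨j, rfl⟩ : ∃ j, m = j + 1 := ⟨m - 1, by omega⟩
  simp only [Nat.add_sub_cancel]
  have hj : (1:ℝ) ≤ j := by exact_mod_cast (by omega : 1 ≤ j)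
  push_cast at hm2 ⊢
  have hden : (0:ℝ) < ((j:ℝ) + 1) ^ 2 - 3 := by nlinarith
  set B := b * R1 ^ τ with hB
  have hB0 : 0 ≤ B := by positivity
  set A := h / (((j:ℝ) + 1) ^ 2 - 3) with hA
  have hA0 : 0 ≤ A := by positivity
  have hAh : A * (((j:ℝ) + 1) ^ 2 - 3) = h := by rw [hA]; field_simp
  have hP1 : ∀ r : ℝ, HasDerivAt (fun r => B * (r / R1) ^ j) (B * (j * (r / R1) ^ (j - 1) * (1 / R1))) r := by
    intro r
    have := (((hasDerivAt_id r).div_const R1).pow j).const_mul B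
    exact this
  have hP2 : ∀ r : ℝ, HasDerivAt (fun r => B * (j * (r / R1) ^ (j - 1) * (1 / R1)))
      (B * (j * (((j - 1 : ℕ) : ℝ) * (r / R1) ^ (j - 1 - 1) * (1 / R1)) * (1 / R1))) r := by
    intro r
    have := (((((hasDerivAt_id r).div_const R1).pow (j - 1)).const_mul (j:ℝ)).mul_const (1 / R1)).const_mul B
    exact this
  have key := max_principle (a := 0) (b := R1)
    (d := fun r => f r - (B * (r / R1) ^ j + A * r ^ τ))
    (d1 := fun r => f1 r - (B * (j * (r / R1) ^ (j - 1) * (1 / R1)) + A * τ * r ^ (τ - 1)))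
    (d2 := fun r => f2 r - (B * (j * (((j - 1 : ℕ) : ℝ) * (r / R1) ^ (j - 1 - 1) * (1 / R1)) * (1 / R1)) + A * τ * (τ - 1) * r ^ (τ - 1 - 1))) ?_ ?_ ?_ ?_ ?_ ?_
  · intro r hr
    have := key r hr
    linarith
  · refine ContinuousOn.sub (fun r hr => (D.hd1 r hr).continuousAt.continuousWithinAt) ?_
    refine ContinuousOn.add (by fun_prop) ?_
    exact (continuousOn_const.mul ((Real.continuous_rpow_const hτ.le).continuousOn))
  · intro r hr
    exact (D.hd1 r (Set.Ioo_subset_Icc_self hr)).sub ((hP1 r).add (hasDerivAt_crpow A τ hr.1))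
  · intro r hr
    exact (D.hd2 r (Set.Ioo_subset_Icc_self hr)).sub ((hP2 r).add (hasDerivAt_crpow (A * τ) (τ - 1) hr.1))
  · intro r hr hpos
    have hr0 := hr.1
    have e1 : r ^ 2 * (B * (j * (((j - 1 : ℕ) : ℝ) * (r / R1) ^ (j - 1 - 1) * (1 / R1)) * (1 / R1)))
        + r * (B * (j * (r / R1) ^ (j - 1) * (1 / R1))) = j ^ 2 * (B * (r / R1) ^ j) := by
      rcases Nat.lt_or_ge j 2 with h2 | h2
      · have : j = 1 := by
          have : 1 ≤ j := by exact_mod_cast hj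
          omega
        subst this; simp; ring
      · obtain ⟨i, rfl⟩ : ∃ i, j = i + 2 := ⟨j - 2, by omega⟩
        simp only [Nat.add_sub_cancel, show i + 2 - 1 = i + 1 by omega]
        push_cast
        have hy : r = r / R1 * R1 := by field_simp
        generalize r / R1 = y at hy ⊢
        rw [hy]
        field_simp
        ring
    have e2 := euler_rpow A τ hr0
    have ho := (abs_le.1 (D.odet r hr)).1
    push_cast at ho
    have hq0 := D.q0 r hr0
    have hq2 := D.q2 r hr0
    set X := B * (r / R1) ^ j with hX
    set Y := A * r ^ τ with hY
    have hX0 : 0 ≤ X := by positivity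
    have hY0 : 0 ≤ Y := by positivity
    have hhY : h * r ^ τ = (((j:ℝ) + 1) ^ 2 - 3) * Y := by rw [hY, ← hAh]; ring
    have hfr : X + Y < f r := by linarith
    have h1 : (((j:ℝ) + 1) ^ 2 - 2) * (X + Y) < (((j:ℝ) + 1) ^ 2 - q r) * f r := by
      have : 0 < ((j:ℝ) + 1) ^ 2 - 2 := by nlinarith
      calc _ < (((j:ℝ) + 1) ^ 2 - 2) * f r := by gcongr
        _ ≤ _ := by gcongr; linarith
    have h2 : (j:ℝ) ^ 2 * X + τ ^ 2 * Y + (((j:ℝ) + 1) ^ 2 - 3) * Y ≤ (((j:ℝ) + 1) ^ 2 - 2) * (X + Y) := by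
      have : τ ^ 2 ≤ 1 := by nlinarith
      have := mul_le_mul_of_nonneg_right this hY0
      nlinarith [mul_nonneg (sub_nonneg.2 hj) hX0]
    have e3 : r ^ 2 * (f2 r - (B * (j * (((j - 1 : ℕ) : ℝ) * (r / R1) ^ (j - 1 - 1) * (1 / R1)) * (1 / R1)) + A * τ * (τ - 1) * r ^ (τ - 1 - 1))) + r * (f1 r - (B * (j * (r / R1) ^ (j - 1) * (1 / R1)) + A * τ * r ^ (τ - 1)))
      = r ^ 2 * f2 r + r * f1 r - j ^ 2 * X - τ ^ 2 * Y := by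
      rw [← e1, ← e2]; ring
    rw [e3]; linarith
  · simp only [D.f0, zero_div]
    rw [Real.zero_rpow hτ.ne', zero_pow (by have : 1 ≤ j := by exact_mod_cast hj
                                            omega)]
    simp
  · simp only [div_self hR1.ne', one_pow, mul_one]
    have := (abs_le.1 D.bd).2
    have : 0 ≤ A * R1 ^ τ := by positivity
    linarith

lemma mode_inner {τ h b R1 Rs : ℝ} {m : ℕ} {q f f1 f2 : ℝ → ℝ} (hm : m ≤ 1)
    (hh : 0 < h) (hRs : 1 ≤ Rs) (hR1 : 2 * Rs ≤ R1)
    (D : ModeData τ h b R1 m q f f1 f2) :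
    ∀ r ∈ Set.Ioo 0 (2 * Rs), |f r| ≤ 8 * h * Rs * r ^ (3/2:ℝ) ∧ |f1 r| ≤ 8 * h * Rs * (3/2) * r ^ (1/2:ℝ) := by
  set A := 8 * h * Rs with hA
  have hA0 : 0 < A := by positivity
  have hsub : ∀ r ∈ Set.Ioo 0 (2 * Rs), r ∈ Set.Ioo 0 R1 := fun r hr => ⟨hr.1, by linarith [hr.2]⟩
  have e12 : (3/2:ℝ) - 1 = 1/2 := by norm_num
  have key := volterra (a := 0) (b := 2 * Rs) le_rfl (f := f) (f1 := f1) (f2 := f2)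
    (Φ := fun r => A * r ^ (3/2:ℝ)) (Φ1 := fun r => A * (3/2) * r ^ ((3/2:ℝ) - 1))
    (Φ2 := fun r => A * (3/2) * ((3/2) - 1) * r ^ ((3/2:ℝ) - 1 - 1))
    (fun r hr => D.hd1 r (Set.Ioo_subset_Icc_self (hsub r hr)))
    (fun r hr => D.hd2 r (Set.Ioo_subset_Icc_self (hsub r hr)))
    (fun r hr => hasDerivAt_crpow _ _ hr.1)
    (fun r hr => hasDerivAt_crpow _ _ hr.1) ?_ ?_
  · intro r hr
    have := key r hr
    rwa [e12] at this
  · intro r hr hf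
    have e2 := euler_rpow A (3/2) hr.1
    rw [e2]
    have ho := D.ode2 r (hsub r hr)
    have hq0 := D.q0 r hr.1
    have hq2 := D.q2 r hr.1
    have hm2 : |(m:ℝ) ^ 2 - q r| ≤ 2 := by
      interval_cases m
      · rw [abs_le]; constructor <;> push_cast <;> linarith
      · rw [abs_le]; constructor <;> push_cast <;> linarith
    have h1 : |r ^ 2 * f2 r + r * f1 r| ≤ |r ^ 2 * f2 r + r * f1 r - (m ^ 2 - q r) * f r| + |(m ^ 2 - q r) * f r| := by
      have := abs_add_le (r ^ 2 * f2 r + r * f1 r - (m ^ 2 - q r) * f r) ((m ^ 2 - q r) * f r)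
      simpa using this
    rw [abs_mul] at h1
    have h2 : |(m:ℝ) ^ 2 - q r| * |f r| ≤ 2 * (A * r ^ (3/2:ℝ)) := by gcongr
    have h3 : r ^ 2 = r ^ (3/2:ℝ) * r ^ (1/2:ℝ) := by
      rw [← Real.rpow_add hr.1]; norm_num
    have h4 : r ^ (1/2:ℝ) ≤ 2 * Rs := by
      calc r ^ (1/2:ℝ) ≤ (2 * Rs) ^ (1/2:ℝ) := by
            have := hr.1.le; have := hr.2.le; gcongr
        _ ≤ (2 * Rs) ^ (1:ℝ) := Real.rpow_le_rpow_of_exponent_le (by linarith) (by norm_num)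
        _ = _ := Real.rpow_one _
    have h5 : h * r ^ 2 ≤ 1/4 * (A * r ^ (3/2:ℝ)) := by
      rw [h3, hA]
      have : 0 ≤ r ^ (3/2:ℝ) := Real.rpow_nonneg hr.1.le _
      nlinarith [mul_nonneg hh.le this, mul_le_mul_of_nonneg_left h4 (mul_nonneg hh.le this)]
    linarith
  · -- initial behaviour
    have hR10 : (0:ℝ) ∈ Set.Icc 0 R1 := ⟨le_rfl, by linarith⟩
    have hd := D.hd2 0 hR10
    have hO := hd.isBigO_sub
    rw [D.f10] at hO
    obtain ⟨C, hC⟩ := hO.bound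
    obtain ⟨δ, hδ, hball⟩ := Metric.eventually_nhds_iff.1 hC
    set C' := max C 1
    have hC' : 0 < C' := lt_of_lt_of_le one_pos (le_max_right _ _)
    have hf1 : ∀ r, 0 ≤ r → r < δ → |f1 r| ≤ C' * r := by
      intro r h0 h1
      have := hball (y := r) (by simpa [abs_of_nonneg h0] using h1)
      simp only [sub_zero, Real.norm_eq_abs, abs_of_nonneg h0] at this
      exact this.trans (by gcongr; exact le_max_left _ _)
    have hf : ∀ r, 0 < r → r < δ → r ≤ R1 → |f r| ≤ C' * r * r := by
      intro r h0 h1 h2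
      have := Convex.norm_image_sub_le_of_norm_hasDerivWithin_le (f := f) (f' := f1) (s := Set.Icc 0 r) (x := 0) (y := r) (C := C' * r)
        (fun x hx => (D.hd1 x ⟨hx.1, hx.2.trans h2⟩).hasDerivWithinAt)
        (fun x hx => (hf1 x hx.1 (hx.2.trans_lt h1)).trans (by have := hx.2; gcongr)) (convex_Icc _ _)
        ⟨le_rfl, h0.le⟩ ⟨h0.le, le_rfl⟩
      simpa [D.f0, abs_of_pos h0] using this
    have hev : ∀ᶠ r in 𝓝[>] (0:ℝ), C' * r ^ (1/2:ℝ) < A := by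
      have : Tendsto (fun r : ℝ => C' * r ^ (1/2:ℝ)) (𝓝[>] 0) (𝓝 (C' * 0 ^ (1/2:ℝ))) :=
        ((continuous_const.mul (Real.continuous_rpow_const (by norm_num))).tendsto 0).mono_left nhdsWithin_le_nhds
      rw [Real.zero_rpow (by norm_num), mul_zero] at this
      exact this.eventually_lt_const hA0
    have hev2 : ∀ᶠ r in 𝓝[>] (0:ℝ), r < min δ R1 :=
      (eventually_lt_nhds (lt_min hδ (by linarith))).filter_mono nhdsWithin_le_nhds
    filter_upwards [hev, hev2, self_mem_nhdsWithin] with r h1 h2 h3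
    have h3 : 0 < r := h3
    have hs : 0 < r ^ (1/2:ℝ) := Real.rpow_pos_of_pos h3 _
    have er : r = r ^ (1/2:ℝ) * r ^ (1/2:ℝ) := by rw [← Real.rpow_add h3]; norm_num
    have er2 : r ^ (3/2:ℝ) = r * r ^ (1/2:ℝ) := by
      rw [← Real.rpow_one_add' h3.le (by norm_num)]; norm_num
    constructor
    · refine (hf r h3 (h2.trans_le (min_le_left _ _)) (h2.le.trans (min_le_right _ _))).trans_lt ?_
      rw [er2]
      calc C' * r * r = (C' * r ^ (1/2:ℝ)) * (r * r ^ (1/2:ℝ)) := by nth_rw 2 [er]; ring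
        _ < A * (r * r ^ (1/2:ℝ)) := by gcongr
    · refine (hf1 r h3.le (h2.trans_le (min_le_left _ _))).trans ?_
      rw [e12]
      calc C' * r = (C' * r ^ (1/2:ℝ)) * r ^ (1/2:ℝ) := by nth_rw 1 [er]; ring
        _ ≤ A * r ^ (1/2:ℝ) := by gcongr
        _ ≤ _ := by nlinarith


lemma mode_zero_outer {τ h b R1 Rs : ℝ} {q f f1 f2 : ℝ → ℝ} (hτ : 0 < τ) (hτ1 : τ < 1)
    (hh : 0 < h) (hRs : 1 ≤ Rs) (hRτ : 128 ≤ τ ^ 2 * Rs ^ 2) (hR1 : 2 * Rs ≤ R1)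
    (D : ModeData τ h b R1 0 q f f1 f2) :
    ∀ r ∈ Set.Ioo Rs R1, |f r| ≤ (h * (100 * Rs ^ 3 / τ ^ 2)) * r ^ τ := by
  have hin := mode_inner (by norm_num) hh hRs hR1 D
  have hL : 1 ≤ 1 / τ ^ 2 := by
    rw [le_div_iff₀ (by positivity)]; nlinarith
  set A := h * (100 * Rs ^ 3 / τ ^ 2) with hA
  have hA0 : 0 < A := by positivity
  have hAτ : A * τ ^ 2 = 100 * h * Rs ^ 3 := by rw [hA]; field_simp
  have hsub : ∀ r ∈ Set.Ioo Rs R1, r ∈ Set.Ioo 0 R1 := fun r hr => ⟨by linarith [hr.1], hr.2⟩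
  have key := volterra (a := Rs) (b := R1) (by linarith) (f := f) (f1 := f1) (f2 := f2)
    (Φ := fun r => A * r ^ τ) (Φ1 := fun r => A * τ * r ^ (τ - 1))
    (Φ2 := fun r => A * τ * (τ - 1) * r ^ (τ - 1 - 1))
    (fun r hr => D.hd1 r (Set.Ioo_subset_Icc_self (hsub r hr)))
    (fun r hr => D.hd2 r (Set.Ioo_subset_Icc_self (hsub r hr)))
    (fun r hr => hasDerivAt_crpow _ _ (hsub r hr).1)
    (fun r hr => hasDerivAt_crpow _ _ (hsub r hr).1) ?_ ?_
  · intro r hr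
    exact (key r hr).1
  · intro r hr hf
    have hr0 := (hsub r hr).1
    rw [euler_rpow A τ hr0]
    have ho := D.odet r (hsub r hr)
    have hq0 := D.q0 r hr0
    have hq2 := D.q64 r hr0
    have hq : q r ≤ τ ^ 2 / 2 := by
      refine hq2.trans ?_
      rw [div_le_iff₀ (by positivity)]
      have : Rs ^ 2 ≤ r ^ 2 := by have := hr.1.le; gcongr
      nlinarith [sq_nonneg τ]
    have h1 : |r ^ 2 * f2 r + r * f1 r| ≤ h * r ^ τ + q r * |f r| := by
      have := abs_add_le (r ^ 2 * f2 r + r * f1 r - (((0:ℕ):ℝ) ^ 2 - q r) * f r) ((((0:ℕ):ℝ) ^ 2 - q r) * f r)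
      rw [sub_add_cancel, abs_mul] at this
      refine this.trans (add_le_add ho (le_of_eq ?_))
      congr 1
      simp [abs_of_nonneg hq0]
    have h2 : q r * |f r| ≤ τ ^ 2 / 2 * (A * r ^ τ) := by gcongr
    have h3 : 0 ≤ r ^ τ := Real.rpow_nonneg hr0.le _
    have h4 : h ≤ τ ^ 2 / 2 * A := by
      have : 1 ≤ Rs ^ 3 := one_le_pow₀ hRs
      nlinarith
    nlinarith [mul_le_mul_of_nonneg_right h4 h3]
  · have : ∀ᶠ r in 𝓝[>] Rs, r < 2 * Rs :=
      (eventually_lt_nhds (by linarith)).filter_mono nhdsWithin_le_nhds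
    filter_upwards [this, self_mem_nhdsWithin] with r h1 h2
    have h2 : Rs < r := h2
    have hr0 : 0 < r := by linarith
    obtain ⟨i1, i2⟩ := hin r ⟨hr0, h1⟩
    have b1 : (1:ℝ) ≤ r ^ τ := Real.one_le_rpow (by linarith) hτ.le
    have b2 : r ^ (3/2:ℝ) ≤ (2 * Rs) ^ 2 := by
      calc r ^ (3/2:ℝ) ≤ r ^ (2:ℝ) := Real.rpow_le_rpow_of_exponent_le (by linarith) (by norm_num)
        _ = r ^ 2 := by norm_num
        _ ≤ _ := by gcongr
    have b3 : r ^ (1/2:ℝ) ≤ 4 * Rs ^ 2 * r ^ (τ - 1) := by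
      have : r ^ (1/2:ℝ) = r ^ (3/2 - τ) * r ^ (τ - 1) := by
        rw [← Real.rpow_add hr0]; congr 1; ring
      rw [this]
      gcongr
      calc r ^ (3/2-τ) ≤ r ^ (2:ℝ) := Real.rpow_le_rpow_of_exponent_le (by linarith) (by linarith)
        _ = r ^ 2 := by norm_num
        _ ≤ (2 * Rs) ^ 2 := by gcongr
        _ = _ := by ring
    have hAge : 100 * h * Rs ^ 3 ≤ A := by
      rw [← hAτ]
      have : τ ^ 2 ≤ 1 := by nlinarith
      exact mul_le_of_le_one_right hA0.le this
    have hAτ1 : 100 * h * Rs ^ 3 ≤ A * τ := by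
      rw [← hAτ]; nlinarith [mul_pos hA0 hτ]
    constructor
    · calc |f r| ≤ 8 * h * Rs * (2 * Rs) ^ 2 := i1.trans (by gcongr)
        _ = 32 * h * Rs ^ 3 := by ring
        _ < 100 * h * Rs ^ 3 := by
          have : 0 < h * Rs ^ 3 := by positivity
          linarith
        _ ≤ A := hAge
        _ ≤ _ := by nlinarith
    · have hp : 0 ≤ r ^ (τ - 1) := Real.rpow_nonneg hr0.le _
      calc |f1 r| ≤ 8 * h * Rs * (3/2) * (4 * Rs ^ 2 * r ^ (τ - 1)) := i2.trans (by gcongr)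
        _ = 48 * h * Rs ^ 3 * r ^ (τ - 1) := by ring
        _ ≤ 100 * h * Rs ^ 3 * r ^ (τ - 1) := by gcongr; norm_num
        _ ≤ _ := by gcongr

lemma mode_one_outer {τ h b R1 Rs : ℝ} {q f f1 f2 : ℝ → ℝ} (hτ : 0 < τ) (hτ1 : τ < 1)
    (hh : 0 < h) (hb : 0 ≤ b) (hRs : 1 ≤ Rs) (hRτ : 128 ≤ (1 - τ ^ 2) * Rs ^ 2) (hR1 : 2 * Rs ≤ R1)
    (D : ModeData τ h b R1 1 q f f1 f2) :
    ∀ r ∈ Set.Icc Rs R1, f r ≤ (h * (100 * Rs ^ 3 / (1 - τ ^ 2)) + b) * r ^ τ := by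
  have hin := mode_inner (by norm_num) hh hRs hR1 D
  have hτ2 : 0 < 1 - τ ^ 2 := by nlinarith
  have hL : 1 ≤ 1 / (1 - τ ^ 2) := by
    rw [le_div_iff₀ (by positivity)]; nlinarith
  set A := h * (100 * Rs ^ 3 / (1 - τ ^ 2)) + b with hA
  have hA0 : 0 < A := by positivity
  have hAτ : 100 * h * Rs ^ 3 ≤ A * (1 - τ ^ 2) := by
    rw [hA, add_mul]
    have : h * (100 * Rs ^ 3 / (1 - τ ^ 2)) * (1 - τ ^ 2) = 100 * h * Rs ^ 3 := by field_simp
    rw [this]; nlinarith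
  have hAge : 100 * h * Rs ^ 3 ≤ A := by nlinarith
  have hsub : ∀ r ∈ Set.Icc Rs R1, r ∈ Set.Icc 0 R1 := fun r hr => ⟨by linarith [hr.1], hr.2⟩
  have hsub' : ∀ r ∈ Set.Ioo Rs R1, r ∈ Set.Ioo 0 R1 := fun r hr => ⟨by linarith [hr.1], hr.2⟩
  have key := max_principle (a := Rs) (b := R1)
    (d := fun r => f r - A * r ^ τ)
    (d1 := fun r => f1 r - A * τ * r ^ (τ - 1))
    (d2 := fun r => f2 r - A * τ * (τ - 1) * r ^ (τ - 1 - 1)) ?_ ?_ ?_ ?_ ?_ ?_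
  · intro r hr
    have := key r hr
    linarith
  · refine ContinuousOn.sub (fun r hr => (D.hd1 r (hsub r hr)).continuousAt.continuousWithinAt) ?_
    exact (continuousOn_const.mul ((Real.continuous_rpow_const hτ.le).continuousOn))
  · intro r hr
    exact (D.hd1 r (Set.Ioo_subset_Icc_self (hsub' r hr))).sub (hasDerivAt_crpow A τ (hsub' r hr).1)
  · intro r hr
    exact (D.hd2 r (Set.Ioo_subset_Icc_self (hsub' r hr))).sub (hasDerivAt_crpow (A * τ) (τ - 1) (hsub' r hr).1)
  · intro r hr hpos
    have hr0 := (hsub' r hr).1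
    have e2 := euler_rpow A τ hr0
    have ho := (abs_le.1 (D.odet r (hsub' r hr))).1
    have hq0 := D.q0 r hr0
    have hq2 := D.q64 r hr0
    have hq : q r ≤ (1 - τ ^ 2) / 2 := by
      refine hq2.trans ?_
      rw [div_le_iff₀ (by positivity)]
      have : Rs ^ 2 ≤ r ^ 2 := by have := hr.1.le; gcongr
      nlinarith [sq_nonneg τ]
    have h3 : 0 ≤ r ^ τ := Real.rpow_nonneg hr0.le _
    have h4 : h ≤ (1 - τ ^ 2) / 2 * A := by
      have : 1 ≤ Rs ^ 3 := one_le_pow₀ hRs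
      nlinarith
    have hfr : A * r ^ τ < f r := by linarith
    have hco : 0 < 1 - (1 - τ ^ 2) / 2 := by nlinarith
    have h1 : (1 - (1 - τ ^ 2) / 2) * (A * r ^ τ) < (((1:ℕ):ℝ) ^ 2 - q r) * f r := by
      have hA1 : 0 ≤ A * r ^ τ := by positivity
      calc _ < (1 - (1 - τ ^ 2) / 2) * f r := by gcongr
        _ ≤ _ := by
          apply mul_le_mul_of_nonneg_right _ (by linarith)
          push_cast; linarith
    have := mul_le_mul_of_nonneg_right h4 h3
    have e3 : r ^ 2 * (f2 r - A * τ * (τ - 1) * r ^ (τ - 1 - 1)) + r * (f1 r - A * τ * r ^ (τ - 1))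
      = r ^ 2 * f2 r + r * f1 r - τ ^ 2 * (A * r ^ τ) := by rw [← e2]; ring
    rw [e3]
    have e4 : (1 - (1 - τ ^ 2) / 2) * (A * r ^ τ) - (1 - τ ^ 2) / 2 * A * r ^ τ - τ ^ 2 * (A * r ^ τ) = 0 := by ring
    generalize (((1:ℕ):ℝ) ^ 2 - q r) * f r = Z at ho h1
    linarith only [ho, h1, e4, this]
  · have := (hin Rs ⟨by linarith, by linarith⟩).1
    have b1 : (1:ℝ) ≤ Rs ^ τ := Real.one_le_rpow (by linarith) hτ.le
    have b2 : Rs ^ (3/2:ℝ) ≤ Rs ^ 2 := by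
      calc Rs ^ (3/2:ℝ) ≤ Rs ^ (2:ℝ) := Real.rpow_le_rpow_of_exponent_le (by linarith) (by norm_num)
        _ = Rs ^ 2 := by norm_num
    have : f Rs ≤ A * Rs ^ τ := by
      calc f Rs ≤ 8 * h * Rs * Rs ^ 2 := (le_abs_self _).trans (this.trans (by gcongr))
        _ = 8 * h * Rs ^ 3 := by ring
        _ ≤ 100 * h * Rs ^ 3 := by gcongr; norm_num
        _ ≤ A := hAge
        _ ≤ _ := by nlinarith
    linarith
  · have := (abs_le.1 D.bd).2
    have h2 : b * R1 ^ τ ≤ A * R1 ^ τ := by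
      have : 0 < R1 := by linarith
      gcongr
      have : 0 ≤ h * (100 * Rs ^ 3 / (1 - τ ^ 2)) := by positivity
      linarith
    linarith

lemma mode_bound {τ : ℝ} (hτ : 0 < τ) (hτ1 : τ < 1) : ∃ C0 Rs : ℝ, 0 < C0 ∧ 1 ≤ Rs ∧
    ∀ (h b R1 : ℝ) (m : ℕ) (q f f1 f2 : ℝ → ℝ), 0 < h → 0 ≤ b → 2 * Rs ≤ R1 →
    ModeData τ h b R1 m q f f1 f2 → ∀ r ∈ Set.Icc 0 (R1 / 2),
      |f r| ≤ C0 * (h + b) * (1 + r) ^ τ * ((1/2) ^ m + 1 / m ^ 2) := by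
  have hτ2 : 0 < 1 - τ ^ 2 := by nlinarith
  set κ := min (τ ^ 2) (1 - τ ^ 2)
  have hκ : 0 < κ := lt_min (by positivity) hτ2
  have hκ1 : κ ≤ 1 := (min_le_left _ _).trans (by nlinarith)
  set Rs := 128 / κ with hRsd
  have hRs : 1 ≤ Rs := by rw [hRsd, le_div_iff₀ hκ]; linarith
  have hκR : κ * Rs = 128 := by rw [hRsd]; field_simp
  have hκR2 : 128 ≤ κ * Rs ^ 2 := by nlinarith
  set L := 100 * Rs ^ 3 / κ with hLd
  have hL0 : 0 < L := by positivity
  have hL1 : 100 * Rs ^ 3 ≤ L := by rw [hLd, le_div_iff₀ hκ]; nlinarith [pow_pos (by linarith : 0 < Rs) 3]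
  have hLτ : 100 * Rs ^ 3 / τ ^ 2 ≤ L := by rw [hLd]; gcongr; exact min_le_left _ _
  have hLτ2 : 100 * Rs ^ 3 / (1 - τ ^ 2) ≤ L := by rw [hLd]; gcongr; exact min_le_right _ _
  refine ⟨8 * L + 8, Rs, by positivity, hRs, ?_⟩
  intro h b R1 m q f f1 f2 hh hb hR1 D r hr
  have hR10 : 0 < R1 := by linarith
  have hr1 : (1:ℝ) ≤ (1 + r) ^ τ := Real.one_le_rpow (by linarith [hr.1]) hτ.le
  have hrr : r ^ τ ≤ (1 + r) ^ τ := Real.rpow_le_rpow hr.1 (by linarith) hτ.le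
  rcases Nat.lt_or_ge m 2 with hm | hm
  · suffices |f r| ≤ L * (h + b) * (1 + r) ^ τ + b * (1 + r) ^ τ by
      have hc : (1/2:ℝ) ≤ (1/2) ^ m + 1 / (m:ℝ) ^ 2 := by
        interval_cases m <;> norm_num
      have hX : 0 ≤ (h + b) * (1 + r) ^ τ := by positivity
      calc |f r| ≤ L * (h + b) * (1 + r) ^ τ + b * (1 + r) ^ τ := this
        _ ≤ (8 * L + 8) * (h + b) * (1 + r) ^ τ * (1/2) := by
          nlinarith [mul_nonneg hh.le (by linarith : 0 ≤ (1 + r) ^ τ), mul_nonneg hb (by linarith : 0 ≤ (1 + r) ^ τ), mul_nonneg hL0.le hX]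
        _ ≤ _ := by
          apply mul_le_mul_of_nonneg_left hc
          positivity
    have hp : 0 ≤ (1 + r) ^ τ := by linarith
    rcases eq_or_lt_of_le hr.1 with h0 | h0
    · have e : f r = 0 := by rw [← h0, D.f0]
      rw [e, abs_zero]; positivity
    rcases le_or_gt r Rs with h1 | h1
    · have := (mode_inner (by omega) hh hRs hR1 D r ⟨h0, by linarith⟩).1
      have b2 : r ^ (3/2:ℝ) ≤ Rs ^ 2 := by
        calc r ^ (3/2:ℝ) ≤ Rs ^ (3/2:ℝ) := by gcongr
          _ ≤ Rs ^ (2:ℝ) := Real.rpow_le_rpow_of_exponent_le (by linarith) (by norm_num)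
          _ = Rs ^ 2 := by norm_num
      calc |f r| ≤ 8 * h * Rs * Rs ^ 2 := this.trans (by gcongr)
        _ = 8 * Rs ^ 3 * h := by ring
        _ ≤ L * h := by
          have : 0 ≤ Rs ^ 3 := by positivity
          gcongr; linarith
        _ ≤ L * (h + b) * (1 + r) ^ τ := by
          rw [mul_assoc]; gcongr; nlinarith
        _ ≤ _ := by linarith [mul_nonneg hb hp]
    · have hmain : |f r| ≤ (h * L + b) * r ^ τ := by
        interval_cases m
        · have := mode_zero_outer hτ hτ1 hh hRs (hκR2.trans (by gcongr; exact min_le_left _ _)) hR1 D r ⟨h1, by linarith [hr.2]⟩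
          refine this.trans ?_
          have : 0 ≤ r ^ τ := Real.rpow_nonneg h0.le _
          gcongr
          have := mul_le_mul_of_nonneg_left hLτ hh.le
          linarith
        · have A1 := mode_one_outer hτ hτ1 hh hb hRs (hκR2.trans (by gcongr; exact min_le_right _ _)) hR1 D r ⟨h1.le, by linarith [hr.2]⟩
          have A2 := mode_one_outer hτ hτ1 hh hb hRs (hκR2.trans (by gcongr; exact min_le_right _ _)) hR1 D.neg r ⟨h1.le, by linarith [hr.2]⟩
          have A3 : |f r| ≤ (h * (100 * Rs ^ 3 / (1 - τ ^ 2)) + b) * r ^ τ := abs_le.2 ⟨by linarith, A1⟩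
          refine A3.trans ?_
          have : 0 ≤ r ^ τ := Real.rpow_nonneg h0.le _
          gcongr
      calc |f r| ≤ (h * L + b) * r ^ τ := hmain
        _ ≤ (h * L + b) * (1 + r) ^ τ := by gcongr
        _ ≤ _ := by nlinarith [mul_nonneg (mul_nonneg hL0.le hb) hp]
  · have hm2 : (2:ℝ) ≤ m := by exact_mod_cast hm
    have A1 := mode_ge_two hm hτ hτ1 hh.le hb hR10 D r ⟨hr.1, by linarith [hr.2]⟩
    have A2 := mode_ge_two hm hτ hτ1 hh.le hb hR10 D.neg r ⟨hr.1, by linarith [hr.2]⟩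
    have A3 : |f r| ≤ b * R1 ^ τ * (r / R1) ^ (m - 1) + h / (m ^ 2 - 3) * r ^ τ := abs_le.2 ⟨by linarith, A1⟩
    have hx0 : 0 ≤ r / R1 := div_nonneg hr.1 hR10.le
    have hx1 : r / R1 ≤ 1 / 2 := by rw [div_le_iff₀ hR10]; linarith [hr.2]
    have B1 : b * R1 ^ τ * (r / R1) ^ (m - 1) ≤ b * r ^ τ * (4 * (1/2) ^ m) := by
      have e : (r / R1) ^ (m - 1) ≤ (r / R1) ^ τ * (4 * (1/2) ^ m) := by
        obtain ⟨j, rfl⟩ : ∃ j, m = j + 2 := ⟨m - 2, by omega⟩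
        rw [show j + 2 - 1 = j + 1 by omega, pow_succ]
        have : (4 * (1/2:ℝ) ^ (j + 2)) = (1/2) ^ j := by ring
        rw [this, mul_comm]
        gcongr
        calc r / R1 = (r / R1) ^ (1:ℝ) := (Real.rpow_one _).symm
          _ ≤ (r / R1) ^ τ := by
            apply Real.rpow_le_rpow_of_exponent_ge' hx0 (by linarith) hτ.le hτ1.le
      have e2 : r ^ τ = R1 ^ τ * (r / R1) ^ τ := by
        rw [← Real.mul_rpow hR10.le hx0]; congr 1; field_simp
      rw [e2]
      calc b * R1 ^ τ * (r / R1) ^ (m - 1) ≤ b * R1 ^ τ * ((r / R1) ^ τ * (4 * (1/2) ^ m)) := by gcongr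
        _ = _ := by ring
    have B2 : h / ((m:ℝ) ^ 2 - 3) * r ^ τ ≤ h * r ^ τ * (4 * (1 / (m:ℝ) ^ 2)) := by
      have : 1 / ((m:ℝ) ^ 2 - 3) ≤ 4 * (1 / (m:ℝ) ^ 2) := by
        rw [mul_one_div, div_le_div_iff₀ (by nlinarith) (by positivity)]
        nlinarith
      have h0 : 0 ≤ h * r ^ τ := mul_nonneg hh.le (Real.rpow_nonneg hr.1 _)
      calc h / ((m:ℝ) ^ 2 - 3) * r ^ τ = h * r ^ τ * (1 / ((m:ℝ) ^ 2 - 3)) := by ring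
        _ ≤ _ := by gcongr
    set P := (1/2:ℝ) ^ m
    set Q := 1 / (m:ℝ) ^ 2
    have hP : 0 ≤ P := by positivity
    have hQ : 0 ≤ Q := by positivity
    have hr0 : 0 ≤ r ^ τ := Real.rpow_nonneg hr.1 _
    calc |f r| ≤ b * r ^ τ * (4 * P) + h * r ^ τ * (4 * Q) := by linarith
      _ ≤ 4 * (h + b) * r ^ τ * (P + Q) := by nlinarith [mul_nonneg (mul_nonneg hh.le hr0) hP, mul_nonneg (mul_nonneg hb hr0) hQ]
      _ ≤ (8 * L + 8) * (h + b) * (1 + r) ^ τ * (P + Q) := by gcongr; linarith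

lemma expU (z : E2) : Real.exp (Ustd z) = 64 / (8 + ‖z‖ ^ 2) ^ 2 := by
  have h : 0 < 1 + ‖z‖ ^ 2 / 8 := by positivity
  have : Ustd z = Real.log ((1 + ‖z‖ ^ 2 / 8) ^ 2)⁻¹ := by
    rw [Real.log_inv, Real.log_pow, Ustd]; push_cast; ring
  rw [this, Real.exp_log (by positivity)]
  field_simp
  norm_num

lemma abs_mode_le {k : E2 → ℝ} {c : E2} {m : ℕ} {α r A : ℝ}
    (h : ∀ θ, |k (c + r • circDir θ)| ≤ A) : |mode k c m α r| ≤ 2 * π * A := by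
  have hA : 0 ≤ A := (abs_nonneg _).trans (h 0)
  have := intervalIntegral.norm_integral_le_of_norm_le_const (a := 0) (b := 2 * π) (C := A)
    (f := fun θ => k (c + r • circDir θ) * Real.cos (m * θ - α)) (fun θ _ => by
      rw [norm_mul]
      calc ‖k (c + r • circDir θ)‖ * ‖Real.cos (m * θ - α)‖ ≤ A * 1 :=
            mul_le_mul (h θ) (Real.abs_cos_le_one _) (norm_nonneg _) hA
        _ = A := mul_one A)
  rw [sub_zero, abs_of_pos (by positivity)] at this
  rw [mul_comm]; exact this


lemma continuousOn_lap {k : E2 → ℝ} {S : Set E2} (hS : IsOpen S) (hk : ContDiffOn ℝ 2 k S) :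
    ContinuousOn (lap k) S := by
  obtain ⟨h0, h1, h2, h3, h4⟩ := c2_facts hS hk
  have : Set.EqOn (lap k) (fun z => ∑ i : Fin 2, D2 k z (EuclideanSpace.single i 1) (EuclideanSpace.single i 1)) S :=
    fun z hz => lap_eq (h4 z hz).differentiableAt
  refine ContinuousOn.congr ?_ this
  refine continuousOn_finset_sum _ fun i _ => ?_
  exact (h2.clm_apply continuousOn_const).clm_apply continuousOn_const

lemma continuous_circle {g : E2 → ℝ} {c : E2} {r R : ℝ} (hg : ContinuousOn g (ball c R))
    (hr : r ∈ Set.Ioo (-R) R) : Continuous fun θ => g (c + r • circDir θ) := by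
  have hcd := continuous_circDir
  exact hg.comp_continuous (by fun_prop) fun θ => mem_ball_polar hr θ

lemma linear_est {τ : ℝ} (hτ : 0 < τ) (hτ1 : τ < 1) : ∃ C Rs : ℝ, 0 < C ∧ 1 ≤ Rs ∧
    ∀ (k : E2 → ℝ) (H B R1 R' : ℝ), 0 < H → 0 ≤ B → 2 * Rs ≤ R1 → R1 < R' →
    ContDiffOn ℝ 2 k (ball 0 R') → k 0 = 0 → fderiv ℝ k 0 = 0 →
    (∀ z, ‖z‖ ≤ R1 → |lap k z + Real.exp (Ustd z) * k z| ≤ H * (1 + ‖z‖) ^ (-5/2 + τ)) →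
    (∀ z, R1 / 2 ≤ ‖z‖ → ‖z‖ ≤ R1 → |k z| ≤ B * (1 + ‖z‖) ^ τ) →
    ∀ z, ‖z‖ ≤ R1 → |k z| ≤ C * (H + B) * (1 + ‖z‖) ^ τ := by
  obtain ⟨C0, Rs, hC0, hRs, hmb⟩ := mode_bound hτ hτ1
  have hsum : Summable fun m : ℕ => ((1/2:ℝ) ^ m + 1 / (m:ℝ) ^ 2) :=
    (summable_geometric_of_lt_one (by norm_num) (by norm_num)).add
      (Real.summable_one_div_nat_pow.2 (by norm_num))
  set S := ∑' m : ℕ, ((1/2:ℝ) ^ m + 1 / (m:ℝ) ^ 2) with hS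
  have hS0 : 0 ≤ S := tsum_nonneg fun m => by positivity
  refine ⟨C0 * (4 * π) * S + 1, Rs, by positivity, hRs, ?_⟩
  intro k H B R1 R' hH hB hR1 hR' hk hk0 hdk0 hE hbd z hz
  have hR10 : 1 ≤ R1 := by linarith
  have hz1 : (1:ℝ) ≤ (1 + ‖z‖) ^ τ := Real.one_le_rpow (by linarith [norm_nonneg z]) hτ.le
  rcases le_or_gt (R1 / 2) ‖z‖ with hz2 | hz2
  · refine (hbd z hz2 hz).trans ?_
    gcongr
    nlinarith [show 0 ≤ C0 * (4 * π) * S * (H + B) by positivity]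
  have hmem : ∀ r ∈ Set.Icc 0 R1, r ∈ Set.Ioo (-R') R' := fun r hr =>
    ⟨by linarith [hr.1, hr.2], by linarith [hr.2]⟩
  have hlapc := continuousOn_lap isOpen_ball hk
  have hD : ∀ (m : ℕ) (α : ℝ), ModeData τ (2 * π * H) (4 * π * B) R1 m
      (fun r => r ^ 2 * (64 / (8 + r ^ 2) ^ 2)) (mode k 0 m α) (mode1 k 0 m α) (mode2 k 0 m α) := by
    intro m α
    have hode : ∀ r ∈ Set.Ioo 0 R1, |r ^ 2 * mode2 k 0 m α r + r * mode1 k 0 m α r -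
        (m ^ 2 - r ^ 2 * (64 / (8 + r ^ 2) ^ 2)) * mode k 0 m α r| ≤
        r ^ 2 * (2 * π * (H * (1 + r) ^ (-5/2 + τ))) := by
      intro r hr
      have hr' := hmem r (Set.Ioo_subset_Icc_self hr)
      have e1 := mode_ode hk m α hr'
      have e2 : mode (lap k) 0 m α r + 64 / (8 + r ^ 2) ^ 2 * mode k 0 m α r =
          mode (fun z => lap k z + Real.exp (Ustd z) * k z) 0 m α r := by
        unfold mode
        rw [← intervalIntegral.integral_const_mul, ← intervalIntegral.integral_add]
        · refine intervalIntegral.integral_congr fun θ _ => ?_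
          simp only [expU, zero_add, norm_smul_circDir', sq_abs]
          ring
        · apply Continuous.intervalIntegrable
          exact (continuous_circle hlapc hr').mul (by fun_prop)
        · apply Continuous.intervalIntegrable
          exact continuous_const.mul ((continuous_circle hk.continuousOn hr').mul (by fun_prop))
      have e3 : |mode (fun z => lap k z + Real.exp (Ustd z) * k z) 0 m α r| ≤
          2 * π * (H * (1 + r) ^ (-5/2 + τ)) := by
        refine abs_mode_le fun θ => ?_
        have hn : ‖(0 + r • circDir θ : E2)‖ = r := by rw [zero_add, norm_smul_circDir hr.1.le]
        have := hE (0 + r • circDir θ) (by rw [hn]; exact hr.2.le)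
        rwa [hn] at this
      have e4 : r ^ 2 * mode2 k 0 m α r + r * mode1 k 0 m α r -
        (m ^ 2 - r ^ 2 * (64 / (8 + r ^ 2) ^ 2)) * mode k 0 m α r =
          r ^ 2 * mode (fun z => lap k z + Real.exp (Ustd z) * k z) 0 m α r := by
        rw [← e2, mul_add, ← e1]; ring
      rw [e4, abs_mul, abs_of_nonneg (sq_nonneg r)]
      gcongr
    refine ⟨fun r hr => hasDerivAt_mode hk m α (hmem r hr), fun r hr => hasDerivAt_mode1 hk m α (hmem r hr),
      by simp [mode, hk0], by simp [mode1, hdk0], ?_, ?_, ?_, ?_, ?_, ?_⟩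
    · intro r hr; positivity
    · intro r hr
      rw [mul_div_assoc', div_le_iff₀ (by positivity)]
      nlinarith [sq_nonneg (8 - r ^ 2)]
    · intro r hr
      rw [mul_div_assoc', div_le_div_iff₀ (by positivity) (by positivity)]
      nlinarith [sq_nonneg r]
    · intro r hr
      refine (hode r hr).trans ?_
      have : (1 + r) ^ (-5/2 + τ) ≤ 1 := Real.rpow_le_one_of_one_le_of_nonpos (by linarith [hr.1]) (by linarith)
      have h2 : 0 ≤ r ^ 2 * (2 * π * H) := by positivity
      calc r ^ 2 * (2 * π * (H * (1 + r) ^ (-5/2 + τ))) = r ^ 2 * (2 * π * H) * (1 + r) ^ (-5/2 + τ) := by ring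
        _ ≤ r ^ 2 * (2 * π * H) * 1 := by gcongr
        _ = _ := by ring
    · intro r hr
      refine (hode r hr).trans ?_
      have : r ^ 2 * (1 + r) ^ (-5/2 + τ) ≤ r ^ τ := by
        have h1 : (1 + r) ^ (-5/2 + τ) ≤ (1 + r) ^ (-2 + τ) :=
          Real.rpow_le_rpow_of_exponent_le (by linarith [hr.1]) (by linarith)
        have h2 : (1 + r) ^ (-2 + τ) ≤ r ^ (-2 + τ) :=
          Real.rpow_le_rpow_of_nonpos hr.1 (by linarith) (by linarith)
        have h3 : r ^ 2 * r ^ (-2 + τ) = r ^ τ := by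
          rw [← Real.rpow_two, ← Real.rpow_add hr.1]; congr 1; ring
        rw [← h3]
        have := hr.1
        gcongr
        exact h1.trans h2
      have h2 : 0 ≤ (2 * π * H) := by positivity
      calc r ^ 2 * (2 * π * (H * (1 + r) ^ (-5/2 + τ))) = (2 * π * H) * (r ^ 2 * (1 + r) ^ (-5/2 + τ)) := by ring
        _ ≤ _ := by gcongr
    · have h1 : |mode k 0 m α R1| ≤ 2 * π * (B * (1 + R1) ^ τ) := by
        refine abs_mode_le fun θ => ?_
        have hn : ‖(0 + R1 • circDir θ : E2)‖ = R1 := by rw [zero_add, norm_smul_circDir (by linarith)]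
        have := hbd (0 + R1 • circDir θ) (by rw [hn]; linarith) (by rw [hn])
        rwa [hn] at this
      have h2 : (1 + R1) ^ τ ≤ 2 * R1 ^ τ := by
        calc (1 + R1) ^ τ ≤ (2 * R1) ^ τ := by gcongr; linarith
          _ = 2 ^ τ * R1 ^ τ := Real.mul_rpow (by norm_num) (by linarith)
          _ ≤ 2 ^ (1:ℝ) * R1 ^ τ := by
            gcongr
            norm_num
          _ = _ := by rw [Real.rpow_one]
      calc _ ≤ 2 * π * (B * (1 + R1) ^ τ) := h1
        _ ≤ 2 * π * (B * (2 * R1 ^ τ)) := by gcongr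
        _ = _ := by ring
  obtain ⟨θ, hθ⟩ := exists_polar z
  have hzr : ‖z‖ ∈ Set.Icc 0 R1 := ⟨norm_nonneg z, hz⟩
  have := fourier_sup (q := fun θ => k (0 + ‖z‖ • circDir θ))
    (continuous_circle hk.continuousOn (hmem _ hzr))
    (fun θ => by simp only [circDir_periodic θ]) (hsum.mul_left (C0 * (2 * π * H + 4 * π * B) * (1 + ‖z‖) ^ τ))
    (fun m α => hmb (2 * π * H) (4 * π * B) R1 m _ _ _ _ (by positivity) (by positivity) hR1 (hD m α) ‖z‖ ⟨norm_nonneg z, hz2.le⟩) θ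
  rw [tsum_mul_left, ← hS, zero_add, ← hθ] at this
  refine this.trans ?_
  have hpi := Real.pi_pos
  calc C0 * (2 * π * H + 4 * π * B) * (1 + ‖z‖) ^ τ * S ≤ C0 * (4 * π * (H + B)) * (1 + ‖z‖) ^ τ * S := by
        gcongr; nlinarith [mul_pos hpi hH]
    _ = (C0 * (4 * π) * S) * (H + B) * (1 + ‖z‖) ^ τ := by ring
    _ ≤ _ := by
      gcongr
      linarith

/-- circle integral -/
def circInt (F : E2 → ℝ) (c : E2) (r : ℝ) : ℝ := ∫ θ in (0:ℝ)..(2 * π), F (c + r • circDir θ)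

lemma circInt_eq_mode (F : E2 → ℝ) (c : E2) (r : ℝ) : circInt F c r = mode F c 0 0 r := by
  simp [circInt, mode]

lemma polar_E2 (f : E2 → ℝ) :
    ∫ q in Set.Ioi (0:ℝ) ×ˢ Set.Ioo (-π) π, q.1 * f (q.1 • circDir q.2) = ∫ z, f z := by
  have h1 : MeasurePreserving (fun q : ℝ × ℝ => (WithLp.toLp 2 ((MeasurableEquiv.finTwoArrow (α := ℝ)).symm q) : E2)) :=
    (PiLp.volume_preserving_toLp (Fin 2)).comp ((volume_preserving_finTwoArrow ℝ).symm _)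
  have hemb : MeasurableEmbedding (fun q : ℝ × ℝ => (WithLp.toLp 2 ((MeasurableEquiv.finTwoArrow (α := ℝ)).symm q) : E2)) :=
    (MeasurableEquiv.toLp 2 (Fin 2 → ℝ)).measurableEmbedding.comp (MeasurableEquiv.measurableEmbedding _)
  rw [← h1.integral_comp hemb f]
  rw [← integral_comp_polarCoord_symm]
  refine integral_congr_ae (Eventually.of_forall fun q => ?_)
  simp only [smul_eq_mul]
  congr 2
  ext i
  fin_cases i <;> simp [circDir_zero, circDir_one]

lemma polar_annulus {F : E2 → ℝ} {c : E2} {R a b : ℝ} (hF : ContinuousOn F (ball c R))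
    (ha : 0 ≤ a) (hab : a ≤ b) (hb : b < R) :
    ∫ z in {z | ‖z - c‖ ∈ Set.Ioc a b}, F z = ∫ r in a..b, r * circInt F c r := by
  set S : Set E2 := {z | ‖z - c‖ ∈ Set.Ioc a b} with hS
  have hSm : MeasurableSet S := by
    have : Measurable fun z : E2 => ‖z - c‖ := by fun_prop
    exact this measurableSet_Ioc
  rw [← integral_indicator hSm, ← integral_add_left_eq_self _ c, ← polar_E2]
  have e1 : ∀ q ∈ Set.Ioi (0:ℝ) ×ˢ Set.Ioo (-π) π, q.1 * S.indicator F (c + q.1 • circDir q.2) =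
      (Set.Ioc a b ×ˢ Set.univ).indicator (fun q : ℝ × ℝ => q.1 * F (c + q.1 • circDir q.2)) q := by
    rintro ⟨r, θ⟩ ⟨hr, -⟩
    have hr : 0 < r := hr
    by_cases h : r ∈ Set.Ioc a b
    · rw [Set.indicator_of_mem, Set.indicator_of_mem]
      · exact ⟨h, trivial⟩
      · simp only [hS, Set.mem_ofPred_eq, add_sub_cancel_left, norm_smul_circDir hr.le]; exact h
    · rw [Set.indicator_of_notMem, Set.indicator_of_notMem, mul_zero]
      · exact fun hh => h hh.1
      · simp only [hS, Set.mem_ofPred_eq, add_sub_cancel_left, norm_smul_circDir hr.le]; exact h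
  rw [setIntegral_congr_fun (measurableSet_Ioi.prod measurableSet_Ioo) e1,
    setIntegral_indicator (measurableSet_Ioc.prod MeasurableSet.univ)]
  have e2 : (Set.Ioi (0:ℝ) ×ˢ Set.Ioo (-π) π) ∩ (Set.Ioc a b ×ˢ Set.univ) = Set.Ioc a b ×ˢ Set.Ioo (-π) π := by
    ext ⟨r, θ⟩
    simp only [Set.mem_inter_iff, Set.mem_prod, Set.mem_Ioi, Set.mem_Ioc, Set.mem_Ioo, Set.mem_univ]
    constructor
    · rintro ⟨⟨h1, h2⟩, h3, -⟩; exact ⟨h3, h2⟩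
    · rintro ⟨h1, h2⟩; exact ⟨⟨by linarith [h1.1], h2⟩, h1, trivial⟩
  rw [e2]
  have hcont : ContinuousOn (fun q : ℝ × ℝ => q.1 * F (c + q.1 • circDir q.2)) (Set.Icc a b ×ˢ Set.Icc (-π) π) := by
    refine ContinuousOn.mul (by fun_prop) ((contOn_polar hF).mono ?_)
    rintro ⟨r, θ⟩ ⟨h1, h2⟩
    exact ⟨⟨by linarith [h1.1], by linarith [h1.2]⟩, trivial⟩
  have hint : IntegrableOn (fun q : ℝ × ℝ => q.1 * F (c + q.1 • circDir q.2)) (Set.Ioc a b ×ˢ Set.Ioo (-π) π)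
      (volume.prod volume) :=
    (hcont.integrableOn_compact (isCompact_Icc.prod isCompact_Icc)).mono_set
      (Set.prod_mono Set.Ioc_subset_Icc_self Set.Ioo_subset_Icc_self)
  rw [show (volume : Measure (ℝ × ℝ)) = volume.prod volume from rfl, setIntegral_prod _ hint,
    intervalIntegral.integral_of_le hab]
  refine setIntegral_congr_fun measurableSet_Ioc fun r hr => ?_
  simp only
  rw [integral_const_mul]
  congr 1
  rw [← integral_Ioc_eq_integral_Ioo, ← intervalIntegral.integral_of_le (by linarith [Real.pi_pos]), circInt]
  have hper : Function.Periodic (fun θ => F (c + r • circDir θ)) (2 * π) := fun θ => by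
    simp only [circDir_periodic θ]
  have := hper.intervalIntegral_add_eq (-π) 0
  rw [zero_add] at this
  rw [← this]; congr 1; ring

lemma continuousOn_circInt {F : E2 → ℝ} {c : E2} {R : ℝ} (hF : ContinuousOn F (ball c R)) :
    ContinuousOn (circInt F c) (Set.Ioo (-R) R) := by
  intro r hr
  obtain ⟨δ, hδ, hsub⟩ : ∃ δ > 0, closedBall r δ ⊆ Set.Ioo (-R) R :=
    Metric.nhds_basis_closedBall.mem_iff.1 (isOpen_Ioo.mem_nhds hr)
  have hcomp : IsCompact (closedBall r δ ×ˢ Set.Icc 0 (2 * π)) :=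
    (isCompact_closedBall r δ).prod isCompact_Icc
  have hc2 := (contOn_polar hF)
  obtain ⟨M, hM⟩ := hcomp.exists_bound_of_continuousOn (hc2.mono (Set.prod_mono hsub (Set.subset_univ _)))
  refine ContinuousAt.continuousWithinAt ?_
  refine intervalIntegral.continuousAt_of_dominated_interval (bound := fun _ => M) ?_ ?_ ?_ ?_
  · filter_upwards [isOpen_Ioo.mem_nhds hr] with x hx
    exact (continuous_circle hF hx).aestronglyMeasurable
  · filter_upwards [closedBall_mem_nhds r hδ] with x hx
    refine Eventually.of_forall fun θ hθ => hM (x, θ) ⟨hx, ?_⟩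
    rw [Set.uIoc_of_le (by positivity)] at hθ
    exact Set.Ioc_subset_Icc_self hθ
  · exact intervalIntegrable_const
  · refine Eventually.of_forall fun θ _ => ?_
    have := hF.continuousAt (isOpen_ball.mem_nhds (mem_ball_polar (c := c) hr θ))
    exact this.comp' (f := fun r : ℝ => c + r • circDir θ) (by fun_prop)

lemma mono_from_zero {d d1 d2 : ℝ → ℝ} {b : ℝ} (hb : 0 ≤ b)
    (h1 : ∀ r ∈ Set.Icc 0 b, HasDerivAt d (d1 r) r)
    (h2 : ∀ r ∈ Set.Icc 0 b, HasDerivAt d1 (d2 r) r)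
    (hd : ∀ r ∈ Set.Ioo 0 b, 0 ≤ r ^ 2 * d2 r + r * d1 r) : d 0 ≤ d b ∧ 0 ≤ b * d1 b := by
  have hg : ∀ r ∈ Set.Icc 0 b, HasDerivAt (fun r => r * d1 r) (1 * d1 r + r * d2 r) r :=
    fun r hr => (hasDerivAt_id r).mul (h2 r hr)
  have hmono : MonotoneOn (fun r => r * d1 r) (Set.Icc 0 b) := by
    refine monotoneOn_of_hasDerivWithinAt_nonneg (f' := fun r => 1 * d1 r + r * d2 r)
      (convex_Icc 0 b) (fun r hr => (hg r hr).continuousAt.continuousWithinAt) ?_ ?_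
    · intro r hr
      rw [interior_Icc] at hr
      exact (hg r (Set.Ioo_subset_Icc_self hr)).hasDerivWithinAt
    · intro r hr
      rw [interior_Icc] at hr
      have hr0 : 0 < r := hr.1
      have := hd r hr
      have h' : 0 ≤ r * (1 * d1 r + r * d2 r) := by nlinarith
      exact nonneg_of_mul_nonneg_right h' hr0
  have hd1 : ∀ r ∈ Set.Icc 0 b, 0 ≤ r * d1 r := by
    intro r hr
    have := hmono (Set.left_mem_Icc.2 hb) hr hr.1
    simpa using this
  refine ⟨?_, hd1 b ⟨hb, le_rfl⟩⟩
  have hmd : MonotoneOn d (Set.Icc 0 b) := by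
    refine monotoneOn_of_hasDerivWithinAt_nonneg (f' := d1)
      (convex_Icc 0 b) (fun r hr => (h1 r hr).continuousAt.continuousWithinAt) ?_ ?_
    · intro r hr
      rw [interior_Icc] at hr
      exact (h1 r (Set.Ioo_subset_Icc_self hr)).hasDerivWithinAt
    · intro r hr
      rw [interior_Icc] at hr
      exact nonneg_of_mul_nonneg_right (hd1 r (Set.Ioo_subset_Icc_self hr)) hr.1
  exact hmd (Set.left_mem_Icc.2 hb) (Set.right_mem_Icc.2 hb) hb

lemma mode_zero_ge {F : E2 → ℝ} {c : E2} {R Q : ℝ} (hF : ContDiffOn ℝ 2 F (ball c R))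
    (hQ : ∀ z ∈ ball c R, -Q ≤ lap F z) {r : ℝ} (hr : 0 ≤ r) (hrR : r < R) :
    2 * π * F c - π / 2 * Q * r ^ 2 ≤ circInt F c r := by
  have hmem : ∀ s ∈ Set.Icc 0 r, s ∈ Set.Ioo (-R) R := fun s hs => ⟨by linarith [hs.1], by linarith [hs.2]⟩
  have hlapc := continuousOn_lap isOpen_ball hF
  have key := mono_from_zero (d := fun s => mode F c 0 0 s + π / 2 * Q * s ^ 2)
    (d1 := fun s => mode1 F c 0 0 s + π / 2 * Q * (2 * s))
    (d2 := fun s => mode2 F c 0 0 s + π / 2 * Q * 2) hr ?_ ?_ ?_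
  · have := key.1
    simp only [mode] at this
    simp at this
    rw [circInt]; linarith
  · intro s hs
    refine (hasDerivAt_mode hF 0 0 (hmem s hs)).add ?_
    have := ((hasDerivAt_pow 2 s).const_mul (π / 2 * Q))
    simpa using this
  · intro s hs
    refine (hasDerivAt_mode1 hF 0 0 (hmem s hs)).add ?_
    have := (((hasDerivAt_id s).const_mul 2).const_mul (π / 2 * Q))
    simpa using this
  · intro s hs
    have e := mode_ode hF 0 0 (hmem s (Set.Ioo_subset_Icc_self hs))
    have h3 : -Q * (2 * π) ≤ mode (lap F) c 0 0 s := by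
      rw [← circInt_eq_mode, circInt]
      have : ∫ θ in (0:ℝ)..(2 * π), (-Q) ≤ ∫ θ in (0:ℝ)..(2 * π), lap F (c + s • circDir θ) := by
        refine intervalIntegral.integral_mono_on (by positivity) (by simp) ?_ ?_
        · exact (continuous_circle hlapc (hmem s (Set.Ioo_subset_Icc_self hs))).intervalIntegrable _ _
        · intro θ _
          exact hQ _ (mem_ball_polar (hmem s (Set.Ioo_subset_Icc_self hs)) θ)
      simpa [mul_comm] using this
    push_cast at e
    nlinarith [mul_le_mul_of_nonneg_left h3 (sq_nonneg s)]

lemma eps_reg {F : E2 → ℝ} {z0 : E2} {ρ R : ℝ} (hρ : 0 < ρ) (hρR : ρ < R)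
    (hF : ContDiffOn ℝ 2 F (ball z0 R)) (hpos : ∀ z ∈ ball z0 R, 0 ≤ F z)
    (hlap : ∀ z ∈ ball z0 R, -(F z) ^ 2 ≤ lap F z)
    (hint : ∫ z in ball z0 ρ, F z < 3 * π / 32) : ρ ^ 2 * F z0 ≤ 1 / 2 := by
  have hcB : closedBall z0 ρ ⊆ ball z0 R := closedBall_subset_ball hρR
  have hcont : ContinuousOn (fun x => (ρ - ‖x - z0‖) ^ 2 * F x) (closedBall z0 ρ) := by
    refine ContinuousOn.mul (by fun_prop) (hF.continuousOn.mono hcB)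
  obtain ⟨y, hy, hmax⟩ := (isCompact_closedBall z0 ρ).exists_isMaxOn ⟨z0, mem_closedBall_self hρ.le⟩ hcont
  have h0 : ρ ^ 2 * F z0 ≤ (ρ - ‖y - z0‖) ^ 2 * F y := by
    have := hmax (mem_closedBall_self hρ.le)
    simpa using this
  have hyn : ‖y - z0‖ ≤ ρ := by simpa [dist_eq_norm] using hy
  set s := (ρ - ‖y - z0‖) / 2 with hs
  set l := F y with hl
  by_contra! hcon
  have h1 : 1 / 2 < 4 * s ^ 2 * l := by
    have : (ρ - ‖y - z0‖) ^ 2 = 4 * s ^ 2 := by rw [hs]; ring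
    rw [this] at h0; linarith
  have hs0 : 0 ≤ s := by rw [hs]; linarith
  have hl0 : 0 < l := by
    by_contra! h
    nlinarith [sq_nonneg s]
  have hspos : 0 < s := by
    rcases hs0.eq_or_lt with h | h
    · rw [← h] at h1; norm_num at h1
    · exact h
  have hsub : ball y s ⊆ ball z0 ρ := by
    refine ball_subset_ball' ?_
    rw [dist_eq_norm]; linarith
  have hsubR : ball y s ⊆ ball z0 R := hsub.trans (ball_subset_ball hρR.le)
  have hFs : ∀ x ∈ ball y s, F x ≤ 4 * l := by
    intro x hx
    have hm := hmax (ball_subset_closedBall (hsub hx))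
    simp only [Set.mem_ofPred_eq] at hm
    have hx' : ‖x - y‖ < s := by simpa [dist_eq_norm] using hx
    have h3 : s ≤ ρ - ‖x - z0‖ := by
      have := norm_add_le (x - y) (y - z0)
      rw [sub_add_sub_cancel] at this
      linarith
    have h4 : s ^ 2 * F x ≤ (ρ - ‖x - z0‖) ^ 2 * F x := by
      have := hpos x (hsubR hx)
      gcongr
    have h5 : (ρ - ‖y - z0‖) ^ 2 = 4 * s ^ 2 := by rw [hs]; ring
    rw [h5] at hm
    have h6 : s ^ 2 * F x ≤ s ^ 2 * (4 * l) := by linarith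
    exact le_of_mul_le_mul_left h6 (by positivity)
  have hQ : ∀ z ∈ ball y s, -(16 * l ^ 2) ≤ lap F z := by
    intro z hz
    have h3 := hFs z hz
    have h4 := hpos z (hsubR hz)
    have := hlap z (hsubR hz)
    nlinarith
  set t := 1 / Real.sqrt (8 * l) with ht
  have ht0 : 0 < t := by positivity
  have ht2 : t ^ 2 = 1 / (8 * l) := by
    rw [ht, div_pow, Real.sq_sqrt (by positivity), one_pow]
  have hts : t < s := by
    refine lt_of_pow_lt_pow_left₀ 2 hs0 ?_
    rw [ht2, div_lt_iff₀ (by positivity)]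
    nlinarith
  have hF' := hF.mono hsubR
  have hge : ∀ r ∈ Set.Icc 0 t, r * (2 * π * l - 8 * π * l ^ 2 * r ^ 2) ≤ r * circInt F y r := by
    intro r hr
    have := mode_zero_ge hF' hQ hr.1 (hr.2.trans_lt hts)
    refine mul_le_mul_of_nonneg_left ?_ hr.1
    linarith
  have hI : ∫ r in (0:ℝ)..t, r * (2 * π * l - 8 * π * l ^ 2 * r ^ 2) = 3 * π / 32 := by
    have e : ∀ r : ℝ, r * (2 * π * l - 8 * π * l ^ 2 * r ^ 2) = 2 * π * l * r - 8 * π * l ^ 2 * r ^ 3 := fun r => by ring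
    simp_rw [e]
    rw [intervalIntegral.integral_sub, intervalIntegral.integral_const_mul, intervalIntegral.integral_const_mul,
      integral_id, integral_pow]
    · have h4 : t ^ 4 = (1 / (8 * l)) ^ 2 := by rw [← ht2]; ring
      norm_num
      rw [h4, ht2]
      field_simp; ring
    · exact (by fun_prop : Continuous fun r : ℝ => 2 * π * l * r).intervalIntegrable _ _
    · exact (by fun_prop : Continuous fun r : ℝ => 8 * π * l ^ 2 * r ^ 3).intervalIntegrable _ _
  have hle : 3 * π / 32 ≤ ∫ z in {z | ‖z - y‖ ∈ Set.Ioc 0 t}, F z := by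
    rw [polar_annulus hF'.continuousOn le_rfl ht0.le hts, ← hI]
    refine intervalIntegral.integral_mono_on ht0.le ?_ ?_ hge
    · exact (by fun_prop : Continuous fun r : ℝ => r * (2 * π * l - 8 * π * l ^ 2 * r ^ 2)).intervalIntegrable _ _
    · refine ContinuousOn.intervalIntegrable ?_
      rw [Set.uIcc_of_le ht0.le]
      exact continuousOn_id.mul ((continuousOn_circInt hF'.continuousOn).mono fun r hr => ⟨by linarith [hr.1], hr.2.trans_lt hts⟩)
  have hle2 : ∫ z in {z | ‖z - y‖ ∈ Set.Ioc 0 t}, F z ≤ ∫ z in ball z0 ρ, F z := by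
    refine setIntegral_mono_set ?_ ?_ ?_
    · exact ((hF.continuousOn.mono hcB).integrableOn_compact (isCompact_closedBall z0 ρ)).mono_set ball_subset_closedBall
    · filter_upwards [ae_restrict_mem measurableSet_ball] with z hz
      exact hpos z (ball_subset_ball hρR.le hz)
    · refine Eventually.of_forall fun z hz => hsub ?_
      have : ‖z - y‖ ∈ Set.Ioc 0 t := hz
      rw [mem_ball, dist_eq_norm]; linarith [this.2]
  linarith

lemma lap_comp {g : E2 → ℝ} {S : Set E2} (hS : IsOpen S) (hg : ContDiffOn ℝ 2 g S)
    {φ φ1 φ2 : ℝ → ℝ} (h1 : ∀ z ∈ S, HasDerivAt φ (φ1 (g z)) (g z))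
    (h2 : ∀ z ∈ S, HasDerivAt φ1 (φ2 (g z)) (g z)) {z : E2} (hz : z ∈ S) :
    lap (fun y => φ (g y)) z = φ1 (g z) * lap g z +
      φ2 (g z) * ∑ i : Fin 2, (fderiv ℝ g z (EuclideanSpace.single i 1)) ^ 2 := by
  obtain ⟨c0, c1, c2, c3, c4⟩ := c2_facts hS hg
  rw [lap_eq (c4 z hz).differentiableAt]
  unfold lap
  rw [Finset.mul_sum, Finset.mul_sum, ← Finset.sum_add_distrib]
  refine Finset.sum_congr rfl fun i _ => ?_
  have ev : (fun y => fderiv ℝ (fun y => φ (g y)) y (EuclideanSpace.single i 1)) =ᶠ[𝓝 z]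
      fun y => φ1 (g y) * fderiv ℝ g y (EuclideanSpace.single i 1) := by
    filter_upwards [hS.mem_nhds hz] with y hy
    have := (h1 y hy).comp_hasFDerivAt y (c3 y hy)
    rw [show (fun y => φ (g y)) = φ ∘ g from rfl, this.fderiv]
    simp
  rw [ev.fderiv_eq]
  have a1 := (h2 z hz).comp_hasFDerivAt z (c3 z hz)
  have a2 := (c4 z hz).clm_apply (hasFDerivAt_const (EuclideanSpace.single i (1:ℝ) : E2) z)
  have a3 : HasFDerivAt (fun y => φ1 (g y) * fderiv ℝ g y (EuclideanSpace.single i 1)) _ z := a1.mul a2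
  rw [a3.fderiv]
  simp
  ring

lemma lap_pow_ge {g : E2 → ℝ} {S : Set E2} (hS : IsOpen S) (hg : ContDiffOn ℝ 2 g S) {p : ℝ} (hp : 2 ≤ p)
    (hpos : ∀ z ∈ S, 0 < g z) (heq : ∀ z ∈ S, - lap g z = g z ^ p / p)
    {z : E2} (hz : z ∈ S) : -(g z ^ (p - 1)) ^ 2 ≤ lap (fun y => g y ^ (p - 1)) z := by
  have hg0 := hpos z hz
  rw [lap_comp hS hg (φ := fun t => t ^ (p - 1)) (φ1 := fun t => (p - 1) * t ^ (p - 1 - 1))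
    (φ2 := fun t => (p - 1) * ((p - 1 - 1) * t ^ (p - 1 - 1 - 1)))
    (fun y hy => Real.hasDerivAt_rpow_const (Or.inl (hpos y hy).ne'))
    (fun y hy => (Real.hasDerivAt_rpow_const (Or.inl (hpos y hy).ne')).const_mul _) hz]
  have h1 : lap g z = -(g z ^ p / p) := by rw [← heq z hz]; ring
  have h2 : 0 ≤ (p - 1) * ((p - 1 - 1) * g z ^ (p - 1 - 1 - 1)) *
      ∑ i : Fin 2, (fderiv ℝ g z (EuclideanSpace.single i 1)) ^ 2 := by
    have : 0 ≤ ∑ i : Fin 2, (fderiv ℝ g z (EuclideanSpace.single i 1)) ^ 2 :=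
      Finset.sum_nonneg fun i _ => sq_nonneg _
    have h3 : 0 ≤ p - 1 := by linarith
    have h4 : 0 ≤ p - 1 - 1 := by linarith
    positivity
  have h3 : (g z ^ (p - 1)) ^ 2 = g z ^ (p - 1 - 1) * g z ^ p := by
    rw [← Real.rpow_add hg0, ← Real.rpow_natCast, ← Real.rpow_mul hg0.le]; congr 1; push_cast; ring
  have h4 : (p - 1) / p * (g z ^ (p - 1)) ^ 2 ≤ 1 * (g z ^ (p - 1)) ^ 2 := by
    gcongr
    rw [div_le_one (by linarith)]; linarith
  have h5 : (p - 1) * g z ^ (p - 1 - 1) * lap g z = -((p - 1) / p * (g z ^ (p - 1)) ^ 2) := by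
    rw [h1, h3]; field_simp
  linarith

lemma osc_bound {v : E2 → ℝ} {R1 R2 R' A P : ℝ} (hv : ContDiffOn ℝ 2 v (ball 0 R')) (hR2 : 0 < R2)
    (hR12 : R2 ≤ R1) (hR' : R1 < R') (hP : 1 ≤ P) (hA : 0 ≤ A)
    (hlap : ∀ z, R2 ≤ ‖z‖ → ‖z‖ ≤ R1 → |lap v z| ≤ 2 / ‖z‖ ^ 2)
    (h2 : ∀ z, ‖z‖ = R2 → |v z| ≤ A) (h1 : ∀ z, ‖z‖ = R1 → |v z| ≤ P)
    {z : E2} (hz1 : 2 * R2 ≤ ‖z‖) (hz2 : ‖z‖ ≤ R1 / (2 * P)) :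
    |v z - circInt v 0 ‖z‖ / (2 * π)| ≤
      ∑' m : ℕ, 2 * π * (1 + A) * (2 * (1 / (m:ℝ) ^ 2) + (1/2) ^ m) := by
  have hpi := Real.pi_pos
  have hR10 : 0 < R1 := hR2.trans_le hR12
  have hmem : ∀ r ∈ Set.Icc R2 R1, r ∈ Set.Ioo (-R') R' := fun r hr =>
    ⟨by linarith [hr.1, hr.2], by linarith [hr.2]⟩
  set r := ‖z‖ with hr
  have hr0 : 0 < r := by linarith
  have hrP : r * (2 * P) ≤ R1 := by rwa [le_div_iff₀ (by positivity)] at hz2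
  have hrm : r ∈ Set.Icc R2 R1 := ⟨by linarith, by nlinarith⟩
  have hbdy : ∀ (m : ℕ) (α : ℝ), |mode v 0 m α R2| ≤ 2 * π * A ∧ |mode v 0 m α R1| ≤ 2 * π * P := by
    intro m α
    exact ⟨abs_mode_le fun θ => h2 _ (by rw [zero_add, norm_smul_circDir hR2.le]),
      abs_mode_le fun θ => h1 _ (by rw [zero_add, norm_smul_circDir hR10.le])⟩
  have hmode : ∀ (m : ℕ) (α : ℝ) (σ : ℝ), |σ| = 1 → 1 ≤ m → ∀ s ∈ Set.Icc R2 R1, σ * mode v 0 m α s ≤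
      4 * π / m ^ 2 + 2 * π * A * (R2 ^ m / s ^ m) + 2 * π * P * (s ^ m / R1 ^ m) := by
    intro m α σ hσ hm
    have hm0 : (0:ℝ) < m := by exact_mod_cast hm
    set B := 2 * π * A * R2 ^ m
    set D := 2 * π * P / R1 ^ m
    have key := max_principle (a := R2) (b := R1)
      (d := fun s => σ * mode v 0 m α s - (4 * π / m ^ 2 + B * s ^ (-(m:ℝ)) + D * s ^ (m:ℝ)))
      (d1 := fun s => σ * mode1 v 0 m α s - (B * (-(m:ℝ)) * s ^ (-(m:ℝ) - 1) + D * m * s ^ ((m:ℝ) - 1)))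
      (d2 := fun s => σ * mode2 v 0 m α s - (B * (-(m:ℝ)) * (-(m:ℝ) - 1) * s ^ (-(m:ℝ) - 1 - 1) +
        D * m * (m - 1) * s ^ ((m:ℝ) - 1 - 1))) ?_ ?_ ?_ ?_ ?_ ?_
    · intro s hs
      have hs0 : 0 < s := by linarith [hs.1]
      have := key s hs
      rw [Real.rpow_neg hs0.le, Real.rpow_natCast] at this
      have e1 : B * (s ^ m)⁻¹ = 2 * π * A * (R2 ^ m / s ^ m) := by simp only [B]; field_simp
      have e2 : D * s ^ m = 2 * π * P * (s ^ m / R1 ^ m) := by simp only [D]; field_simp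
      rw [e1, e2] at this
      linarith
    · refine ContinuousOn.sub (continuousOn_const.mul fun s hs => (hasDerivAt_mode hv m α (hmem s hs)).continuousAt.continuousWithinAt) ?_
      refine ContinuousOn.add (ContinuousOn.add continuousOn_const ?_) ?_
      · exact fun s hs => (hasDerivAt_crpow _ _ (by linarith [hs.1])).continuousAt.continuousWithinAt
      · exact fun s hs => (hasDerivAt_crpow _ _ (by linarith [hs.1])).continuousAt.continuousWithinAt
    · intro s hs
      have hs0 : 0 < s := by linarith [hs.1]
      refine ((hasDerivAt_mode hv m α (hmem s (Set.Ioo_subset_Icc_self hs))).const_mul σ).sub ?_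
      refine HasDerivAt.add ?_ (hasDerivAt_crpow _ _ hs0)
      exact (hasDerivAt_crpow _ _ hs0).const_add _
    · intro s hs
      have hs0 : 0 < s := by linarith [hs.1]
      refine ((hasDerivAt_mode1 hv m α (hmem s (Set.Ioo_subset_Icc_self hs))).const_mul σ).sub ?_
      exact (hasDerivAt_crpow _ _ hs0).add (hasDerivAt_crpow _ _ hs0)
    · intro s hs hpos
      have hs0 : 0 < s := by linarith [hs.1]
      have e1 := euler_rpow B (-(m:ℝ)) hs0
      have e2 := euler_rpow D (m:ℝ) hs0
      have e3 := mode_ode hv m α (hmem s (Set.Ioo_subset_Icc_self hs))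
      have e4 : |mode (lap v) 0 m α s| ≤ 2 * π * (2 / s ^ 2) := by
        refine abs_mode_le fun θ => ?_
        have hn : ‖(0 + s • circDir θ : E2)‖ = s := by rw [zero_add, norm_smul_circDir hs0.le]
        have := hlap (0 + s • circDir θ) (by rw [hn]; exact hs.1.le) (by rw [hn]; exact hs.2.le)
        rwa [hn] at this
      have e5 : -(4 * π) ≤ σ * (s ^ 2 * mode (lap v) 0 m α s) := by
        have : |σ * (s ^ 2 * mode (lap v) 0 m α s)| ≤ 4 * π := by
          rw [abs_mul, hσ, one_mul, abs_mul, abs_of_nonneg (sq_nonneg s)]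
          calc s ^ 2 * |mode (lap v) 0 m α s| ≤ s ^ 2 * (2 * π * (2 / s ^ 2)) := by gcongr
            _ = 4 * π := by field_simp; ring
        exact (abs_le.1 this).1
      rw [← e3] at e5
      set X := B * s ^ (-(m:ℝ))
      set Y := D * s ^ (m:ℝ)
      have e6 : s ^ 2 * (σ * mode2 v 0 m α s - (B * (-(m:ℝ)) * (-(m:ℝ) - 1) * s ^ (-(m:ℝ) - 1 - 1) +
        D * m * (m - 1) * s ^ ((m:ℝ) - 1 - 1))) + s * (σ * mode1 v 0 m α s - (B * (-(m:ℝ)) * s ^ (-(m:ℝ) - 1) + D * m * s ^ ((m:ℝ) - 1)))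
         = σ * (s ^ 2 * mode2 v 0 m α s + s * mode1 v 0 m α s - m ^ 2 * mode v 0 m α s) + m ^ 2 * (σ * mode v 0 m α s) - (-(m:ℝ)) ^ 2 * X - m ^ 2 * Y := by
        rw [← e1, ← e2]; ring
      rw [e6]
      have e7 : (m:ℝ) ^ 2 * (4 * π / m ^ 2) = 4 * π := by field_simp
      have e8 := mul_pos (pow_pos hm0 2) hpos
      have e9 : (m:ℝ) ^ 2 * (σ * mode v 0 m α s - (4 * π / m ^ 2 + X + Y)) = m ^ 2 * (σ * mode v 0 m α s) - 4 * π - m ^ 2 * X - m ^ 2 * Y := by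
        rw [mul_sub, mul_add, mul_add, e7]; ring
      rw [e9] at e8
      rw [neg_sq]
      linarith
    · have := (hbdy m α).1
      have h3 : σ * mode v 0 m α R2 ≤ 2 * π * A := by
        refine (le_abs_self _).trans ?_
        rw [abs_mul, hσ, one_mul]; exact this
      have h4 : B * R2 ^ (-(m:ℝ)) = 2 * π * A := by
        rw [Real.rpow_neg hR2.le, Real.rpow_natCast]; simp only [B]; field_simp
      have h5 : 0 ≤ D * R2 ^ (m:ℝ) := by positivity
      have h6 : 0 ≤ 4 * π / (m:ℝ) ^ 2 := by positivity
      linarith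
    · have := (hbdy m α).2
      have h3 : σ * mode v 0 m α R1 ≤ 2 * π * P := by
        refine (le_abs_self _).trans ?_
        rw [abs_mul, hσ, one_mul]; exact this
      have h4 : D * R1 ^ (m:ℝ) = 2 * π * P := by
        rw [Real.rpow_natCast]; simp only [D]; field_simp
      have h5 : 0 ≤ B * R1 ^ (-(m:ℝ)) := by positivity
      have h6 : 0 ≤ 4 * π / (m:ℝ) ^ 2 := by positivity
      linarith
  have hmode' : ∀ (m : ℕ) (α : ℝ), 1 ≤ m → |mode v 0 m α r| ≤
      2 * π * (1 + A) * (2 * (1 / (m:ℝ) ^ 2) + (1/2) ^ m) := by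
    intro m α hm
    have a1 := hmode m α 1 (by simp) hm r hrm
    have a2 := hmode m α (-1) (by simp) hm r hrm
    have a3 : |mode v 0 m α r| ≤ 4 * π / m ^ 2 + 2 * π * A * (R2 ^ m / r ^ m) + 2 * π * P * (r ^ m / R1 ^ m) :=
      abs_le.2 ⟨by linarith, by linarith⟩
    have b1 : R2 ^ m / r ^ m ≤ (1/2) ^ m := by
      rw [← div_pow]
      exact pow_le_pow_left₀ (by positivity) (by rw [div_le_iff₀ hr0]; linarith) m
    have b2 : P * (r ^ m / R1 ^ m) ≤ (1/2) ^ m := by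
      rw [← div_pow]
      obtain ⟨j, rfl⟩ : ∃ j, m = j + 1 := ⟨m - 1, by omega⟩
      have c1 : r / R1 ≤ 1/2 := by rw [div_le_iff₀ hR10]; nlinarith
      have c2 : P * (r / R1) ≤ 1/2 := by rw [mul_div_assoc', div_le_iff₀ hR10]; nlinarith
      have c3 : 0 ≤ r / R1 := by positivity
      calc P * (r / R1) ^ (j + 1) = (r / R1) ^ j * (P * (r / R1)) := by ring
        _ ≤ (1/2) ^ j * (1/2) := by gcongr
        _ = _ := by ring
    have b3 : 2 * π * A * (R2 ^ m / r ^ m) ≤ 2 * π * A * (1/2) ^ m := by gcongr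
    have b4 : 2 * π * (P * (r ^ m / R1 ^ m)) ≤ 2 * π * (1/2) ^ m := by gcongr
    have b5 : 4 * π / (m:ℝ) ^ 2 ≤ 2 * π * (1 + A) * (2 * (1 / (m:ℝ) ^ 2)) := by
      have : 0 ≤ 2 * π * A * (2 * (1 / (m:ℝ) ^ 2)) := by positivity
      have e : 4 * π / (m:ℝ) ^ 2 = 2 * π * (2 * (1 / (m:ℝ) ^ 2)) := by ring
      rw [e]; linarith
    calc _ ≤ _ := a3
      _ ≤ 2 * π * (1 + A) * (2 * (1 / (m:ℝ) ^ 2)) + 2 * π * A * (1/2) ^ m + 2 * π * (1/2) ^ m := by linarith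
      _ = _ := by ring
  have hsum : Summable fun m : ℕ => 2 * π * (1 + A) * (2 * (1 / (m:ℝ) ^ 2) + (1/2) ^ m) :=
    (((Real.summable_one_div_nat_pow.2 (by norm_num)).mul_left 2).add
      (summable_geometric_of_lt_one (by norm_num) (by norm_num))).mul_left _
  obtain ⟨θ, hθ⟩ := exists_polar z
  have hcv := continuous_circle hv.continuousOn (hmem r hrm)
  have := fourier_sup (q := fun θ => v (0 + r • circDir θ) - circInt v 0 r / (2 * π))
    (hcv.sub continuous_const)
    (fun θ => by simp only [circDir_periodic θ]) hsum
    (fun m α => ?_) θ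
  · simp only [zero_add] at this
    rw [← hr] at hθ
    rwa [← hθ] at this
  · have e : ∫ θ in (0:ℝ)..(2 * π), (v (0 + r • circDir θ) - circInt v 0 r / (2 * π)) * Real.cos (m * θ - α) =
        mode v 0 m α r - circInt v 0 r / (2 * π) * ∫ θ in (0:ℝ)..(2 * π), Real.cos (m * θ - α) := by
      unfold mode
      rw [← intervalIntegral.integral_const_mul, ← intervalIntegral.integral_sub]
      · congr 1; ext θ; ring
      · exact (hcv.mul (by fun_prop)).intervalIntegrable _ _
      · exact (by fun_prop : Continuous _).intervalIntegrable _ _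
    rw [e]
    rcases Nat.eq_zero_or_pos m with h0 | h0
    · subst h0
      have : mode v 0 0 α r = circInt v 0 r * Real.cos α := by
        simp [mode, circInt]
      rw [this]
      simp
      have : circInt v 0 r * Real.cos α - circInt v 0 r / (2 * π) * (2 * π * Real.cos α) = 0 := by field_simp; ring
      rw [this, abs_zero]; positivity
    · have hm0 : (m:ℝ) ≠ 0 := by exact_mod_cast h0.ne'
      have : ∫ θ in (0:ℝ)..(2 * π), Real.cos (m * θ - α) = 0 := by
        rw [intervalIntegral.integral_comp_mul_sub (fun x => Real.cos x) hm0, integral_cos]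
        have : Real.sin ((m:ℝ) * (2 * π) - α) = Real.sin (-α) := by
          rw [show (m:ℝ) * (2 * π) - α = -α + m * (2 * π) by ring, Real.sin_add_nat_mul_two_pi]
        rw [this]; simp
      rw [this, mul_zero, sub_zero]
      exact hmode' m α h0

lemma annulus_meas (a b : ℝ) : MeasurableSet {z : E2 | ‖z‖ ∈ Set.Ioc a b} :=
  measurable_norm measurableSet_Ioc

lemma vol_closedBall_E2 (Q : ℝ) (hQ : 0 ≤ Q) : (volume (closedBall (0:E2) Q)).toReal = π * Q ^ 2 := by
  rw [EuclideanSpace.volume_closedBall_fin_two, ENNReal.toReal_mul, ENNReal.toReal_pow, ENNReal.toReal_ofReal hQ]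
  simp [mul_comm, Real.pi_pos.le]

/-- solution on a large ball -/
structure SolB (p : ℝ) (v : E2 → ℝ) (Q : ℝ) : Prop where
  cd : ContDiffOn ℝ 2 v (ball 0 Q)
  lo : ∀ z ∈ ball (0:E2) Q, -p < v z
  up : ∀ z ∈ ball (0:E2) Q, v z ≤ 0
  eq : ∀ z ∈ ball (0:E2) Q, -lap v z = (1 + v z / p) ^ p

section
variable {p Q Q' R : ℝ} {v : E2 → ℝ}

lemma SolB.gpos (h : SolB p v Q') (hp : 2 ≤ p) {z : E2} (hz : z ∈ ball (0:E2) Q') : 0 < 1 + v z / p := by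
  have h1 := h.lo z hz
  have : -1 < v z / p := by rw [lt_div_iff₀ (by linarith)]; linarith
  linarith

lemma SolB.gle (h : SolB p v Q') (hp : 2 ≤ p) {z : E2} (hz : z ∈ ball (0:E2) Q') : 1 + v z / p ≤ 1 := by
  have h1 := h.up z hz
  have : v z / p ≤ 0 := div_nonpos_of_nonpos_of_nonneg h1 (by linarith)
  linarith

lemma SolB.contpow (h : SolB p v Q') (hp : 2 ≤ p) (s : ℝ) :
    ContinuousOn (fun z => (1 + v z / p) ^ s) (ball 0 Q') := by
  refine ContinuousOn.rpow_const ?_ fun z hz => Or.inl (h.gpos hp hz).ne'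
  exact continuousOn_const.add (h.cd.continuousOn.div_const p)

lemma int_on_annulus {f : E2 → ℝ} (hf : ContinuousOn f (ball 0 Q')) (hQ : Q < Q') {S : Set E2}
    (hS : S ⊆ closedBall 0 Q) : IntegrableOn f S :=
  ((hf.mono (closedBall_subset_ball hQ)).integrableOn_compact (isCompact_closedBall 0 Q)).mono_set hS

lemma SolB.F_int (h : SolB p v Q') (hp : 2 ≤ p) (hQ0 : 0 ≤ Q) (hQ : Q < Q')
    (hm : ∫ z in {z : E2 | ‖z‖ ∈ Set.Ioc R Q}, (1 + v z / p) ^ (p + 1) ≤ 1 / 40)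
    (hs : (1/2:ℝ) ^ (p - 1) * (π * Q ^ 2) ≤ 1 / 100)
    {S : Set E2} (hSm : MeasurableSet S) (hS : S ⊆ {z : E2 | ‖z‖ ∈ Set.Ioc R Q}) :
    ∫ z in S, (1 + v z / p) ^ (p - 1) ≤ 11 / 100 := by
  have hann : {z : E2 | ‖z‖ ∈ Set.Ioc R Q} ⊆ closedBall 0 Q := fun z hz => by
    rw [mem_closedBall, dist_zero_right]; exact hz.2
  have hSc : S ⊆ closedBall 0 Q := hS.trans hann
  have hfin : volume S ≠ ⊤ := ((measure_mono hSc).trans_lt measure_closedBall_lt_top).ne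
  calc ∫ z in S, (1 + v z / p) ^ (p - 1) ≤ ∫ z in S, (4 * (1 + v z / p) ^ (p + 1) + (1/2:ℝ) ^ (p - 1)) := by
        refine setIntegral_mono_on (int_on_annulus (h.contpow hp _) hQ hSc) ?_ hSm fun z hz => ?_
        · exact (Integrable.const_mul (int_on_annulus (h.contpow hp _) hQ hSc) 4).add
            (integrableOn_const hfin)
        · have hz' : z ∈ ball (0:E2) Q' := closedBall_subset_ball hQ (hSc hz)
          have hg := h.gpos hp hz'
          set g := 1 + v z / p
          rcases le_total (1/2) g with h2 | h2
          · have e : g ^ (p + 1) = g ^ (p - 1) * g ^ 2 := by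
              rw [← Real.rpow_natCast, ← Real.rpow_add hg]; congr 1; push_cast; ring
            have h3 : 0 ≤ g ^ (p - 1) := by positivity
            have h4 : 0 ≤ (1/2:ℝ) ^ (p - 1) := by positivity
            rw [e]
            nlinarith [mul_nonneg h3 (by nlinarith : 0 ≤ 4 * g ^ 2 - 1)]
          · have : g ^ (p - 1) ≤ (1/2) ^ (p - 1) := Real.rpow_le_rpow hg.le h2 (by linarith)
            have h3 : 0 ≤ g ^ (p + 1) := by positivity
            linarith
    _ = 4 * (∫ z in S, (1 + v z / p) ^ (p + 1)) + (volume S).toReal * (1/2:ℝ) ^ (p - 1) := by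
        rw [integral_add (Integrable.const_mul (int_on_annulus (h.contpow hp _) hQ hSc) 4)
            (integrableOn_const hfin), integral_const_mul, setIntegral_const]
        rfl
    _ ≤ 4 * (1 / 40) + π * Q ^ 2 * (1/2:ℝ) ^ (p - 1) := by
        have h1 : ∫ z in S, (1 + v z / p) ^ (p + 1) ≤ ∫ z in {z : E2 | ‖z‖ ∈ Set.Ioc R Q}, (1 + v z / p) ^ (p + 1) := by
          refine setIntegral_mono_set (int_on_annulus (h.contpow hp _) hQ hann) ?_ (LE.le.eventuallyLE hS)
          filter_upwards [ae_restrict_mem (annulus_meas R Q)] with z hz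
          have := h.gpos hp (closedBall_subset_ball hQ (hann hz))
          simp only [Pi.zero_apply]; positivity
        have h2 : (volume S).toReal ≤ π * Q ^ 2 := by
          rw [← vol_closedBall_E2 Q hQ0]
          exact ENNReal.toReal_mono measure_closedBall_lt_top.ne (measure_mono hSc)
        gcongr
        linarith
    _ ≤ _ := by linarith

lemma SolB.F_bound (h : SolB p v Q') (hp : 3 ≤ p) (hR : 10 ≤ R) (hQ0 : 0 ≤ Q) (hQ : Q < Q')
    (hm : ∫ z in {z : E2 | ‖z‖ ∈ Set.Ioc R Q}, (1 + v z / p) ^ (p + 1) ≤ 1 / 40)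
    (hs : (1/2:ℝ) ^ (p - 1) * (π * Q ^ 2) ≤ 1 / 100) {z : E2} (hz1 : 2 * R ≤ ‖z‖) (hz2 : ‖z‖ ≤ Q / 2) :
    |lap v z| ≤ 2 / ‖z‖ ^ 2 := by
  have hp2 : 2 ≤ p := by linarith
  have hz0 : 0 < ‖z‖ := by linarith
  have hsub : ball z (3 / 4 * ‖z‖) ⊆ ball (0:E2) Q' := by
    intro y hy
    rw [mem_ball, dist_zero_right]
    rw [mem_ball, dist_eq_norm] at hy
    have : ‖y‖ ≤ ‖y - z‖ + ‖z‖ := by simpa using norm_add_le (y - z) z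
    linarith
  have hgc : ContDiffOn ℝ 2 (fun z => 1 + v z / p) (ball 0 Q') := contDiffOn_const.add (h.cd.div_const p)
  have hlapg : ∀ y ∈ ball (0:E2) Q', - lap (fun z => 1 + v z / p) y = (1 + v y / p) ^ p / p := by
    intro y hy
    rw [lap_comp isOpen_ball h.cd (φ := fun t => 1 + t / p) (φ1 := fun t => 1 / p) (φ2 := fun _ => 0)
      (fun z _ => ((hasDerivAt_id (v z)).div_const p).const_add 1) (fun z _ => hasDerivAt_const _ _) hy,
      ← h.eq y hy]
    ring
  have hzm : z ∈ ball (0:E2) Q' := by rw [mem_ball, dist_zero_right]; linarith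
  have := eps_reg (F := fun z => (1 + v z / p) ^ (p - 1)) (z0 := z) (ρ := ‖z‖ / 2) (R := 3 / 4 * ‖z‖)
    (by linarith) (by linarith) ?_ ?_ ?_ ?_
  · have hg := h.gpos hp2 hzm
    have h1 : |lap v z| = (1 + v z / p) ^ p := by
      rw [← h.eq z hzm, ← abs_neg, abs_of_nonneg]
      rw [h.eq z hzm]; positivity
    rw [h1]
    have h2 : (1 + v z / p) ^ p ≤ (1 + v z / p) ^ (p - 1) :=
      Real.rpow_le_rpow_of_exponent_ge hg (h.gle hp2 hzm) (by linarith)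
    refine h2.trans ?_
    rw [le_div_iff₀ (by positivity)]
    nlinarith
  · exact ContDiffOn.rpow_const_of_ne (hgc.mono hsub) fun y hy => (h.gpos hp2 (hsub hy)).ne'
  · intro y hy; have := h.gpos hp2 (hsub hy); positivity
  · intro y hy
    exact lap_pow_ge isOpen_ball hgc hp2 (fun y hy => h.gpos hp2 hy) hlapg (hsub hy)
  · refine (h.F_int hp2 hQ0 hQ hm hs measurableSet_ball ?_).trans_lt ?_
    · intro y hy
      rw [mem_ball, dist_eq_norm] at hy
      have h1 : ‖y‖ ≤ ‖y - z‖ + ‖z‖ := by simpa using norm_add_le (y - z) z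
      have h2 : ‖z‖ ≤ ‖y - z‖ + ‖y‖ := by
        have := norm_add_le (z - y) y
        rw [norm_sub_rev]; simpa using this
      exact ⟨by linarith, by linarith⟩
    · have := Real.pi_gt_three; linarith
end

lemma Ustd_nonpos (z : E2) : Ustd z ≤ 0 := by
  have : 0 ≤ Real.log (1 + ‖z‖ ^ 2 / 8) := Real.log_nonneg (by have := sq_nonneg ‖z‖; linarith)
  unfold Ustd; linarith

lemma Ustd_ge {z : E2} {r : ℝ} (h : ‖z‖ ≤ r) : -2 * Real.log (1 + r ^ 2 / 8) ≤ Ustd z := by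
  have h1 : ‖z‖ ^ 2 ≤ r ^ 2 := by gcongr
  have : Real.log (1 + ‖z‖ ^ 2 / 8) ≤ Real.log (1 + r ^ 2 / 8) := by
    apply Real.log_le_log (by positivity); linarith
  unfold Ustd; linarith

lemma decay_slope {p Q Q' R : ℝ} {v : E2 → ℝ} (h : SolB p v Q') (hp : 3 ≤ p) (hR : 10 ≤ R) (hQ : Q < Q')
    (hm : ∫ z in {z : E2 | ‖z‖ ∈ Set.Ioc R Q}, (1 + v z / p) ^ (p + 1) ≤ 1 / 40)
    (hs : (1/2:ℝ) ^ (p - 1) * (π * Q ^ 2) ≤ 1 / 100)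
    (hm1 : |2 * R * mode1 v 0 0 0 (2 * R) + 8 * π * ((2 * R) ^ 2 / (8 + (2 * R) ^ 2))| ≤ 1 / 10)
    {r : ℝ} (hr1 : 2 * R ≤ r) (hr2 : r ≤ Q) :
    -(4.1 * (2 * π)) ≤ r * mode1 v 0 0 0 r ∧ r * mode1 v 0 0 0 r ≤ -(3.9 * (2 * π)) := by
  have hp2 : 2 ≤ p := by linarith
  have hpi := Real.pi_gt_three
  have hmem : ∀ s ∈ Set.Icc (2 * R) r, s ∈ Set.Ioo (-Q') Q' := fun s hs => ⟨by linarith [hs.1, hs.2], by linarith [hs.2]⟩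
  have hlapc := continuousOn_lap isOpen_ball h.cd
  have hbd : ∀ s ∈ Set.uIcc (2 * R) r, HasDerivAt (fun s => s * mode1 v 0 0 0 s) (s * circInt (lap v) 0 s) s := by
    intro s hs
    rw [Set.uIcc_of_le hr1] at hs
    have hs0 : 0 < s := by linarith [hs.1]
    have e := mode_ode h.cd 0 0 (hmem s hs)
    have e2 := (hasDerivAt_id s).mul (hasDerivAt_mode1 h.cd 0 0 (hmem s hs))
    convert! e2 using 1
    rw [circInt_eq_mode]
    have : s * (s * mode (lap v) 0 0 0 s) = s * (1 * mode1 v 0 0 0 s + s * mode2 v 0 0 0 s) := by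
      have e' : s ^ 2 * mode2 v 0 0 0 s + s * mode1 v 0 0 0 s = s ^ 2 * mode (lap v) 0 0 0 s := by
        simpa using e
      linear_combination -e'
    exact mul_left_cancel₀ hs0.ne' this
  have hci : IntervalIntegrable (fun s => s * circInt (lap v) 0 s) volume (2 * R) r := by
    apply ContinuousOn.intervalIntegrable
    rw [Set.uIcc_of_le hr1]
    exact continuousOn_id.mul ((continuousOn_circInt hlapc).mono hmem)
  have ftc := intervalIntegral.integral_eq_sub_of_hasDerivAt hbd hci
  have pa := polar_annulus hlapc (a := 2 * R) (b := r) (by linarith) hr1 (hr2.trans_lt hQ)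
  simp only [sub_zero] at pa
  rw [← pa] at ftc
  have hsub : {z : E2 | ‖z‖ ∈ Set.Ioc (2 * R) r} ⊆ {z : E2 | ‖z‖ ∈ Set.Ioc R Q} :=
    fun z hz => ⟨by linarith [hz.1], hz.2.trans hr2⟩
  have hcb : {z : E2 | ‖z‖ ∈ Set.Ioc (2 * R) r} ⊆ closedBall 0 Q := fun z hz => by
    rw [mem_closedBall, dist_zero_right]; exact hz.2.trans hr2
  have hF := h.F_int hp2 (by linarith) hQ hm hs (annulus_meas (2 * R) r) hsub
  have b1 : -(11/100) ≤ ∫ z in {z : E2 | ‖z‖ ∈ Set.Ioc (2 * R) r}, lap v z := by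
    have : ∫ z in {z : E2 | ‖z‖ ∈ Set.Ioc (2 * R) r}, -(1 + v z / p) ^ (p - 1) ≤
        ∫ z in {z : E2 | ‖z‖ ∈ Set.Ioc (2 * R) r}, lap v z := by
      refine setIntegral_mono_on (int_on_annulus (h.contpow hp2 _) hQ hcb).neg (int_on_annulus hlapc hQ hcb)
        (annulus_meas _ _) fun z hz => ?_
      have hz' := closedBall_subset_ball hQ (hcb hz)
      have := h.eq z hz'
      have h2 : (1 + v z / p) ^ p ≤ (1 + v z / p) ^ (p - 1) :=
        Real.rpow_le_rpow_of_exponent_ge (h.gpos hp2 hz') (h.gle hp2 hz') (by linarith)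
      linarith
    rw [integral_neg] at this
    linarith
  have b2 : ∫ z in {z : E2 | ‖z‖ ∈ Set.Ioc (2 * R) r}, lap v z ≤ 0 := by
    refine setIntegral_nonpos (annulus_meas _ _) fun z hz => ?_
    have hz' := closedBall_subset_ball hQ (hcb hz)
    have := h.eq z hz'
    have := (Real.rpow_nonneg (h.gpos hp2 hz').le p)
    linarith
  rw [ftc] at b1 b2
  have hq : (400 / 408 : ℝ) ≤ (2 * R) ^ 2 / (8 + (2 * R) ^ 2) := by
    rw [div_le_div_iff₀ (by norm_num) (by positivity)]; nlinarith
  have hq2 : (2 * R) ^ 2 / (8 + (2 * R) ^ 2) ≤ 1 := by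
    rw [div_le_one (by positivity)]; linarith
  obtain ⟨c1, c2⟩ := abs_le.1 hm1
  constructor <;> nlinarith

lemma decay_det {R : ℝ} (hR : 10 ≤ R) : ∃ D : ℝ, 0 < D ∧ ∀ (p Q Q' : ℝ) (v : E2 → ℝ), SolB p v Q' →
    3 ≤ p → Q < Q' →
    ∫ z in {z : E2 | ‖z‖ ∈ Set.Ioc R Q}, (1 + v z / p) ^ (p + 1) ≤ 1 / 40 →
    (1/2:ℝ) ^ (p - 1) * (π * Q ^ 2) ≤ 1 / 100 →
    |2 * R * mode1 v 0 0 0 (2 * R) + 8 * π * ((2 * R) ^ 2 / (8 + (2 * R) ^ 2))| ≤ 1 / 10 →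
    (∀ z, ‖z‖ ≤ 4 * R → |v z - Ustd z| ≤ 1) →
    ∀ z, ‖z‖ ≤ Q / (4 * p) → v z ≤ D - 7 / 2 * Real.log (1 + ‖z‖) ∧ |v z| ≤ D + 5 * Real.log (1 + ‖z‖) := by
  set A := 2 * Real.log (1 + (4 * R) ^ 2 / 8) + 1 with hA
  have hA1 : 1 ≤ A := by
    have : 0 ≤ Real.log (1 + (4 * R) ^ 2 / 8) := Real.log_nonneg (by have := sq_nonneg (4 * R); linarith)
    linarith
  set S := ∑' m : ℕ, 2 * π * (1 + A) * (2 * (1 / (m:ℝ) ^ 2) + (1/2) ^ m) with hS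
  have hS0 : 0 ≤ S := tsum_nonneg fun m => by have := Real.pi_pos; positivity
  have hl1 : 0 ≤ Real.log (4 * R) := Real.log_nonneg (by linarith)
  have hl2 : 0 ≤ Real.log 2 := Real.log_nonneg (by norm_num)
  have hl3 : 0 ≤ Real.log (1 + 4 * R) := Real.log_nonneg (by linarith)
  refine ⟨S + A + 1 + 4.1 * Real.log (4 * R) + 7 / 2 * Real.log 2 + 7 / 2 * Real.log (1 + 4 * R), by positivity, ?_⟩
  intro p Q Q' v h hp hQ hm hs_small hm1 hU z hz
  have hvA : ∀ z, ‖z‖ ≤ 4 * R → |v z| ≤ A := by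
    intro z hz
    have h1 := abs_le.1 (hU z hz)
    have h2 := Ustd_ge hz
    have h3 := Ustd_nonpos z
    rw [abs_le]; constructor <;> linarith
  have hz0 := norm_nonneg z
  have hlz : 0 ≤ Real.log (1 + ‖z‖) := Real.log_nonneg (by linarith)
  rcases le_total ‖z‖ (4 * R) with hc | hc
  · have h1 := abs_le.1 (hU z hc)
    have h3 := Ustd_nonpos z
    have h4 : Real.log (1 + ‖z‖) ≤ Real.log (1 + 4 * R) := Real.log_le_log (by linarith) (by linarith)
    have h5 := hvA z hc
    constructor
    · linarith
    · linarith
  have hp2 : 2 ≤ p := by linarith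
  have hpi := Real.pi_gt_three
  have hzQ : ‖z‖ * (4 * p) ≤ Q := by rwa [le_div_iff₀ (by linarith)] at hz
  have hQR : 4 * R * (4 * p) ≤ Q := le_trans (by gcongr) hzQ
  have hQbig : 48 * R ≤ Q := by nlinarith
  have hzQ2 : 12 * ‖z‖ ≤ Q := by nlinarith
  have hosc := osc_bound (R1 := Q / 2) (R2 := 2 * R) (A := A) (P := p) h.cd (by linarith) (by linarith) (by linarith)
    (by linarith) (by linarith) (fun y h1 h2 => h.F_bound hp hR (by linarith) hQ hm hs_small h1 h2)
    (fun y hy => hvA y (by linarith)) (fun y hy => ?_) (z := z) (by linarith)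
    (by rw [le_div_iff₀ (by linarith)]; linarith)
  swap
  · have hy' : y ∈ ball (0:E2) Q' := by rw [mem_ball, dist_zero_right]; linarith
    rw [abs_le]; exact ⟨(h.lo y hy').le, by linarith [h.up y hy']⟩
  rw [← hS] at hosc
  set r := ‖z‖ with hr
  have hmem : ∀ s ∈ Set.Icc (4 * R) r, s ∈ Set.Ioo (-Q') Q' := fun s hs => ⟨by linarith [hs.1, hs.2], by linarith [hs.2]⟩
  have hder : ∀ (c s : ℝ), s ∈ Set.Icc (4 * R) r → HasDerivAt (fun s => mode v 0 0 0 s / (2 * π) + c * Real.log s)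
      (mode1 v 0 0 0 s / (2 * π) + c * s⁻¹) s := by
    intro c s hs
    exact ((hasDerivAt_mode h.cd 0 0 (hmem s hs)).div_const _).add ((Real.hasDerivAt_log (by linarith [hs.1])).const_mul c)
  have hmode4 : |mode v 0 0 0 (4 * R) / (2 * π)| ≤ A := by
    rw [abs_div, abs_of_pos (by positivity : 0 < 2 * π), div_le_iff₀ (by positivity), mul_comm A]
    exact abs_mode_le fun θ => hvA _ (by rw [zero_add, norm_smul_circDir (by linarith)])
  have anti : AntitoneOn (fun s => mode v 0 0 0 s / (2 * π) + 3.9 * Real.log s) (Set.Icc (4 * R) r) := by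
    refine antitoneOn_of_deriv_nonpos (convex_Icc _ _) (fun s hs => (hder _ s hs).continuousAt.continuousWithinAt)
      (fun s hs => (hder _ s (interior_subset hs)).differentiableAt.differentiableWithinAt) fun s hs => ?_
    have hs' := interior_subset hs
    rw [(hder _ s hs').deriv]
    have hs0 : 0 < s := by linarith [hs'.1]
    have := (decay_slope h hp hR hQ hm hs_small hm1 (r := s) (by linarith [hs'.1]) (by linarith [hs'.2])).2
    have e : mode1 v 0 0 0 s / (2 * π) + 3.9 * s⁻¹ = (s * mode1 v 0 0 0 s + 3.9 * (2 * π)) / (s * (2 * π)) := by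
      field_simp
    rw [e]
    exact div_nonpos_of_nonpos_of_nonneg (by linarith) (by positivity)
  have mono : MonotoneOn (fun s => mode v 0 0 0 s / (2 * π) + 4.1 * Real.log s) (Set.Icc (4 * R) r) := by
    refine monotoneOn_of_deriv_nonneg (convex_Icc _ _) (fun s hs => (hder _ s hs).continuousAt.continuousWithinAt)
      (fun s hs => (hder _ s (interior_subset hs)).differentiableAt.differentiableWithinAt) fun s hs => ?_
    have hs' := interior_subset hs
    rw [(hder _ s hs').deriv]
    have hs0 : 0 < s := by linarith [hs'.1]
    have := (decay_slope h hp hR hQ hm hs_small hm1 (r := s) (by linarith [hs'.1]) (by linarith [hs'.2])).1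
    have e : mode1 v 0 0 0 s / (2 * π) + 4.1 * s⁻¹ = (s * mode1 v 0 0 0 s + 4.1 * (2 * π)) / (s * (2 * π)) := by
      field_simp
    rw [e]
    exact div_nonneg (by linarith) (by positivity)
  have l4 : (4 * R) ∈ Set.Icc (4 * R) r := ⟨le_rfl, hc⟩
  have lr : r ∈ Set.Icc (4 * R) r := ⟨hc, le_rfl⟩
  have a1 := anti l4 lr hc
  have a2 := mono l4 lr hc
  simp only at a1 a2
  rw [circInt_eq_mode] at hosc
  obtain ⟨o1, o2⟩ := abs_le.1 hosc
  obtain ⟨m1, m2⟩ := abs_le.1 hmode4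
  have hr0 : 0 < r := by linarith
  have k1 : Real.log (1 + r) ≤ Real.log 2 + Real.log r := by
    rw [← Real.log_mul (by norm_num) hr0.ne']
    exact Real.log_le_log (by linarith) (by linarith)
  have k2 : Real.log r ≤ Real.log (1 + r) := Real.log_le_log hr0 (by linarith)
  have k3 : 0 ≤ Real.log r := Real.log_nonneg (by linarith)
  constructor
  · linarith
  · rw [abs_le]; constructor <;> linarith

lemma fderiv_normsq (z : E2) : HasFDerivAt (fun z : E2 => ‖z‖ ^ 2) ((2:ℝ) • innerSL ℝ z) z :=
  by simpa [two_smul] using (hasStrictFDerivAt_norm_sq z).hasFDerivAt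

lemma contDiff_Ustd : ContDiff ℝ 2 Ustd := by
  unfold Ustd
  refine contDiff_const.mul (ContDiff.log ?_ fun z => by positivity)
  exact contDiff_const.add ((contDiff_norm_sq ℝ).div_const 8)

lemma hasDerivAt_phiU (t : ℝ) (ht : 0 ≤ t) : HasDerivAt (fun t => -2 * Real.log (1 + t / 8)) (-2 / (8 + t)) t := by
  have h1 : HasDerivAt (fun t : ℝ => 1 + t / 8) (1 / 8) t := ((hasDerivAt_id t).div_const 8).const_add 1
  have h2 := (h1.log (by positivity)).const_mul (-2)
  convert! h2 using 1
  have : 8 + t ≠ 0 := by positivity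
  have : 1 + t / 8 ≠ 0 := by positivity
  field_simp

lemma fderiv_Ustd (z e : E2) : fderiv ℝ Ustd z e = -4 * inner ℝ z e / (8 + ‖z‖ ^ 2) := by
  have := (hasDerivAt_phiU (‖z‖ ^ 2) (by positivity)).comp_hasFDerivAt z (fderiv_normsq z)
  have h2 : HasFDerivAt Ustd ((-2 / (8 + ‖z‖ ^ 2)) • (2:ℝ) • innerSL ℝ z) z := this
  rw [h2.fderiv]
  simp
  ring

lemma lap_Ustd (z : E2) : lap Ustd z = -Real.exp (Ustd z) := by
  have hc : ContDiffOn ℝ 2 (fun z : E2 => ‖z‖ ^ 2) Set.univ := (contDiff_norm_sq ℝ).contDiffOn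
  have := lap_comp isOpen_univ hc (φ := fun t => -2 * Real.log (1 + t / 8)) (φ1 := fun t => -2 / (8 + t))
    (φ2 := fun t => 2 / (8 + t) ^ 2) (fun z _ => hasDerivAt_phiU _ (by positivity)) (fun z _ => ?_) (Set.mem_univ z)
  · have h1 : lap Ustd z = lap (fun y => -2 * Real.log (1 + ‖y‖ ^ 2 / 8)) z := rfl
    have hl : lap (fun z : E2 => ‖z‖ ^ 2) z = 4 := by
      unfold lap
      have : ∀ i : Fin 2, (fun y : E2 => fderiv ℝ (fun z : E2 => ‖z‖ ^ 2) y (EuclideanSpace.single i 1)) =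
          fun y => 2 * inner ℝ (EuclideanSpace.single i (1:ℝ) : E2) y := by
        intro i; ext y
        rw [(fderiv_normsq y).fderiv, real_inner_comm]
        simp
      simp_rw [this]
      have h3 : ∀ i : Fin 2, HasFDerivAt (fun y : E2 => 2 * inner ℝ (EuclideanSpace.single i (1:ℝ) : E2) y)
          ((2:ℝ) • innerSL ℝ (EuclideanSpace.single i (1:ℝ) : E2)) z := fun i =>
        ((innerSL ℝ (EuclideanSpace.single i (1:ℝ) : E2)).hasFDerivAt).const_mul 2
      rw [Fin.sum_univ_two, (h3 0).fderiv, (h3 1).fderiv]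
      simp
      norm_num
    have hs : ∑ i : Fin 2, (fderiv ℝ (fun z : E2 => ‖z‖ ^ 2) z (EuclideanSpace.single i 1)) ^ 2 = 4 * ‖z‖ ^ 2 := by
      have hin : ∀ i : Fin 2, inner ℝ z (EuclideanSpace.single i (1:ℝ)) = z i := fun i => by
        rw [EuclideanSpace.inner_single_right]; simp
      rw [(fderiv_normsq z).fderiv, Fin.sum_univ_two, EuclideanSpace.norm_sq_eq]
      simp [hin]
      ring
    rw [h1, this, hl, hs, expU]
    have : 8 + ‖z‖ ^ 2 ≠ 0 := by positivity
    field_simp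
    ring
  · have h1 : HasDerivAt (fun t : ℝ => 8 + t) 1 (‖z‖ ^ 2) := (hasDerivAt_id _).const_add 8
    have hne : 8 + ‖z‖ ^ 2 ≠ 0 := by positivity
    have h2 := (h1.inv hne).const_mul (-2)
    convert! h2 using 1
    field_simp

lemma dist_d0 (f g : E2 → ℝ) (x : E2) : |f x - g x| ≤ dist (iteratedFDeriv ℝ 0 f x) (iteratedFDeriv ℝ 0 g x) := by
  rw [dist_eq_norm]
  have := (iteratedFDeriv ℝ 0 f x - iteratedFDeriv ℝ 0 g x).le_opNorm (fun _ => 0)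
  simpa using this

lemma dist_d1 (f g : E2 → ℝ) (x : E2) :
    ‖fderiv ℝ f x - fderiv ℝ g x‖ ≤ dist (iteratedFDeriv ℝ 1 f x) (iteratedFDeriv ℝ 1 g x) := by
  rw [dist_eq_norm]
  refine ContinuousLinearMap.opNorm_le_bound _ (norm_nonneg _) fun e => ?_
  have := (iteratedFDeriv ℝ 1 f x - iteratedFDeriv ℝ 1 g x).le_opNorm (fun _ => e)
  simpa [iteratedFDeriv_one_apply] using this

lemma dist_d2 (f g : E2 → ℝ) (x : E2) :
    ‖D2 f x - D2 g x‖ ≤ dist (iteratedFDeriv ℝ 2 f x) (iteratedFDeriv ℝ 2 g x) := by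
  rw [dist_eq_norm]
  refine ContinuousLinearMap.opNorm_le_bound _ (norm_nonneg _) fun e => ?_
  refine ContinuousLinearMap.opNorm_le_bound _ (by positivity) fun e' => ?_
  have := (iteratedFDeriv ℝ 2 f x - iteratedFDeriv ℝ 2 g x).le_opNorm ![e, e']
  simpa [iteratedFDeriv_two_apply, D2, Fin.prod_univ_two, mul_assoc] using this

/-- the abstract sequence setting -/
structure Core (p : ℕ → ℝ) (v : ℕ → E2 → ℝ) (w0 : E2 → ℝ) : Prop where
  ptop : Tendsto p atTop atTop
  sol : ∀ K : ℕ, ∀ᶠ n in atTop, SolB (p n) (v n) (p n ^ K)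
  v0 : ∀ n, v n 0 = 0
  lim : TendstoC2LocOn Set.univ (fun n z => p n * (v n z - Ustd z)) w0
  mass : ∃ R ≥ (10:ℝ), ∀ K : ℕ, ∀ᶠ n in atTop,
    ∫ z in {z : E2 | ‖z‖ ∈ Set.Ioc R (p n ^ K)}, (1 + v n z / p n) ^ (p n + 1) ≤ 1 / 40
  weq : ∀ z : E2, -lap w0 z - Real.exp (Ustd z) * w0 z = -((Ustd z) ^ 2 / 2) * Real.exp (Ustd z)
  wgr : ∀ τ ∈ Set.Ioo (0:ℝ) 1, ∃ C > (0:ℝ), ∀ z : E2, |w0 z| ≤ C * (1 + ‖z‖) ^ τ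

section
variable {p : ℕ → ℝ} {v : ℕ → E2 → ℝ} {w0 : E2 → ℝ}

lemma Core.lim0 (h : Core p v w0) (R : ℝ) {η : ℝ} (hη : 0 < η) :
    ∀ᶠ n in atTop, ∀ z : E2, ‖z‖ ≤ R → |p n * (v n z - Ustd z) - w0 z| ≤ η := by
  have := h.lim (closedBall 0 R) (Set.subset_univ _) (isCompact_closedBall 0 R) 0 (by norm_num)
  rw [Metric.tendstoUniformlyOn_iff] at this
  filter_upwards [this η hη] with n hn z hz
  have h1 := hn z (by simpa using hz)
  rw [dist_comm] at h1
  exact (dist_d0 _ _ z).trans h1.le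

lemma Core.lim1 (h : Core p v w0) (R : ℝ) {η : ℝ} (hη : 0 < η) :
    ∀ᶠ n in atTop, ∀ z : E2, ‖z‖ ≤ R → ‖fderiv ℝ (fun z => p n * (v n z - Ustd z)) z - fderiv ℝ w0 z‖ ≤ η := by
  have := h.lim (closedBall 0 R) (Set.subset_univ _) (isCompact_closedBall 0 R) 1 (by norm_num)
  rw [Metric.tendstoUniformlyOn_iff] at this
  filter_upwards [this η hη] with n hn z hz
  have h1 := hn z (by simpa using hz)
  rw [dist_comm] at h1
  exact (dist_d1 _ _ z).trans h1.le

lemma Core.lim2 (h : Core p v w0) (R : ℝ) {η : ℝ} (hη : 0 < η) :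
    ∀ᶠ n in atTop, ∀ z : E2, ‖z‖ ≤ R → ‖D2 (fun z => p n * (v n z - Ustd z)) z - D2 w0 z‖ ≤ η := by
  have := h.lim (closedBall 0 R) (Set.subset_univ _) (isCompact_closedBall 0 R) 2 (by norm_num)
  rw [Metric.tendstoUniformlyOn_iff] at this
  filter_upwards [this η hη] with n hn z hz
  have h1 := hn z (by simpa using hz)
  rw [dist_comm] at h1
  exact (dist_d2 _ _ z).trans h1.le

lemma Core.ev_ball (h : Core p v w0) (R : ℝ) : ∀ᶠ n in atTop, R < p n ∧ SolB (p n) (v n) (p n) := by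
  filter_upwards [h.ptop.eventually_gt_atTop R, h.sol 1] with n h1 h2
  exact ⟨h1, by simpa using h2⟩

lemma SolB.wcd {p Q : ℝ} {v : E2 → ℝ} (h : SolB p v Q) :
    ContDiffOn ℝ 2 (fun z => p * (v z - Ustd z)) (ball 0 Q) :=
  contDiffOn_const.mul (h.cd.sub contDiff_Ustd.contDiffOn)

lemma tuo {G : Type} [NormedAddCommGroup G] {f : ℕ → E2 → G} {g : E2 → G}
    (hfg : ∀ R η : ℝ, 0 < η → ∀ᶠ n in atTop, ∀ z : E2, ‖z‖ ≤ R → ‖f n z - g z‖ ≤ η) (R : ℝ) :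
      TendstoUniformlyOn f g atTop (ball 0 R) := by
  rw [Metric.tendstoUniformlyOn_iff]
  intro η hη
  filter_upwards [hfg R (η / 2) (by linarith)] with n hn z hz
  rw [dist_comm, dist_eq_norm]
  have := hn z (by simpa using (mem_ball.1 hz).le)
  linarith

lemma deriv_lim {G : Type} [NormedAddCommGroup G] [NormedSpace ℝ G] {f : ℕ → E2 → G} {g : E2 → G}
    {f' : ℕ → E2 → E2 →L[ℝ] G} {g' : E2 → E2 →L[ℝ] G}
    (h0 : ∀ R η : ℝ, 0 < η → ∀ᶠ n in atTop, ∀ z : E2, ‖z‖ ≤ R → ‖f n z - g z‖ ≤ η)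
    (h1 : ∀ R η : ℝ, 0 < η → ∀ᶠ n in atTop, ∀ z : E2, ‖z‖ ≤ R → ‖f' n z - g' z‖ ≤ η)
    (hd : ∀ R : ℝ, ∀ᶠ n in atTop, ∀ z ∈ ball (0:E2) R, HasFDerivAt (f n) (f' n z) z) (z : E2) :
    HasFDerivAt g (g' z) z := by
  obtain ⟨N, hN⟩ := eventually_atTop.1 (hd (‖z‖ + 1))
  have sh := tendsto_add_atTop_nat N
  refine hasFDerivAt_of_tendstoUniformlyOn (f := fun n => f (n + N)) (f' := fun n => f' (n + N)) isOpen_ball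
    (tuo (fun R η hη => sh.eventually (h1 R η hη)) (‖z‖ + 1)) ?_ ?_ (by simp)
  · intro n y hy
    exact hN (n + N) (by omega) y hy
  · intro y hy
    exact (tuo (fun R η hη => sh.eventually (h0 R η hη)) (‖z‖ + 1)).tendsto_at hy

lemma Core.w0c (h : Core p v w0) : ContDiff ℝ 2 w0 := by
  have l0 : ∀ R η : ℝ, 0 < η → ∀ᶠ n in atTop, ∀ z : E2, ‖z‖ ≤ R →
    ‖(fun z => p n * (v n z - Ustd z)) z - w0 z‖ ≤ η := fun R η hη => h.lim0 R hη
  have l1 := fun (R η : ℝ) (hη : 0 < η) => h.lim1 R hη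
  have l2 := fun (R η : ℝ) (hη : 0 < η) => h.lim2 R hη
  have sub : ∀ R : ℝ, ∀ᶠ n in atTop, ContDiffOn ℝ 2 (fun z => p n * (v n z - Ustd z)) (ball (0:E2) R) := by
    intro R
    filter_upwards [h.ev_ball R] with n hn
    exact hn.2.wcd.mono (ball_subset_ball hn.1.le)
  have d1 : ∀ z, HasFDerivAt w0 (fderiv ℝ w0 z) z := by
    refine deriv_lim l0 l1 fun R => ?_
    filter_upwards [sub R] with n hn
    exact (c2_facts isOpen_ball hn).2.2.2.1
  have d2 : ∀ z, HasFDerivAt (fun y => fderiv ℝ w0 y) (D2 w0 z) z := by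
    refine deriv_lim l1 l2 fun R => ?_
    filter_upwards [sub R] with n hn
    exact (c2_facts isOpen_ball hn).2.2.2.2
  have c2 : Continuous (D2 w0) := by
    rw [continuous_iff_continuousAt]
    intro z
    have : ContinuousOn (D2 w0) (ball 0 (‖z‖ + 1)) := by
      refine (tuo (G := E2 →L[ℝ] E2 →L[ℝ] ℝ) (f := fun n => D2 (fun z => p n * (v n z - Ustd z))) (g := D2 w0) l2 (‖z‖ + 1)).continuousOn (Eventually.frequently ?_)
      filter_upwards [sub (‖z‖ + 1)] with n hn
      exact (c2_facts isOpen_ball hn).2.2.1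
    exact this.continuousAt (isOpen_ball.mem_nhds (by simp))
  rw [show (2 : WithTop ℕ∞) = 1 + 1 by norm_num, contDiff_succ_iff_fderiv]
  refine ⟨fun z => (d1 z).differentiableAt, by simp, ?_⟩
  rw [contDiff_one_iff_fderiv]
  exact ⟨fun z => (d2 z).differentiableAt, c2⟩

lemma Core.fderiv_v0 (h : Core p v w0) : ∀ᶠ n in atTop, fderiv ℝ (v n) 0 = 0 := by
  filter_upwards [h.ev_ball 1] with n hn
  refine IsLocalMax.fderiv_eq_zero ?_
  filter_upwards [isOpen_ball.mem_nhds (mem_ball_self (x := (0:E2)) (by linarith [hn.1] : 0 < p n))] with z hz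
  rw [h.v0]; exact hn.2.up z hz

lemma Core.w00 (h : Core p v w0) : w0 0 = 0 := by
  have h1 : ∀ η : ℝ, 0 < η → |w0 0| ≤ η := by
    intro η hη
    obtain ⟨n, hn⟩ := (h.lim0 0 hη).exists
    have := hn 0 (by simp)
    simpa [h.v0, Ustd] using this
  by_contra hne
  have := h1 (|w0 0| / 2) (by positivity)
  have : 0 < |w0 0| := by positivity
  linarith

lemma fderiv_w {p Q : ℝ} {v : E2 → ℝ} (h : SolB p v Q) {z : E2} (hz : z ∈ ball (0:E2) Q) :
    fderiv ℝ (fun z => p * (v z - Ustd z)) z = p • (fderiv ℝ v z - fderiv ℝ Ustd z) := by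
  have h1 := (c2_facts isOpen_ball h.cd).2.2.2.1 z hz
  have h2 : HasFDerivAt Ustd (fderiv ℝ Ustd z) z := (contDiff_Ustd.differentiable (by norm_num) z).hasFDerivAt
  exact ((h1.sub h2).const_mul p).fderiv

lemma fderiv_Ustd0 : fderiv ℝ Ustd 0 = 0 := by
  ext e; rw [fderiv_Ustd]; simp

lemma Core.fderiv_w00 (h : Core p v w0) : fderiv ℝ w0 0 = 0 := by
  have h1 : ∀ η : ℝ, 0 < η → ‖fderiv ℝ w0 0‖ ≤ η := by
    intro η hη
    obtain ⟨n, hn, h2, h3⟩ := ((h.lim1 0 hη).and (h.fderiv_v0.and (h.ev_ball 1))).exists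
    have := hn 0 (by simp)
    rw [fderiv_w h3.2 (mem_ball_self (by linarith [h3.1])), h2, fderiv_Ustd0] at this
    simpa using this
  by_contra hne
  have h2 : 0 < ‖fderiv ℝ w0 0‖ := norm_pos_iff.2 hne
  have := h1 (‖fderiv ℝ w0 0‖ / 2) (by positivity)
  linarith

/-- v is close to U in C^1 on compacts -/
lemma Core.vU (h : Core p v w0) (R : ℝ) {η : ℝ} (hη : 0 < η) : ∀ᶠ n in atTop, ∀ z : E2, ‖z‖ ≤ R →
    |v n z - Ustd z| ≤ η ∧ ‖fderiv ℝ (v n) z - fderiv ℝ Ustd z‖ ≤ η := by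
  obtain ⟨C, hC⟩ := (isCompact_closedBall (0:E2) R).exists_bound_of_continuousOn h.w0c.continuous.continuousOn
  obtain ⟨C', hC'⟩ := (isCompact_closedBall (0:E2) R).exists_bound_of_continuousOn
    (h.w0c.continuous_fderiv (by norm_num)).continuousOn
  filter_upwards [h.lim0 R one_pos, h.lim1 R one_pos, h.ev_ball (R + 1), h.ptop.eventually_ge_atTop ((C + 1) / η),
    h.ptop.eventually_ge_atTop ((C' + 1) / η), h.ptop.eventually_gt_atTop 0] with n h0 h1 h2 h3 h4 h5 z hz
  have hz' : z ∈ closedBall (0:E2) R := by simpa using hz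
  have hzb : z ∈ ball (0:E2) (p n) := by
    rw [mem_ball, dist_zero_right]; linarith [h2.1]
  rw [div_le_iff₀ hη] at h3 h4
  constructor
  · have a1 := h0 z hz
    have a2 := hC z hz'
    rw [Real.norm_eq_abs] at a2
    have a3 : |p n * (v n z - Ustd z)| ≤ p n * η := by
      have : |p n * (v n z - Ustd z)| ≤ |p n * (v n z - Ustd z) - w0 z| + |w0 z| := by
        simpa using abs_add_le (p n * (v n z - Ustd z) - w0 z) (w0 z)
      linarith
    rw [abs_mul, abs_of_pos h5] at a3
    exact le_of_mul_le_mul_left a3 h5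
  · have a1 := h1 z hz
    have a2 := hC' z hz'
    rw [fderiv_w h2.2 hzb] at a1
    have a3 : ‖p n • (fderiv ℝ (v n) z - fderiv ℝ Ustd z)‖ ≤ p n * η := by
      have : ‖p n • (fderiv ℝ (v n) z - fderiv ℝ Ustd z)‖ ≤ ‖p n • (fderiv ℝ (v n) z - fderiv ℝ Ustd z) - fderiv ℝ w0 z‖ + ‖fderiv ℝ w0 z‖ := by
        simpa using norm_add_le (p n • (fderiv ℝ (v n) z - fderiv ℝ Ustd z) - fderiv ℝ w0 z) (fderiv ℝ w0 z)
      linarith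
    rw [norm_smul, Real.norm_of_nonneg h5.le] at a3
    exact le_of_mul_le_mul_left a3 h5

lemma Core.mode1_lim (h : Core p v w0) {R : ℝ} (hR : 0 < R) {η : ℝ} (hη : 0 < η) : ∀ᶠ n in atTop,
    |R * mode1 (v n) 0 0 0 R + 8 * π * (R ^ 2 / (8 + R ^ 2))| ≤ η := by
  have hpi := Real.pi_pos
  filter_upwards [h.vU R (η := η / (2 * π * R)) (by positivity), h.ev_ball (R + 1)] with n h0 h2
  have hmem : R ∈ Set.Ioo (-(p n)) (p n) := ⟨by linarith [h2.1], by linarith [h2.1]⟩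
  have hc : Continuous fun θ => fderiv ℝ (v n) (0 + R • circDir θ) (circDir θ) := by
    have c1 : Continuous fun θ => fderiv ℝ (v n) (0 + R • circDir θ) := by
      have hcd := continuous_circDir
      exact (c2_facts isOpen_ball h2.2.cd).2.1.comp_continuous (by fun_prop) fun θ => mem_ball_polar hmem θ
    exact c1.clm_apply continuous_circDir
  have e : mode1 (v n) 0 0 0 R + 2 * π * (4 * R / (8 + R ^ 2)) =
      ∫ θ in (0:ℝ)..(2 * π), (fderiv ℝ (v n) (0 + R • circDir θ) (circDir θ) + 4 * R / (8 + R ^ 2)) := by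
    rw [intervalIntegral.integral_add (hc.intervalIntegrable _ _) (by simp)]
    simp [mode1]
    try ring
  have e2 : |mode1 (v n) 0 0 0 R + 2 * π * (4 * R / (8 + R ^ 2))| ≤ η / (2 * π * R) * (2 * π) := by
    rw [e]
    have := intervalIntegral.norm_integral_le_of_norm_le_const (a := 0) (b := 2 * π) (C := η / (2 * π * R))
      (f := fun θ => fderiv ℝ (v n) (0 + R • circDir θ) (circDir θ) + 4 * R / (8 + R ^ 2)) fun θ _ => ?_
    · rwa [sub_zero, abs_of_pos (by positivity), Real.norm_eq_abs] at this
    · have h3 := (h0 (0 + R • circDir θ) (by rw [zero_add, norm_smul_circDir hR.le])).2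
      have h4 := (fderiv ℝ (v n) (0 + R • circDir θ) - fderiv ℝ Ustd (0 + R • circDir θ)).le_opNorm (circDir θ)
      rw [norm_circDir, mul_one] at h4
      have h5 : fderiv ℝ Ustd (0 + R • circDir θ) (circDir θ) = -(4 * R / (8 + R ^ 2)) := by
        rw [fderiv_Ustd, zero_add, norm_smul_circDir hR.le, inner_smul_left, real_inner_self_eq_norm_sq, norm_circDir]
        simp; ring
      rw [sub_apply, h5, sub_neg_eq_add] at h4
      exact h4.trans h3
  have e3 : R * mode1 (v n) 0 0 0 R + 8 * π * (R ^ 2 / (8 + R ^ 2)) = R * (mode1 (v n) 0 0 0 R + 2 * π * (4 * R / (8 + R ^ 2))) := by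
    ring
  rw [e3, abs_mul, abs_of_pos hR]
  calc _ ≤ R * (η / (2 * π * R) * (2 * π)) := by gcongr
    _ = η := by field_simp

lemma small_exp (C : ℝ) (K : ℕ) {η : ℝ} (hη : 0 < η) :
    ∀ᶠ p : ℝ in atTop, (1/2:ℝ) ^ (p - 1) * (C * p ^ K) ≤ η := by
  have h1 := Real.tendsto_pow_mul_exp_neg_atTop_nhds_zero K
  have h2 := tendsto_rpow_mul_exp_neg_mul_atTop_nhds_zero K (Real.log 2) (Real.log_pos (by norm_num))
  have h3 : Tendsto (fun p : ℝ => 2 * C * (p ^ (K:ℝ) * Real.exp (-Real.log 2 * p))) atTop (𝓝 (2 * C * 0)) := h2.const_mul _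
  rw [mul_zero] at h3
  filter_upwards [h3.eventually_lt_const hη] with p hp
  have e : (1/2:ℝ) ^ (p - 1) = 2 * Real.exp (-Real.log 2 * p) := by
    rw [Real.rpow_def_of_pos (by norm_num), one_div, Real.log_inv, show -Real.log 2 * (p - 1) = Real.log 2 + -Real.log 2 * p by ring,
      Real.exp_add, Real.exp_log (by norm_num)]
  rw [e]
  rw [Real.rpow_natCast] at hp
  have : 2 * Real.exp (-Real.log 2 * p) * (C * p ^ K) = 2 * C * (p ^ K * Real.exp (-Real.log 2 * p)) := by ring
  rw [this]; exact hp.le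

lemma Core.decay (h : Core p v w0) (K : ℕ) : ∃ D > 0, ∀ᶠ n in atTop, ∀ z : E2, ‖z‖ ≤ p n ^ K →
    v n z ≤ D - 7 / 2 * Real.log (1 + ‖z‖) ∧ |v n z| ≤ D + 5 * Real.log (1 + ‖z‖) := by
  obtain ⟨R, hR, hm⟩ := h.mass
  obtain ⟨D, hD, H⟩ := decay_det hR
  refine ⟨D, hD, ?_⟩
  filter_upwards [hm (K + 3), h.sol (K + 4), h.ptop.eventually_ge_atTop 4, h.vU (4 * R) one_pos,
    h.mode1_lim (R := 2 * R) (by linarith) (η := 1 / 10) (by norm_num),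
    h.ptop.eventually (small_exp π (2 * (K + 3)) (η := 1 / 100) (by norm_num))] with n h1 h2 h3 h4 h5 h6 z hz
  refine H (p n) (p n ^ (K + 3)) (p n ^ (K + 4)) (v n) h2 (by linarith) ?_ h1 ?_ h5 (fun z hz => (h4 z hz).1) z ?_
  · exact pow_lt_pow_right₀ (by linarith) (by omega)
  · rw [← pow_mul, mul_comm (K + 3) 2]; exact h6
  · refine hz.trans ?_
    rw [le_div_iff₀ (by linarith), pow_add]
    have : 0 < p n ^ K := pow_pos (by linarith) K
    gcongr
    nlinarith [mul_self_nonneg (p n)]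
end

lemma exp_taylor (x y M : ℝ) (hx : Real.exp x ≤ M) (hy : Real.exp y ≤ M) :
    |Real.exp x - Real.exp y - Real.exp y * (x - y)| ≤ M * (x - y) ^ 2 := by
  have e1 : Real.exp x = Real.exp y * Real.exp (x - y) := by rw [← Real.exp_add]; congr 1; ring
  have e2 : Real.exp y = Real.exp x * Real.exp (-(x - y)) := by rw [← Real.exp_add]; congr 1; ring
  have hx0 := Real.exp_pos x
  have hy0 := Real.exp_pos y
  have l1 := Real.add_one_le_exp (x - y)
  have l2 := Real.add_one_le_exp (-(x - y))
  have lo : 0 ≤ Real.exp x - Real.exp y - Real.exp y * (x - y) := by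
    rw [e1]; nlinarith
  rw [abs_of_nonneg lo]
  have hsq := sq_nonneg (x - y)
  rcases le_total 0 (x - y) with h | h
  · have h3 : Real.exp x * (1 - (x - y) ^ 2) ≤ Real.exp y * (1 + (x - y)) := by
      conv_rhs => rw [e2]
      rw [mul_assoc]
      refine mul_le_mul_of_nonneg_left ?_ hx0.le
      nlinarith
    nlinarith [mul_le_mul_of_nonneg_right hx hsq]
  · have h4 := Real.quadratic_le_exp_of_nonneg (x := -(x - y)) (by linarith)
    set t := x - y
    have h5 : Real.exp t * Real.exp (-t) = 1 := by rw [← Real.exp_add]; simp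
    have h6 : Real.exp t ≤ 1 + t + t ^ 2 := by
      have hp := Real.exp_pos t
      have h7 : Real.exp t * (1 + -t + (-t) ^ 2 / 2) ≤ 1 := (mul_le_mul_of_nonneg_left h4 hp.le).trans h5.le
      have h8 : 1 ≤ (1 + t + t ^ 2) * (1 + -t + (-t) ^ 2 / 2) := by nlinarith [sq_nonneg (t^2), pow_nonneg (neg_nonneg.2 h) 3]
      have h9 : 0 < 1 + -t + (-t) ^ 2 / 2 := by nlinarith
      exact le_of_mul_le_mul_right (h7.trans h8) h9
    have : Real.exp x ≤ Real.exp y * (1 + t + t ^ 2) := by rw [e1]; gcongr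
    nlinarith [mul_le_mul_of_nonneg_right hy hsq]

lemma log_taylor {t : ℝ} (h1 : -(1/2) ≤ t) (h2 : t ≤ 0) : |Real.log (1 + t) - t + t ^ 2 / 2| ≤ 2 * |t| ^ 3 := by
  have ht : |-t| < 1 := by rw [abs_neg, abs_of_nonpos h2]; linarith
  have := Real.abs_log_sub_add_sum_range_le ht 2
  simp only [Finset.sum_range_succ, Finset.sum_range_zero, abs_neg] at this
  have e : 0 + (-t) ^ (0 + 1) / (((0:ℕ):ℝ) + 1) + (-t) ^ (1 + 1) / (((1:ℕ):ℝ) + 1) + Real.log (1 - -t) = Real.log (1 + t) - t + t ^ 2 / 2 := by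
    norm_num; ring
  rw [e] at this
  refine this.trans ?_
  have : |t| ≤ 1/2 := by rw [abs_of_nonpos h2]; linarith
  rw [div_le_iff₀ (by linarith)]
  have : 0 ≤ |t| ^ 3 := by positivity
  norm_num
  nlinarith

set_option maxHeartbeats 1000000 in
lemma err_alg {p v U w0 L b D M : ℝ} (hp : 1 ≤ p) (hD : 1 ≤ D) (hb : 1 ≤ b) (hL : 1 ≤ L)
    (hv0 : v ≤ 0) (hv : |v| ≤ D * L) (hU : |U| ≤ D * L) (hLb : L ^ 3 ≤ D * b) (hDL : D * L ≤ p / 2)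
    (hw : |w0| ≤ D * b) (hev : Real.exp v ≤ M) (heU : Real.exp U ≤ M) :
    |p ^ 2 * ((1 + v / p) ^ p - Real.exp U) - p * (Real.exp U * (w0 - U ^ 2 / 2)) - Real.exp U * (p * (p * (v - U) - w0))| ≤
      100 * D ^ 8 * M * (b ^ 2 + b * (|p * (p * (v - U) - w0)| / p) + (|p * (p * (v - U) - w0)| / p) ^ 2) := by
  have hp0 : 0 < p := by linarith
  set k := p * (p * (v - U) - w0) with hk
  set q := |k| / p with hq
  have hq0 : 0 ≤ q := by positivity
  have hvp : v / p ≤ 0 := div_nonpos_of_nonpos_of_nonneg hv0 hp0.le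
  have hvp2 : -(1/2) ≤ v / p := by
    rw [le_div_iff₀ hp0]; have := (abs_le.1 hv).1; linarith
  set g := 1 + v / p with hg
  have hg0 : 0 < g := by linarith
  set A := p * Real.log g with hA
  have hgp : g ^ p = Real.exp A := by rw [Real.rpow_def_of_pos hg0, hA, mul_comm]
  rw [hgp]
  have hAv : A ≤ v := by
    have := Real.log_le_sub_one_of_pos hg0
    calc A ≤ p * (g - 1) := by rw [hA]; gcongr
      _ = v := by rw [hg]; field_simp; ring
  have heA : Real.exp A ≤ M := (Real.exp_le_exp.2 hAv).trans hev
  have hM0 : 0 ≤ M := (Real.exp_pos U).le.trans heU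
  set R3 := Real.log g - v / p + (v / p) ^ 2 / 2 with hR3
  have hR3b : |p ^ 2 * R3| ≤ 2 * D ^ 3 * L ^ 3 / p := by
    have h1 := log_taylor hvp2 hvp
    rw [← hg, ← hR3, abs_div, abs_of_pos hp0] at h1
    rw [abs_mul, abs_of_nonneg (by positivity : 0 ≤ p ^ 2)]
    calc p ^ 2 * |R3| ≤ p ^ 2 * (2 * (|v| / p) ^ 3) := by gcongr
      _ = 2 * |v| ^ 3 / p := by field_simp
      _ ≤ 2 * (D * L) ^ 3 / p := by gcongr
      _ = _ := by ring
  set w := p * (v - U) with hwd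
  have hww : |w| ≤ D * b + q := by
    have : w = w0 + k / p := by rw [hk]; field_simp; ring
    rw [this]
    refine (abs_add_le _ _).trans ?_
    rw [abs_div, abs_of_pos hp0]; linarith
  have hvU : |v + U| ≤ 2 * D * L := (abs_add_le _ _).trans (by linarith)
  -- T - k
  set T := -(w / 2) * (v + U) + p * (p ^ 2 * R3) with hT
  have hAU : p ^ 2 * (A - U) = p * (w0 - U ^ 2 / 2) + k + T := by
    have : A = v - v ^ 2 / (2 * p) + p * R3 := by rw [hA, hR3]; field_simp; ring
    rw [this, hT, hk, hwd]; field_simp; ring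
  have hTb : |T| ≤ D * L * (D * b + q) + 2 * D ^ 3 * L ^ 3 := by
    rw [hT]
    refine (abs_add_le _ _).trans ?_
    have h1 : |-(w / 2) * (v + U)| ≤ (D * b + q) / 2 * (2 * D * L) := by
      rw [abs_mul, abs_neg, abs_div, abs_two]; gcongr
    have h2 : |p * (p ^ 2 * R3)| ≤ p * (2 * D ^ 3 * L ^ 3 / p) := by
      rw [abs_mul, abs_of_pos hp0]; gcongr
    have h3 : p * (2 * D ^ 3 * L ^ 3 / p) = 2 * D ^ 3 * L ^ 3 := by field_simp
    linarith
  have hLD : L ≤ D * b := by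
    refine le_trans ?_ hLb
    calc L = L ^ 1 := (pow_one L).symm
      _ ≤ L ^ 3 := pow_le_pow_right₀ hL (by norm_num)
  have hL2D : L ^ 2 ≤ D * b := by
    refine le_trans ?_ hLb
    exact pow_le_pow_right₀ hL (by norm_num)
  -- X
  set X := p * (A - U) with hX
  have hXe : X = (w0 - U ^ 2 / 2) + (k + T) / p := by
    rw [hX]; field_simp; linarith
  have hXb : |X| ≤ 6 * D ^ 4 * (b + q) := by
    rw [hXe]
    have h1 : |(k + T) / p| ≤ q + (D * b + q) / 2 + D ^ 3 * L ^ 2 / D := by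
      rw [abs_div, abs_of_pos hp0, div_le_iff₀ hp0]
      have a1 : |k + T| ≤ |k| + |T| := abs_add_le _ _
      have a2 : |k| = q * p := by rw [hq]; field_simp
      have a3 : D * L * (D * b + q) ≤ p / 2 * (D * b + q) := by gcongr
      have a4 : 2 * D ^ 3 * L ^ 3 ≤ D ^ 3 * L ^ 2 / D * p := by
        calc 2 * D ^ 3 * L ^ 3 = 2 * (D ^ 3 * L ^ 2 / D) * (D * L) := by field_simp
          _ ≤ 2 * (D ^ 3 * L ^ 2 / D) * (p / 2) := by gcongr
          _ = _ := by ring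
      have a5 : (q + (D * b + q) / 2 + D ^ 3 * L ^ 2 / D) * p = q * p + p / 2 * (D * b + q) + D ^ 3 * L ^ 2 / D * p := by ring
      rw [a5]; linarith
    have h1' : D ^ 3 * L ^ 2 / D = D ^ 2 * L ^ 2 := by field_simp
    rw [h1'] at h1
    have h2 : |w0 - U ^ 2 / 2| ≤ D * b + D ^ 2 * L ^ 2 := by
      refine (abs_sub _ _).trans ?_
      have : |U ^ 2 / 2| ≤ D ^ 2 * L ^ 2 := by
        rw [abs_of_nonneg (by positivity), ← sq_abs]
        have : |U| ^ 2 ≤ (D * L) ^ 2 := by gcongr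
        rw [mul_pow] at this
        have h0 : 0 ≤ D ^ 2 * L ^ 2 := by positivity
        linarith
      linarith
    have h3 : |w0 - U ^ 2 / 2 + (k + T) / p| ≤ 3/2 * (D * b) + 2 * (D ^ 2 * L ^ 2) + 3/2 * q :=
      (abs_add_le _ _).trans (by linarith)
    have h4 : D ^ 2 * L ^ 2 ≤ D ^ 2 * (D * b) := by gcongr
    have h5 : D * b ≤ D ^ 4 * b := by
      gcongr
      simpa using pow_le_pow_right₀ hD (by norm_num : 1 ≤ 4)
    have h6 : D ^ 2 * (D * b) ≤ D ^ 4 * b := by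
      have : D ^ 3 ≤ D ^ 4 := pow_le_pow_right₀ hD (by norm_num)
      calc D ^ 2 * (D * b) = D ^ 3 * b := by ring
        _ ≤ _ := by gcongr
    have h7 : q ≤ D ^ 4 * q := by
      exact le_mul_of_one_le_left hq0 (one_le_pow₀ hD)
    have h8 : 6 * D ^ 4 * (b + q) = 6 * (D ^ 4 * b) + 6 * (D ^ 4 * q) := by ring
    have h9 : 0 ≤ D ^ 4 * b := by positivity
    have h10 : 0 ≤ D ^ 4 * q := by positivity
    rw [h8]; linarith
  have hrem := exp_taylor A U M heA heU
  have e : p ^ 2 * (Real.exp A - Real.exp U) - p * (Real.exp U * (w0 - U ^ 2 / 2)) - Real.exp U * k =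
      p ^ 2 * (Real.exp A - Real.exp U - Real.exp U * (A - U)) + Real.exp U * T := by
    linear_combination Real.exp U * hAU
  rw [e]
  refine (abs_add_le _ _).trans ?_
  have b1 : |p ^ 2 * (Real.exp A - Real.exp U - Real.exp U * (A - U))| ≤ M * (72 * D ^ 8 * (b ^ 2 + q ^ 2)) := by
    rw [abs_mul, abs_of_nonneg (by positivity : 0 ≤ p ^ 2)]
    calc _ ≤ p ^ 2 * (M * (A - U) ^ 2) := by gcongr
      _ = M * |X| ^ 2 := by rw [sq_abs, hX]; ring
      _ ≤ M * (6 * D ^ 4 * (b + q)) ^ 2 := by gcongr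
      _ = M * (36 * D ^ 8 * (b + q) ^ 2) := by ring
      _ ≤ M * (36 * D ^ 8 * (2 * (b ^ 2 + q ^ 2))) := by
        have : (b + q) ^ 2 ≤ 2 * (b ^ 2 + q ^ 2) := by linarith [sq_nonneg (b - q), add_sq b q, sub_sq b q]
        gcongr
      _ = _ := by ring
  have b2 : |Real.exp U * T| ≤ M * (D ^ 8 * (3 * b ^ 2 + b * q)) := by
    rw [abs_mul, abs_of_pos (Real.exp_pos U)]
    have c1 : |T| ≤ D ^ 8 * (3 * b ^ 2 + b * q) := by
      refine hTb.trans ?_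
      have d1 : D * L * (D * b + q) ≤ D * (D * b) * (D * b + q) := by gcongr
      have d2 : 2 * D ^ 3 * L ^ 3 ≤ 2 * D ^ 3 * (D * b) := by gcongr
      have d3 : D * (D * b) * (D * b + q) ≤ D ^ 8 * (b ^ 2 + b * q) := by
        have f1 : D ^ 3 ≤ D ^ 8 := pow_le_pow_right₀ hD (by norm_num)
        have f2 : D ^ 2 ≤ D ^ 8 := pow_le_pow_right₀ hD (by norm_num)
        calc D * (D * b) * (D * b + q) = D ^ 3 * b ^ 2 + D ^ 2 * (b * q) := by ring
          _ ≤ D ^ 8 * b ^ 2 + D ^ 8 * (b * q) := by gcongr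
          _ = _ := by ring
      have d4 : 2 * D ^ 3 * (D * b) ≤ 2 * D ^ 8 * b ^ 2 := by
        have f1 : D ^ 4 ≤ D ^ 8 := pow_le_pow_right₀ hD (by norm_num)
        calc 2 * D ^ 3 * (D * b) = 2 * D ^ 4 * b := by ring
          _ ≤ 2 * D ^ 8 * b ^ 2 := by
            have : b ≤ b ^ 2 := by rw [sq]; exact le_mul_of_one_le_left (by linarith) hb
            gcongr
      have d5 : D ^ 8 * (3 * b ^ 2 + b * q) = D ^ 8 * (b ^ 2 + b * q) + 2 * D ^ 8 * b ^ 2 := by ring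
      rw [d5]; linarith
    gcongr
  have hbq : 0 ≤ b * q := by positivity
  have hfin : M * (72 * D ^ 8 * (b ^ 2 + q ^ 2)) + M * (D ^ 8 * (3 * b ^ 2 + b * q)) ≤
      100 * D ^ 8 * M * (b ^ 2 + b * q + q ^ 2) := by
    have : 0 ≤ D ^ 8 * M := by positivity
    have e : 100 * D ^ 8 * M * (b ^ 2 + b * q + q ^ 2) - (M * (72 * D ^ 8 * (b ^ 2 + q ^ 2)) + M * (D ^ 8 * (3 * b ^ 2 + b * q)))
      = D ^ 8 * M * (25 * b ^ 2 + 28 * q ^ 2 + 99 * (b * q)) := by ring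
    have : 0 ≤ D ^ 8 * M * (25 * b ^ 2 + 28 * q ^ 2 + 99 * (b * q)) := by positivity
    linarith
  linarith

def kk (p : ℝ) (v w0 : E2 → ℝ) (z : E2) : ℝ := p * (p * (v z - Ustd z) - w0 z)

lemma lap_lin {f g h : E2 → ℝ} {S : Set E2} (hS : IsOpen S) (hf : ContDiffOn ℝ 2 f S) (hg : ContDiffOn ℝ 2 g S)
    (hh : ContDiffOn ℝ 2 h S) (a b : ℝ) {z : E2} (hz : z ∈ S) :
    lap (fun z => a * (b * (f z - g z) - h z)) z = a * (b * (lap f z - lap g z) - lap h z) := by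
  obtain ⟨_, _, _, f3, f4⟩ := c2_facts hS hf
  obtain ⟨_, _, _, g3, g4⟩ := c2_facts hS hg
  obtain ⟨_, _, _, h3, h4⟩ := c2_facts hS hh
  rw [lap_eq (f4 z hz).differentiableAt, lap_eq (g4 z hz).differentiableAt, lap_eq (h4 z hz).differentiableAt]
  have ev : (fun y => fderiv ℝ (fun z => a * (b * (f z - g z) - h z)) y) =ᶠ[𝓝 z]
      fun y => a • (b • (fderiv ℝ f y - fderiv ℝ g y) - fderiv ℝ h y) := by
    filter_upwards [hS.mem_nhds hz] with y hy
    exact (((((f3 y hy).sub (g3 y hy)).const_mul b).sub (h3 y hy)).const_mul a).fderiv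
  have d : HasFDerivAt (fun y => a • (b • (fderiv ℝ f y - fderiv ℝ g y) - fderiv ℝ h y))
      (a • (b • (D2 f z - D2 g z) - D2 h z)) z :=
    (((((f4 z hz).sub (g4 z hz)).const_smul b).sub (h4 z hz)).const_smul a)
  have d' := d.congr_of_eventuallyEq ev
  rw [lap_eq d'.differentiableAt]
  unfold D2
  rw [d'.fderiv]
  simp only [Fin.sum_univ_two, D2, _root_.sub_apply, _root_.smul_apply, smul_eq_mul]
  ring

lemma kk_cd {p Q : ℝ} {v w0 : E2 → ℝ} (h : SolB p v Q) (hw : ContDiff ℝ 2 w0) : ContDiffOn ℝ 2 (kk p v w0) (ball 0 Q) :=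
  contDiffOn_const.mul (h.wcd.sub hw.contDiffOn)

lemma lap_kk {p Q : ℝ} {v w0 : E2 → ℝ} (h : SolB p v Q) (hw : ContDiff ℝ 2 w0)
    (weq : ∀ z : E2, -lap w0 z - Real.exp (Ustd z) * w0 z = -((Ustd z) ^ 2 / 2) * Real.exp (Ustd z))
    {z : E2} (hz : z ∈ ball (0:E2) Q) : lap (kk p v w0) z + Real.exp (Ustd z) * kk p v w0 z =
      -(p ^ 2 * ((1 + v z / p) ^ p - Real.exp (Ustd z)) - p * (Real.exp (Ustd z) * (w0 z - (Ustd z) ^ 2 / 2))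
        - Real.exp (Ustd z) * (p * (p * (v z - Ustd z) - w0 z))) := by
  have h1 := lap_lin isOpen_ball h.cd contDiff_Ustd.contDiffOn hw.contDiffOn p p hz
  have h2 := h.eq z hz
  have h3 := weq z
  unfold kk
  rw [h1, lap_Ustd]
  linear_combination p ^ 2 * (-h2) + p * h3

lemma log_le_pow {s a : ℝ} (hs : 0 < s) (ha : 1 ≤ a) : 1 + Real.log a ≤ (1 + 1 / s) * a ^ s := by
  have h1 := Real.log_le_rpow_div (by linarith : 0 ≤ a) hs
  have h2 : 1 ≤ a ^ s := Real.one_le_rpow ha hs.le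
  have : (1 + 1 / s) * a ^ s = a ^ s + a ^ s / s := by ring
  linarith

lemma abs_Ustd_le (z : E2) : |Ustd z| ≤ 4 * Real.log (1 + ‖z‖) := by
  rw [abs_of_nonpos (Ustd_nonpos z)]
  have h : Real.log (1 + ‖z‖ ^ 2 / 8) ≤ Real.log ((1 + ‖z‖) ^ 2) := by
    apply Real.log_le_log (by positivity); nlinarith [norm_nonneg z]
  rw [Real.log_pow] at h
  unfold Ustd; push_cast at h; linarith

lemma expU_le (z : E2) : Real.exp (Ustd z) ≤ 81 * (1 + ‖z‖) ^ (-(7/2) : ℝ) := by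
  have h0 := norm_nonneg z
  have h1 : Real.exp (Ustd z) ≤ 81 * (1 + ‖z‖) ^ (-(4:ℝ)) := by
    rw [expU, Real.rpow_neg (by positivity), show (4:ℝ) = ((4:ℕ):ℝ) by norm_num, Real.rpow_natCast, ← div_eq_mul_inv,
      div_le_div_iff₀ (by positivity) (by positivity)]
    have : 8 / 9 * (1 + ‖z‖) ^ 2 ≤ 8 + ‖z‖ ^ 2 := by nlinarith [sq_nonneg (‖z‖ - 8)]
    calc 64 * (1 + ‖z‖) ^ 4 = 81 * (8 / 9 * (1 + ‖z‖) ^ 2) ^ 2 := by ring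
      _ ≤ 81 * (8 + ‖z‖ ^ 2) ^ 2 := by gcongr
  refine h1.trans ?_
  gcongr
  · linarith
  · norm_num

lemma small_log (D : ℝ) (K : ℕ) : ∀ᶠ p : ℝ in atTop, D * (1 + Real.log (1 + p ^ K)) ≤ p / 2 := by
  have h1 : Tendsto (fun p : ℝ => p⁻¹ * (2 * |D| * (1 + Real.log 2)) + 2 * |D| * K * (Real.log p / p)) atTop (𝓝 (0 * (2 * |D| * (1 + Real.log 2)) + 2 * |D| * K * 0)) := by
    refine (tendsto_inv_atTop_zero.mul_const _).add (Tendsto.const_mul _ ?_)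
    have := Real.isLittleO_log_id_atTop.tendsto_div_nhds_zero
    simpa using this
  rw [zero_mul, mul_zero, add_zero] at h1
  filter_upwards [h1.eventually_lt_const one_pos, eventually_ge_atTop 1] with p h hp
  have hp0 : 0 < p := by linarith
  have h2 : Real.log (1 + p ^ K) ≤ Real.log 2 + K * Real.log p := by
    rw [← Real.log_pow, ← Real.log_mul (by norm_num) (by positivity)]
    apply Real.log_le_log (by positivity)
    have := one_le_pow₀ hp (n := K); linarith
  have h3 : 0 ≤ 1 + Real.log (1 + p ^ K) := by
    have : 0 ≤ Real.log (1 + p ^ K) := Real.log_nonneg (by have := pow_pos hp0 K; linarith)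
    linarith
  calc D * (1 + Real.log (1 + p ^ K)) ≤ |D| * (1 + Real.log (1 + p ^ K)) := by gcongr; exact le_abs_self D
    _ ≤ |D| * (1 + (Real.log 2 + K * Real.log p)) := by gcongr
    _ = p / 2 * (p⁻¹ * (2 * |D| * (1 + Real.log 2)) + 2 * |D| * K * (Real.log p / p)) := by field_simp; ring
    _ ≤ p / 2 * 1 := by gcongr
    _ = _ := by ring

section
variable {p : ℕ → ℝ} {v : ℕ → E2 → ℝ} {w0 : E2 → ℝ}

set_option maxHeartbeats 2000000 in
lemma Core.err (h : Core p v w0) (K : ℕ) : ∃ C > 0, ∀ η > 0, ∀ᶠ n in atTop, ∀ z : E2, ‖z‖ ≤ p n ^ K →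
    |lap (kk (p n) (v n) w0) z + Real.exp (Ustd z) * kk (p n) (v n) w0 z| ≤
      (C + η * |kk (p n) (v n) w0 z|) * (1 + ‖z‖) ^ (-(5/2) : ℝ) := by
  obtain ⟨D0, hD0, hdec⟩ := h.decay K
  obtain ⟨Cw, hCw, hw⟩ := h.wgr (1/4) (by norm_num)
  set D := D0 + 5 + 2197 + Cw + Real.exp D0 + 81 with hD
  have hexp := Real.exp_pos D0
  have hD1 : 1 ≤ D := by linarith
  have hDp : 0 < D := by linarith
  set C := 100 * D ^ 8 * D with hC
  have hC0 : 0 < C := by positivity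
  refine ⟨C, hC0, fun η hη => ?_⟩
  set η' := η / C with hη'
  have hη'0 : 0 < η' := by positivity
  have ht : Tendsto (fun a : ℝ => 3 * D ^ 2 * a ^ (-(3/4) : ℝ)) atTop (𝓝 (3 * D ^ 2 * 0)) :=
    (tendsto_rpow_neg_atTop (by norm_num : (0:ℝ) < 3/4)).const_mul _
  rw [mul_zero] at ht
  obtain ⟨R, hR⟩ := eventually_atTop.1 (ht.eventually_lt_const (half_pos hη'0))
  filter_upwards [hdec, h.ptop.eventually_ge_atTop 2, h.ptop.eventually (small_log D K), h.lim0 R one_pos,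
    h.ptop.eventually_ge_atTop (2 / η'), h.sol (K + 1)] with n h1 h2 h3 h4 h5 h6 z hz
  have hp0 : 0 < p n := by linarith
  have hzb : z ∈ ball (0:E2) (p n ^ (K + 1)) := by
    rw [mem_ball, dist_zero_right]
    exact hz.trans_lt (pow_lt_pow_right₀ (by linarith) (by omega))
  rw [lap_kk h6 h.w0c h.weq hzb, abs_neg]
  have hz0 := norm_nonneg z
  set a := 1 + ‖z‖ with ha
  have ha1 : 1 ≤ a := by linarith
  have ha0 : 0 < a := by linarith
  have hla : 0 ≤ Real.log a := Real.log_nonneg ha1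
  obtain ⟨d1, d2⟩ := h1 z hz
  have hLb : (1 + Real.log a) ^ 3 ≤ D * a ^ (1/4:ℝ) := by
    have e1 := log_le_pow (s := 1/12) (by norm_num) ha1
    calc (1 + Real.log a) ^ 3 ≤ ((1 + 1 / (1/12)) * a ^ (1/12:ℝ)) ^ 3 := by gcongr
      _ = 2197 * a ^ (1/4:ℝ) := by
        rw [mul_pow, ← Real.rpow_natCast (a ^ (1/12:ℝ)), ← Real.rpow_mul ha0.le]; norm_num
      _ ≤ _ := by gcongr; linarith
  have hb1 : 1 ≤ a ^ (1/4:ℝ) := Real.one_le_rpow ha1 (by norm_num)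
  have hLa : Real.log a ≤ Real.log (1 + p n ^ K) := Real.log_le_log ha0 (by linarith)
  have hvL : |v n z| ≤ D * (1 + Real.log a) := by
    calc |v n z| ≤ D0 * 1 + 5 * Real.log a := by linarith
      _ ≤ D * 1 + D * Real.log a := by gcongr <;> linarith
      _ = _ := by ring
  have hUL : |Ustd z| ≤ D * (1 + Real.log a) := by
    have := abs_Ustd_le z
    calc |Ustd z| ≤ 4 * Real.log a := this
      _ ≤ D * Real.log a := by gcongr; linarith
      _ ≤ _ := by gcongr; linarith
  have hwb : |w0 z| ≤ D * a ^ (1/4:ℝ) := (hw z).trans (by gcongr; linarith)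
  have hev : Real.exp (v n z) ≤ D * a ^ (-(7/2) : ℝ) := by
    calc Real.exp (v n z) ≤ Real.exp (D0 - 7 / 2 * Real.log a) := Real.exp_le_exp.2 d1
      _ = Real.exp D0 * a ^ (-(7/2) : ℝ) := by
        rw [Real.rpow_def_of_pos ha0, ← Real.exp_add]; congr 1; ring
      _ ≤ _ := by gcongr; linarith
  have hDL : D * (1 + Real.log a) ≤ p n / 2 := le_trans (by gcongr) h3
  have key := err_alg (p := p n) (v := v n z) (U := Ustd z) (w0 := w0 z) (L := 1 + Real.log a) (b := a ^ (1/4:ℝ)) (D := D)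
    (M := D * a ^ (-(7/2) : ℝ)) (by linarith) hD1 hb1
    (by linarith) (h6.up z hzb) hvL hUL hLb hDL hwb hev
    ((expU_le z).trans (by gcongr; linarith))
  refine key.trans ?_
  change 100 * D ^ 8 * (D * a ^ (-(7/2) : ℝ)) * ((a ^ (1/4:ℝ)) ^ 2 + a ^ (1/4:ℝ) * (|kk (p n) (v n) w0 z| / p n) + (|kk (p n) (v n) w0 z| / p n) ^ 2) ≤ _
  have hkk : |kk (p n) (v n) w0 z| / p n ^ 2 ≤ 3 * D ^ 2 * a ^ (1/4:ℝ) ∧ (‖z‖ ≤ R → |kk (p n) (v n) w0 z| / p n ^ 2 ≤ 1 / p n) := by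
    have hLb1 : 1 + Real.log a ≤ D * a ^ (1/4:ℝ) := by
      refine le_trans ?_ hLb
      calc 1 + Real.log a = (1 + Real.log a) ^ 1 := (pow_one _).symm
        _ ≤ _ := pow_le_pow_right₀ (by linarith) (by norm_num)
    constructor
    · have e : |kk (p n) (v n) w0 z| / p n ^ 2 = |v n z - Ustd z - w0 z / p n| := by
        rw [← abs_of_pos (pow_pos hp0 2), ← abs_div, kk]; congr 1
        field_simp
      rw [e]
      have e1 : |v n z - Ustd z - w0 z / p n| ≤ |v n z| + |Ustd z| + |w0 z / p n| :=
        (abs_sub _ _).trans (by gcongr; exact abs_sub _ _)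
      have e2 : |w0 z / p n| ≤ |w0 z| := by
        rw [abs_div, abs_of_pos hp0]; exact div_le_self (abs_nonneg _) (by linarith)
      have e3 : D * (1 + Real.log a) ≤ D * (D * a ^ (1/4:ℝ)) := by gcongr
      have e4 : D * a ^ (1/4:ℝ) ≤ D * (D * a ^ (1/4:ℝ)) := le_mul_of_one_le_left (by positivity) hD1
      calc _ ≤ 3 * (D * (D * a ^ (1/4:ℝ))) := by linarith
        _ = _ := by ring
    · intro hzR
      have := h4 z hzR
      rw [kk, abs_mul, abs_of_pos hp0, div_le_div_iff₀ (by positivity) hp0]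
      calc p n * |p n * (v n z - Ustd z) - w0 z| * p n ≤ p n * 1 * p n := by gcongr
        _ = _ := by ring
  set κ := |kk (p n) (v n) w0 z| with hκ
  have hκ0 : 0 ≤ κ := abs_nonneg _
  have hp2 : 1 / p n ≤ η' / 2 := by
    rw [div_le_iff₀ hη'0] at h5
    rw [div_le_iff₀ hp0]; linarith
  have s1 : a⁻¹ * a ^ (1/4:ℝ) = a ^ (-(3/4) : ℝ) := by
    rw [← Real.rpow_neg_one, ← Real.rpow_add ha0]; norm_num
  have s1' : a⁻¹ * a ^ (1/4:ℝ) ≤ 1 := by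
    rw [s1]; exact Real.rpow_le_one_of_one_le_of_nonpos ha1 (by norm_num)
  have t1 : a⁻¹ * (a ^ (1/4:ℝ) / p n) ≤ η' / 2 := by
    calc a⁻¹ * (a ^ (1/4:ℝ) / p n) = (a⁻¹ * a ^ (1/4:ℝ)) * (1 / p n) := by ring
      _ ≤ 1 * (1 / p n) := by gcongr
      _ ≤ _ := by linarith
  have t2 : a⁻¹ * (κ / p n ^ 2) ≤ η' / 2 := by
    rcases le_total ‖z‖ R with hc | hc
    · calc a⁻¹ * (κ / p n ^ 2) ≤ 1 * (1 / p n) :=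
            mul_le_mul (inv_le_one_of_one_le₀ ha1) (hkk.2 hc) (by positivity) (by norm_num)
        _ ≤ _ := by linarith
    · calc a⁻¹ * (κ / p n ^ 2) ≤ a⁻¹ * (3 * D ^ 2 * a ^ (1/4:ℝ)) := by gcongr; exact hkk.1
        _ = 3 * D ^ 2 * (a⁻¹ * a ^ (1/4:ℝ)) := by ring
        _ ≤ _ := by rw [s1]; exact (hR a (by linarith)).le
  have s2 : a ^ (-(7/2) : ℝ) = a ^ (-(5/2) : ℝ) * a⁻¹ := by
    rw [← Real.rpow_neg_one, ← Real.rpow_add ha0]; norm_num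
  have s3 : a⁻¹ * (a ^ (1/4:ℝ)) ^ 2 ≤ 1 := by
    rw [← Real.rpow_natCast (a ^ (1/4:ℝ)), ← Real.rpow_mul ha0.le, ← Real.rpow_neg_one, ← Real.rpow_add ha0]
    exact Real.rpow_le_one_of_one_le_of_nonpos ha1 (by norm_num)
  rw [s2]
  have e : 100 * D ^ 8 * (D * (a ^ (-(5/2) : ℝ) * a⁻¹)) * ((a ^ (1/4:ℝ)) ^ 2 + a ^ (1/4:ℝ) * (κ / p n) + (κ / p n) ^ 2) =
      C * (a⁻¹ * (a ^ (1/4:ℝ)) ^ 2 + κ * (a⁻¹ * (a ^ (1/4:ℝ) / p n) + a⁻¹ * (κ / p n ^ 2))) * a ^ (-(5/2) : ℝ) := by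
    rw [hC]; ring
  rw [e]
  have hη'' : C * (κ * (η' / 2 + η' / 2)) = η * κ := by rw [hη']; field_simp; ring
  calc _ ≤ C * (1 + κ * (η' / 2 + η' / 2)) * a ^ (-(5/2) : ℝ) := by gcongr
    _ = _ := by rw [mul_add, hη'', mul_one]

lemma triv_bound (h : Core p v w0) {τ : ℝ} (hτ : τ ∈ Set.Ioo (0:ℝ) 1) {K : ℕ} (hK : 8 ≤ K * τ) :
    ∃ B > 0, ∀ᶠ n in atTop, ∀ z : E2, p n ^ K / 2 ≤ ‖z‖ → -p n ≤ v n z → v n z ≤ 0 →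
      |kk (p n) (v n) w0 z| ≤ B * (1 + ‖z‖) ^ τ := by
  obtain ⟨Cw, hCw, hw⟩ := h.wgr (τ / 2) ⟨by linarith [hτ.1], by linarith [hτ.2]⟩
  have hτ0 := hτ.1
  set Cu := 4 * (1 + 1 / (τ / 2)) with hCu
  have hCu0 : 0 < Cu := by positivity
  refine ⟨2 + 2 * Cu + 2 * Cw, by positivity, ?_⟩
  filter_upwards [h.ptop.eventually_ge_atTop 1] with n hp z hz hv1 hv2
  have hp0 : 0 < p n := by linarith
  have hz0 := norm_nonneg z
  set a := 1 + ‖z‖ with ha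
  have ha1 : 1 ≤ a := by linarith
  have ha0 : 0 < a := by linarith
  have h8 : p n ^ 8 ≤ 2 * a ^ τ := by
    calc p n ^ 8 = p n ^ (8:ℝ) := by rw [← Real.rpow_natCast]; norm_num
      _ ≤ p n ^ (K * τ) := Real.rpow_le_rpow_of_exponent_le hp hK
      _ = (p n ^ K) ^ τ := by rw [Real.rpow_mul hp0.le, Real.rpow_natCast]
      _ ≤ (2 * a) ^ τ := Real.rpow_le_rpow (by positivity) (by linarith) hτ0.le
      _ = 2 ^ τ * a ^ τ := Real.mul_rpow (by norm_num) ha0.le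
      _ ≤ 2 * a ^ τ := by
        gcongr
        calc (2:ℝ) ^ τ ≤ 2 ^ (1:ℝ) := Real.rpow_le_rpow_of_exponent_le (by norm_num) hτ.2.le
          _ = 2 := Real.rpow_one 2
  have h3 : p n ^ 3 ≤ 2 * a ^ τ := (pow_le_pow_right₀ hp (by norm_num)).trans h8
  have hsq : a ^ τ = (a ^ (τ / 2)) ^ 2 := by
    rw [← Real.rpow_natCast, ← Real.rpow_mul ha0.le]; congr 1; push_cast; ring
  have h2 : p n ^ 2 ≤ 2 * a ^ (τ / 2) := by
    have : (p n ^ 2) ^ 2 ≤ (2 * a ^ (τ / 2)) ^ 2 := by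
      calc (p n ^ 2) ^ 2 = p n ^ 4 := by ring
        _ ≤ p n ^ 8 := pow_le_pow_right₀ hp (by norm_num)
        _ ≤ 2 * a ^ τ := h8
        _ ≤ 4 * a ^ τ := by gcongr; norm_num
        _ = _ := by rw [hsq]; ring
    exact le_of_sq_le_sq this (by positivity)
  have h1 : p n ≤ 2 * a ^ (τ / 2) := le_trans (by nlinarith) h2
  have hU : |Ustd z| ≤ Cu * a ^ (τ / 2) := by
    have e1 := abs_Ustd_le z
    have e2 := log_le_pow (s := τ / 2) (by positivity) ha1
    rw [hCu, mul_assoc]; rw [← ha] at e1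
    linarith
  have hv : |v n z| ≤ p n := by rw [abs_le]; exact ⟨hv1, by linarith⟩
  have e : kk (p n) (v n) w0 z = p n ^ 2 * v n z - p n ^ 2 * Ustd z - p n * w0 z := by unfold kk; ring
  rw [e]
  calc |p n ^ 2 * v n z - p n ^ 2 * Ustd z - p n * w0 z| ≤ |p n ^ 2 * v n z| + |p n ^ 2 * Ustd z| + |p n * w0 z| :=
        (abs_sub _ _).trans (by gcongr; exact abs_sub _ _)
    _ = p n ^ 2 * |v n z| + p n ^ 2 * |Ustd z| + p n * |w0 z| := by
        rw [abs_mul, abs_mul, abs_mul, abs_of_pos (pow_pos hp0 2), abs_of_pos hp0]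
    _ ≤ p n ^ 2 * p n + (2 * a ^ (τ / 2)) * (Cu * a ^ (τ / 2)) + (2 * a ^ (τ / 2)) * (Cw * a ^ (τ / 2)) := by
        gcongr; exact hw z
    _ = p n ^ 3 + (2 * Cu + 2 * Cw) * a ^ τ := by rw [hsq]; ring
    _ ≤ 2 * a ^ τ + (2 * Cu + 2 * Cw) * a ^ τ := by gcongr
    _ = _ := by ring

lemma Core.part1 (h : Core p v w0) {τ : ℝ} (hτ : τ ∈ Set.Ioo (0:ℝ) 1) : ∃ C > 0, ∀ᶠ n in atTop, ∀ z : E2,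
    -p n ≤ v n z → v n z ≤ 0 → |kk (p n) (v n) w0 z| ≤ C * (1 + ‖z‖) ^ τ := by
  obtain ⟨K, hK⟩ := exists_nat_ge (8 / τ)
  rw [div_le_iff₀ hτ.1] at hK
  have hK1 : 1 ≤ K := by
    by_contra hc
    have : K = 0 := by omega
    rw [this] at hK; norm_num at hK
  obtain ⟨B, hB, htriv⟩ := triv_bound h hτ hK
  obtain ⟨Ce, hCe, herr⟩ := h.err K
  obtain ⟨Cl, Rs, hCl, hRs, hlin⟩ := linear_est hτ.1 hτ.2
  refine ⟨B + 2 * Cl * (Ce + B), by positivity, ?_⟩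
  filter_upwards [htriv, herr (1 / (2 * Cl)) (by positivity), h.ptop.eventually_ge_atTop (2 * Rs), h.sol (K + 1),
    h.fderiv_v0, h.ptop.eventually_ge_atTop 2] with n h1 h2 h3 h4 h5 h6 z hv1 hv2
  have ha : ∀ z : E2, 1 ≤ 1 + ‖z‖ := fun z => by linarith [norm_nonneg z]
  have hat : ∀ z : E2, 0 < (1 + ‖z‖) ^ τ := fun z => Real.rpow_pos_of_pos (by linarith [ha z]) _
  rcases le_total (p n ^ K / 2) ‖z‖ with hz | hz
  · refine (h1 z hz hv1 hv2).trans ?_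
    gcongr
    have : 0 ≤ 2 * Cl * (Ce + B) := by positivity
    linarith
  set Q := p n ^ K with hQ
  have hpQ : p n ≤ Q := by
    calc p n = p n ^ 1 := (pow_one _).symm
      _ ≤ _ := pow_le_pow_right₀ (by linarith) hK1
  have hQ' : Q < p n ^ (K + 1) := pow_lt_pow_right₀ (by linarith) (by omega)
  have hkc := kk_cd h4 h.w0c
  have hcont : ContinuousOn (fun z => |kk (p n) (v n) w0 z| / (1 + ‖z‖) ^ τ) (closedBall 0 Q) := by
    refine ContinuousOn.div (hkc.continuousOn.mono (closedBall_subset_ball hQ')).abs ?_ fun z _ => (hat z).ne'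
    exact ContinuousOn.rpow_const (by fun_prop) fun z _ => Or.inl (by linarith [ha z])
  obtain ⟨y, hy, hmax⟩ := (isCompact_closedBall (0:E2) Q).exists_isMaxOn ⟨0, by simp; linarith⟩ hcont
  set N := |kk (p n) (v n) w0 y| / (1 + ‖y‖) ^ τ with hN
  have hN0 : 0 ≤ N := by have := hat y; positivity
  have hkN : ∀ z : E2, ‖z‖ ≤ Q → |kk (p n) (v n) w0 z| ≤ N * (1 + ‖z‖) ^ τ := by
    intro z hz
    have := hmax (show z ∈ closedBall (0:E2) Q by simpa using hz)
    simp only [Set.mem_ofPred_eq] at this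
    rwa [div_le_iff₀ (hat z)] at this
  have hfd : fderiv ℝ (kk (p n) (v n) w0) 0 = 0 := by
    have h0 : (0:E2) ∈ ball (0:E2) (p n ^ (K + 1)) := mem_ball_self (by linarith)
    have d1 := (c2_facts isOpen_ball h4.wcd).2.2.2.1 0 h0
    rw [fderiv_w h4 h0, h5, fderiv_Ustd0] at d1
    have d2 := (h.w0c.differentiable (by norm_num) 0).hasFDerivAt
    rw [h.fderiv_w00] at d2
    have := ((d1.sub d2).const_mul (p n)).fderiv
    change fderiv ℝ (fun y => p n * (p n * (v n y - Ustd y) - w0 y)) 0 = 0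
    simpa using this
  have key := hlin (kk (p n) (v n) w0) (Ce + 1 / (2 * Cl) * N) B Q (p n ^ (K + 1)) (by positivity) hB.le
    (by linarith) hQ' hkc (by simp [kk, h.v0, h.w00, Ustd]) hfd (fun z hz => ?_) (fun z hz1 hz2 => ?_)
  · have k1 := key y (by simpa using hy)
    have k2 : N ≤ Cl * (Ce + 1 / (2 * Cl) * N + B) := by
      rw [hN, div_le_iff₀ (hat y)]; exact k1
    have k3 : Cl * (Ce + 1 / (2 * Cl) * N + B) = Cl * (Ce + B) + N / 2 := by field_simp; ring
    have k4 : N ≤ 2 * Cl * (Ce + B) := by rw [k3] at k2; linarith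
    refine (hkN z (by linarith)).trans ?_
    have := hat z
    gcongr
    linarith
  · refine (h2 z hz).trans ?_
    have hn := hkN z hz
    have : (1:ℝ) ≤ (1 + ‖z‖) ^ τ := Real.one_le_rpow (ha z) hτ.1.le
    rw [Real.rpow_add (by linarith [ha z])]
    rw [show (-5/2 : ℝ) = -(5/2) by norm_num]
    calc (Ce + 1 / (2 * Cl) * |kk (p n) (v n) w0 z|) * (1 + ‖z‖) ^ (-(5/2) : ℝ) ≤
        (Ce * (1 + ‖z‖) ^ τ + 1 / (2 * Cl) * (N * (1 + ‖z‖) ^ τ)) * (1 + ‖z‖) ^ (-(5/2) : ℝ) := by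
          gcongr
          exact le_mul_of_one_le_right hCe.le this
      _ = _ := by ring
  · have hzb : z ∈ ball (0:E2) (p n ^ (K + 1)) := by
      rw [mem_ball, dist_zero_right]; linarith
    exact h1 z (by linarith) (h4.lo z hzb).le (h4.up z hzb)
end

section
variable {k : E2 → ℝ} {c : E2} {R R' : ℝ}

lemma mode_barrier (hk : ContDiffOn ℝ 2 k (ball c R')) (hR : 0 < R) (hRR : R < R') (m : ℕ) (hm : 1 ≤ m)
    (α : ℝ) {M L : ℝ} (hM : ∀ z ∈ closedBall c R, |k z| ≤ M) (h0 : mode k c m α 0 = 0)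
    (hL0 : 0 ≤ L)
    (hL : ∀ r ∈ Set.Ioo 0 R, |mode (lap k) c m α r| ≤ 2 * π * (L * r ^ (m - 1))) :
    ∀ r ∈ Set.Icc 0 R, mode k c m α r ≤ (2 * π * M / R ^ m + 2 * π * L * R) * r ^ m := by
  have hpi := Real.pi_pos
  have hM0 : 0 ≤ M := (abs_nonneg _).trans (hM c (mem_closedBall_self hR.le))
  set b := 2 * π * L with hb
  have hb0 : 0 ≤ b := by positivity
  set a := 2 * π * M / R ^ m + b * R with ha
  have memI : ∀ r ∈ Set.Icc 0 R, r ∈ Set.Ioo (-R') R' := fun r hr => ⟨by linarith [hr.1], by linarith [hr.2]⟩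
  -- use strict barrier with parameter s
  have main : ∀ s > 0, ∀ r ∈ Set.Icc 0 R,
      mode k c m α r - ((a + s * R) * r ^ m - (b + s) * r ^ (m + 1)) ≤ 0 := by
    intro s hs
    have hd : ∀ j : ℕ, ∀ r : ℝ, HasDerivAt (fun r : ℝ => r ^ j) (j * r ^ (j - 1)) r := fun j r => hasDerivAt_pow j r
    refine max_principle (d1 := fun r => mode1 k c m α r - ((a + s * R) * (m * r ^ (m - 1)) - (b + s) * ((m + 1 : ℕ) * r ^ (m + 1 - 1))))
      (d2 := fun r => mode2 k c m α r - ((a + s * R) * (m * ((m - 1 : ℕ) * r ^ (m - 1 - 1))) - (b + s) * ((m + 1 : ℕ) * ((m + 1 - 1 : ℕ) * r ^ (m + 1 - 1 - 1)))))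
      ?_ ?_ ?_ ?_ ?_ ?_
    · have : ContinuousOn (mode k c m α) (Set.Icc 0 R) := fun r hr =>
        (hasDerivAt_mode hk m α (memI r hr)).continuousAt.continuousWithinAt
      exact this.sub (by fun_prop)
    · intro r hr
      exact (hasDerivAt_mode hk m α (memI r ⟨hr.1.le, hr.2.le⟩)).sub
        (((hd m r).const_mul _).sub ((hd (m + 1) r).const_mul _))
    · intro r hr
      exact (hasDerivAt_mode1 hk m α (memI r ⟨hr.1.le, hr.2.le⟩)).sub
        ((((hd (m - 1) r).const_mul _).const_mul _).sub (((hd (m + 1 - 1) r).const_mul _).const_mul _))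
    · intro r hr hpos
      have ode := mode_ode hk m α (memI r ⟨hr.1.le, hr.2.le⟩)
      have hl := (abs_le.1 (hL r hr)).1
      obtain ⟨j, rfl⟩ : ∃ j, m = j + 1 := ⟨m - 1, by omega⟩
      have e1 : r ^ 2 * (((j + 1 : ℕ):ℝ) * ((j + 1 - 1 : ℕ) * r ^ (j + 1 - 1 - 1))) + r * ((j + 1 : ℕ) * r ^ (j + 1 - 1)) =
          ((j + 1 : ℕ):ℝ) ^ 2 * r ^ (j + 1) := by
        rcases j with _ | j
        · simp
        · simp only [Nat.add_sub_cancel]; push_cast; ring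
      have e2 : r ^ 2 * (((j + 1 + 1 : ℕ):ℝ) * ((j + 1 + 1 - 1 : ℕ) * r ^ (j + 1 + 1 - 1 - 1))) + r * ((j + 1 + 1 : ℕ) * r ^ (j + 1 + 1 - 1)) =
          ((j + 1 + 1 : ℕ):ℝ) ^ 2 * r ^ (j + 1 + 1) := by
        simp only [Nat.add_sub_cancel]; push_cast; ring
      have e3 : r ^ 2 * (mode2 k c (j+1) α r - ((a + s * R) * ((j + 1 : ℕ) * ((j + 1 - 1 : ℕ) * r ^ (j + 1 - 1 - 1))) - (b + s) * ((j + 1 + 1 : ℕ) * ((j + 1 + 1 - 1 : ℕ) * r ^ (j + 1 + 1 - 1 - 1)))))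
         + r * (mode1 k c (j+1) α r - ((a + s * R) * ((j + 1 : ℕ) * r ^ (j + 1 - 1)) - (b + s) * ((j + 1 + 1 : ℕ) * r ^ (j + 1 + 1 - 1)))) =
         ((j + 1 : ℕ):ℝ) ^ 2 * (mode k c (j+1) α r - ((a + s * R) * r ^ (j+1) - (b + s) * r ^ (j + 1 + 1)))
          + r ^ 2 * mode (lap k) c (j+1) α r + (b + s) * (2 * j + 3) * r ^ (j + 1 + 1) := by
        have e2' : ((j + 1 + 1 : ℕ):ℝ) ^ 2 = ((j + 1 : ℕ):ℝ) ^ 2 + (2 * j + 3) := by push_cast; ring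
        rw [e2'] at e2
        linear_combination ode - (a + s * R) * e1 + (b + s) * e2
      rw [e3]
      have h1 : 0 < ((j + 1 : ℕ):ℝ) ^ 2 * (mode k c (j+1) α r - ((a + s * R) * r ^ (j+1) - (b + s) * r ^ (j + 1 + 1))) := by
        apply mul_pos _ hpos; positivity
      have hr0 := hr.1
      simp only [Nat.add_sub_cancel] at hl
      have h2 : r ^ 2 * (-(2 * π * (L * r ^ j))) ≤ r ^ 2 * mode (lap k) c (j+1) α r := by gcongr
      have h3 : r ^ 2 * (-(2 * π * (L * r ^ j))) = -(b * r ^ (j + 1 + 1)) := by rw [hb]; ring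
      have h4 : b * r ^ (j + 1 + 1) ≤ (b + s) * (2 * j + 3) * r ^ (j + 1 + 1) := by
        have : (0:ℝ) ≤ j := by positivity
        gcongr
        nlinarith
      linarith
    · have : m ≠ 0 := by omega
      simp [h0, this]
    · have h1 : |mode k c m α R| ≤ 2 * π * M := by
        refine abs_mode_le fun θ => hM _ ?_
        rw [mem_closedBall, dist_eq_norm, add_sub_cancel_left, norm_smul_circDir hR.le]
      have h2 : (a + s * R) * R ^ m - (b + s) * R ^ (m + 1) = 2 * π * M := by
        rw [ha]; field_simp; ring
      linarith [(abs_le.1 h1).2]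
  intro r hr
  have h1 : Tendsto (fun s : ℝ => (a + s * R) * r ^ m - (b + s) * r ^ (m + 1)) (𝓝[>] 0)
      (𝓝 ((a + 0 * R) * r ^ m - (b + 0) * r ^ (m + 1))) := by
    refine Tendsto.mono_left ?_ nhdsWithin_le_nhds
    apply Continuous.tendsto; fun_prop
  have h2 : mode k c m α r ≤ (a + 0 * R) * r ^ m - (b + 0) * r ^ (m + 1) := by
    refine ge_of_tendsto h1 ?_
    filter_upwards [self_mem_nhdsWithin] with s hs
    linarith [main s hs r hr]
  have h3 : 0 ≤ b * r ^ (m + 1) := by have := hr.1; positivity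
  linarith

lemma int_trig1 (A B α : ℝ) : ∫ θ in (0:ℝ)..(2 * π), (A * Real.cos θ + B * Real.sin θ) * Real.cos (θ - α) =
    π * (A * Real.cos α + B * Real.sin α) := by
  have h : ∀ θ ∈ Set.uIcc 0 (2 * π), HasDerivAt (fun θ => (A * Real.cos α + B * Real.sin α) * θ / 2 +
      (A * Real.cos α - B * Real.sin α) * (Real.sin (2 * θ)) / 4 - (A * Real.sin α + B * Real.cos α) * Real.cos (2 * θ) / 4)
      ((A * Real.cos θ + B * Real.sin θ) * Real.cos (θ - α)) θ := by
    intro θ _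
    have h2 : HasDerivAt (fun θ : ℝ => 2 * θ) 2 θ := by simpa using (hasDerivAt_id θ).const_mul 2
    have := ((((hasDerivAt_id θ).const_mul (A * Real.cos α + B * Real.sin α)).div_const 2).add
      ((h2.sin.const_mul (A * Real.cos α - B * Real.sin α)).div_const 4)).sub
      ((h2.cos.const_mul (A * Real.sin α + B * Real.cos α)).div_const 4)
    convert! this using 1
    rw [Real.cos_sub, Real.cos_two_mul, Real.sin_two_mul]
    have := Real.sin_sq_add_cos_sq θ
    linear_combination (B * Real.sin α) * this
  rw [intervalIntegral.integral_eq_sub_of_hasDerivAt h (Continuous.intervalIntegrable (by fun_prop) _ _)]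
  have e1 : Real.sin (2 * (2 * π)) = 0 := by
    have := Real.sin_nat_mul_pi 4; rw [← this]; congr 1; push_cast; ring
  have e2 : Real.cos (2 * (2 * π)) = 1 := by
    have := Real.cos_nat_mul_two_pi 2; rw [← this]; congr 1
  rw [e1, e2]; simp; ring

lemma int_trig0 (A α : ℝ) (m : ℕ) (hm : 1 ≤ m) : ∫ θ in (0:ℝ)..(2 * π), A * Real.cos (m * θ - α) = 0 := by
  have hm' : (m:ℝ) ≠ 0 := by positivity
  have h : ∀ θ ∈ Set.uIcc 0 (2 * π), HasDerivAt (fun θ => A * Real.sin (m * θ - α) / m) (A * Real.cos (m * θ - α)) θ := by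
    intro θ _
    have h2 : HasDerivAt (fun θ : ℝ => m * θ - α) m θ := by simpa using ((hasDerivAt_id θ).const_mul (m:ℝ)).sub_const α
    have := (h2.sin.const_mul A).div_const m
    convert! this using 1
    field_simp
  rw [intervalIntegral.integral_eq_sub_of_hasDerivAt h (Continuous.intervalIntegrable (by fun_prop) _ _)]
  have : Real.sin (m * (2 * π) - α) = Real.sin (m * 0 - α) := by
    rw [show (m:ℝ) * (2 * π) - α = (m * 0 - α) + m * (2 * π) by ring, Real.sin_add_nat_mul_two_pi]
  rw [this]; ring

lemma int_trig12 (A B α : ℝ) : ∫ θ in (0:ℝ)..(2 * π), (A * Real.cos θ + B * Real.sin θ) * Real.cos (2 * θ - α) = 0 := by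
  have h1 := int_trig1 1 0
  -- antiderivative
  have h : ∀ θ ∈ Set.uIcc 0 (2 * π), HasDerivAt (fun θ => A / 2 * (Real.sin (3 * θ - α) / 3 + Real.sin (θ - α))
      + B / 2 * (-Real.cos (3 * θ - α) / 3 + Real.cos (θ - α)))
      ((A * Real.cos θ + B * Real.sin θ) * Real.cos (2 * θ - α)) θ := by
    intro θ _
    have h3 : HasDerivAt (fun θ : ℝ => 3 * θ - α) 3 θ := by simpa using ((hasDerivAt_id θ).const_mul 3).sub_const α
    have h2 : HasDerivAt (fun θ : ℝ => θ - α) 1 θ := (hasDerivAt_id θ).sub_const α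
    have := (((h3.sin.div_const 3).add h2.sin).const_mul (A / 2)).add (((h3.cos.neg.div_const 3).add h2.cos).const_mul (B / 2))
    convert! this using 1
    rw [show 3 * θ - α = (2 * θ - α) + θ by ring, show θ - α = (2 * θ - α) - θ by ring]
    simp only [Real.cos_add, Real.sin_add, Real.cos_sub (2 * θ - α), Real.sin_sub (2 * θ - α)]
    ring
  rw [intervalIntegral.integral_eq_sub_of_hasDerivAt h (Continuous.intervalIntegrable (by fun_prop) _ _)]
  have e1 : 3 * (2 * π) - α = (3 * 0 - α) + (3:ℕ) * (2 * π) := by push_cast; ring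
  have e2 : 2 * π - α = (0 - α) + (1:ℕ) * (2 * π) := by push_cast; ring
  rw [e1, e2, Real.sin_add_nat_mul_two_pi, Real.sin_add_nat_mul_two_pi, Real.cos_add_nat_mul_two_pi, Real.cos_add_nat_mul_two_pi]
  ring

lemma int_trig2 (A B α : ℝ) : ∫ θ in (0:ℝ)..(2 * π), (A * Real.cos (2 * θ) + B * Real.sin (2 * θ)) * Real.cos (2 * θ - α) =
    π * (A * Real.cos α + B * Real.sin α) := by
  have h : ∀ θ ∈ Set.uIcc 0 (2 * π), HasDerivAt (fun θ => (A * Real.cos α + B * Real.sin α) * θ / 2 +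
      (A * Real.cos α - B * Real.sin α) * (Real.sin (4 * θ)) / 8 - (A * Real.sin α + B * Real.cos α) * Real.cos (4 * θ) / 8)
      ((A * Real.cos (2 * θ) + B * Real.sin (2 * θ)) * Real.cos (2 * θ - α)) θ := by
    intro θ _
    have h2 : HasDerivAt (fun θ : ℝ => 4 * θ) 4 θ := by simpa using (hasDerivAt_id θ).const_mul 4
    have := ((((hasDerivAt_id θ).const_mul (A * Real.cos α + B * Real.sin α)).div_const 2).add
      ((h2.sin.const_mul (A * Real.cos α - B * Real.sin α)).div_const 8)).sub
      ((h2.cos.const_mul (A * Real.sin α + B * Real.cos α)).div_const 8)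
    convert! this using 1
    rw [Real.cos_sub, show 4 * θ = 2 * (2 * θ) by ring, Real.cos_two_mul (2 * θ), Real.sin_two_mul (2 * θ)]
    have := Real.sin_sq_add_cos_sq (2 * θ)
    linear_combination (B * Real.sin α) * this
  rw [intervalIntegral.integral_eq_sub_of_hasDerivAt h (Continuous.intervalIntegrable (by fun_prop) _ _)]
  have e1 : Real.sin (4 * (2 * π)) = 0 := by
    have := Real.sin_nat_mul_pi 8; rw [← this]; congr 1; push_cast; ring
  have e2 : Real.cos (4 * (2 * π)) = 1 := by
    have := Real.cos_nat_mul_two_pi 4; rw [← this]; congr 1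
  rw [e1, e2]; simp; ring

lemma clm_norm_le {T : E2 →L[ℝ] ℝ} {a : ℝ} (ha : 0 ≤ a) (h : ∀ α, T (circDir α) ≤ a) : ‖T‖ ≤ a := by
  have h2 : ∀ α, |T (circDir α)| ≤ a := by
    intro α
    refine abs_le.2 ⟨?_, h α⟩
    have := h (α + π)
    have e : circDir (α + π) = -circDir α := by
      rw [circDir_eq, circDir_eq, Real.cos_add_pi, Real.sin_add_pi]; module
    rw [e, map_neg] at this; linarith
  refine T.opNorm_le_bound ha fun z => ?_
  obtain ⟨θ, hθ⟩ := exists_polar z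
  conv_lhs => rw [hθ]
  rw [map_smul, norm_smul, norm_norm, mul_comm]
  gcongr
  exact h2 θ

lemma grad_est (hk : ContDiffOn ℝ 2 k (ball c R')) (hR : 0 < R) (hRR : R < R') {M H : ℝ}
    (hM : ∀ z ∈ closedBall c R, |k z| ≤ M) (hH : ∀ z ∈ closedBall c R, |lap k z| ≤ H) :
    ‖fderiv ℝ k c‖ ≤ 2 * M / R + 2 * H * R := by
  have hpi := Real.pi_pos
  have hc := mem_closedBall_self (x := c) hR.le
  have hM0 : 0 ≤ M := (abs_nonneg _).trans (hM c hc)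
  have hH0 : 0 ≤ H := (abs_nonneg _).trans (hH c hc)
  refine clm_norm_le (by positivity) fun α => ?_
  have h0 : mode k c 1 α 0 = 0 := by
    have := int_trig0 (k c) α 1 le_rfl
    simpa [mode] using this
  have hb := mode_barrier hk hR hRR 1 le_rfl α hM h0 hH0 (fun r hr => by
    refine abs_mode_le fun θ => ?_
    simp only [Nat.sub_self, pow_zero, mul_one]
    refine hH _ ?_
    rw [mem_closedBall, dist_eq_norm, add_sub_cancel_left, norm_smul_circDir hr.1.le]; exact hr.2.le)
  have hd := hasDerivAt_mode hk 1 α (r := 0) ⟨by linarith, by linarith⟩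
  have e : mode1 k c 1 α 0 = π * fderiv ℝ k c (circDir α) := by
    have := int_trig1 (fderiv ℝ k c (EuclideanSpace.single 0 1)) (fderiv ℝ k c (EuclideanSpace.single 1 1)) α
    rw [circDir_eq α, map_add, map_smul, map_smul, smul_eq_mul, smul_eq_mul, mul_comm (Real.cos α), mul_comm (Real.sin α), ← this, mode1]
    refine intervalIntegral.integral_congr fun θ _ => ?_
    simp only [zero_smul, add_zero, Nat.cast_one, one_mul]
    rw [circDir_eq θ, map_add, map_smul, map_smul, smul_eq_mul, smul_eq_mul]; ring
  have h1 : mode1 k c 1 α 0 ≤ 2 * π * M / R ^ 1 + 2 * π * H * R := by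
    have ht := hd.tendsto_slope_zero_right
    refine le_of_tendsto ht ?_
    filter_upwards [Ioc_mem_nhdsGT hR] with t ht
    have := hb t ⟨ht.1.le, ht.2⟩
    rw [zero_add, h0, sub_zero, smul_eq_mul, inv_mul_le_iff₀ ht.1]
    rw [pow_one t] at this; linarith
  rw [e, pow_one] at h1
  have h2 : 2 * π * M / R + 2 * π * H * R = π * (2 * M / R + 2 * H * R) := by ring
  rw [h2] at h1
  exact le_of_mul_le_mul_left h1 hpi

lemma second_le {f f1 : ℝ → ℝ} {f2 a R : ℝ} (hR : 0 < R) (h1 : ∀ r ∈ Set.Icc 0 R, HasDerivAt f (f1 r) r)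
    (h2 : HasDerivAt f1 f2 0) (f0 : f 0 = 0) (f10 : f1 0 = 0) (hb : ∀ r ∈ Set.Icc 0 R, f r ≤ a * r ^ 2) : f2 ≤ 2 * a := by
  by_contra! hcon
  have ht := h2.tendsto_slope_zero_right
  have ev := (ht.eventually (lt_mem_nhds hcon)).and (Ioc_mem_nhdsGT hR)
  obtain ⟨δ, hδ, hδs⟩ := (mem_nhdsGT_iff_exists_Ioc_subset.1 ev)
  set s := min δ R with hs
  have hs0 : 0 < s := lt_min hδ hR
  have hmono : StrictMonoOn (fun r => f r - a * r ^ 2) (Set.Icc 0 s) := by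
    have hder : ∀ r ∈ Set.Icc 0 s, HasDerivAt (fun r => f r - a * r ^ 2) (f1 r - a * (2 * r)) r := by
      intro r hr
      have := (h1 r ⟨hr.1, hr.2.trans (min_le_right _ _)⟩).sub ((hasDerivAt_pow 2 r).const_mul a)
      convert! this using 1; simp
    refine strictMonoOn_of_deriv_pos (convex_Icc _ _) (fun r hr => (hder r hr).continuousAt.continuousWithinAt) ?_
    intro r hr
    rw [interior_Icc] at hr
    rw [(hder r ⟨hr.1.le, hr.2.le⟩).deriv]
    have h3 := hδs (show r ∈ Set.Ioc 0 δ from ⟨hr.1, hr.2.le.trans (min_le_left _ _)⟩)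
    have h4 := h3.1
    rw [zero_add, f10, sub_zero, smul_eq_mul, lt_inv_mul_iff₀ hr.1] at h4
    linarith
  have := hmono ⟨le_rfl, hs0.le⟩ ⟨hs0.le, le_rfl⟩ hs0
  simp only [f0] at this
  have := hb s ⟨hs0.le, min_le_right _ _⟩
  norm_num at *
  linarith

lemma hess_est (hk : ContDiffOn ℝ 2 k (ball c R')) (hR : 0 < R) (hRR : R < R') {M L : ℝ} (hL : 0 ≤ L)
    (hM : ∀ z ∈ closedBall c R, |k z| ≤ M) (hH : ∀ z ∈ closedBall c R, |lap k z - lap k c| ≤ L * ‖z - c‖) :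
    ‖D2 k c‖ ≤ |lap k c| + 4 * M / R ^ 2 + 4 * L * R := by
  have hpi := Real.pi_pos
  have hc := mem_closedBall_self (x := c) hR.le
  have hcb : c ∈ ball c R' := mem_ball_self (by linarith)
  have hM0 : 0 ≤ M := (abs_nonneg _).trans (hM c hc)
  obtain ⟨f0, f1, f2, f3, f4⟩ := c2_facts isOpen_ball hk
  set A := 2 * π * M / R ^ 2 + 2 * π * L * R with hA
  have hm : ∀ α, mode2 k c 2 α 0 ≤ 2 * A := by
    intro α
    have h0 : mode k c 2 α 0 = 0 := by
      have := int_trig0 (k c) α 2 (by norm_num)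
      simpa [mode] using this
    have hb := mode_barrier hk hR hRR 2 (by norm_num) α hM h0 hL (fun r hr => by
      have hmem : r ∈ Set.Ioo (-R') R' := ⟨by linarith [hr.1], by linarith [hr.2]⟩
      have hcont := continuous_circle (continuousOn_lap isOpen_ball hk) hmem
      have e : mode (lap k) c 2 α r = mode (fun z => lap k z - lap k c) c 2 α r := by
        have := int_trig0 (lap k c) α 2 (by norm_num)
        have h9 := intervalIntegral.integral_sub (μ := volume) (a := 0) (b := 2 * π)
          (f := fun θ => lap k (c + r • circDir θ) * Real.cos ((2:ℕ) * θ - α)) (g := fun θ => lap k c * Real.cos ((2:ℕ) * θ - α))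
          (Continuous.intervalIntegrable (by fun_prop) _ _) (Continuous.intervalIntegrable (by fun_prop) _ _)
        rw [this, sub_zero] at h9
        rw [mode, mode, ← h9]
        refine intervalIntegral.integral_congr fun θ _ => ?_
        ring
      rw [e]
      refine abs_mode_le fun θ => ?_
      have hn : ‖c + r • circDir θ - c‖ = r := by rw [add_sub_cancel_left, norm_smul_circDir hr.1.le]
      have := hH (c + r • circDir θ) (by rw [mem_closedBall, dist_eq_norm, hn]; exact hr.2.le)
      rw [hn] at this
      simpa using this)
    refine second_le hR (fun r hr => hasDerivAt_mode hk 2 α ⟨by linarith [hr.1], by linarith [hr.2]⟩)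
      (hasDerivAt_mode1 hk 2 α ⟨by linarith, by linarith⟩) h0 ?_ hb
    have := int_trig12 (fderiv ℝ k c (EuclideanSpace.single 0 1)) (fderiv ℝ k c (EuclideanSpace.single 1 1)) α
    refine Eq.trans ?_ this
    rw [mode1]
    refine intervalIntegral.integral_congr fun θ _ => ?_
    simp only [zero_smul, add_zero]
    rw [circDir_eq θ, map_add, map_smul, map_smul, smul_eq_mul, smul_eq_mul]; push_cast; ring
  have e0 : lap k c = _ := lap_eq (f4 c hcb).differentiableAt
  simp only [Fin.sum_univ_two] at e0
  set a := D2 k c (EuclideanSpace.single 0 1) (EuclideanSpace.single 0 1) with ha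
  set d := D2 k c (EuclideanSpace.single 1 1) (EuclideanSpace.single 1 1) with hd
  set b := D2 k c (EuclideanSpace.single 0 1) (EuclideanSpace.single 1 1) with hb
  set b' := D2 k c (EuclideanSpace.single 1 1) (EuclideanSpace.single 0 1) with hb'
  have hq : ∀ θ, D2 k c (circDir θ) (circDir θ) = (a + d) / 2 + ((a - d) / 2 * Real.cos (2 * θ) + (b + b') / 2 * Real.sin (2 * θ)) := by
    intro θ
    rw [circDir_eq θ]
    simp only [map_add, map_smul, add_apply, smul_apply, smul_eq_mul]
    rw [← ha, ← hd, ← hb, ← hb', Real.cos_two_mul, Real.sin_two_mul]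
    have := Real.sin_sq_add_cos_sq θ
    linear_combination d * this
  have hm2 : ∀ α, π * ((a - d) / 2 * Real.cos α + (b + b') / 2 * Real.sin α) ≤ 2 * A := by
    intro α
    refine le_trans (le_of_eq ?_) (hm α)
    rw [← int_trig2, mode2]
    have := int_trig0 ((a + d) / 2) α 2 (by norm_num)
    have h9 := intervalIntegral.integral_add (μ := volume) (a := 0) (b := 2 * π)
      (f := fun θ => (a + d) / 2 * Real.cos ((2:ℕ) * θ - α))
      (g := fun θ => ((a - d) / 2 * Real.cos (2 * θ) + (b + b') / 2 * Real.sin (2 * θ)) * Real.cos (2 * θ - α))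
      (Continuous.intervalIntegrable (by fun_prop) _ _) (Continuous.intervalIntegrable (by fun_prop) _ _)
    rw [this, zero_add] at h9
    rw [← h9]
    refine intervalIntegral.integral_congr fun θ _ => ?_
    simp only [zero_smul, add_zero]
    rw [hq]; push_cast; ring
  set S := |lap k c| + 4 * M / R ^ 2 + 4 * L * R with hS
  have hS0 : 0 ≤ S := by positivity
  have hAS : 2 * A = π * (4 * M / R ^ 2 + 4 * L * R) := by rw [hA]; ring
  have hm3 : ∀ α, |(a - d) / 2 * Real.cos α + (b + b') / 2 * Real.sin α| ≤ 4 * M / R ^ 2 + 4 * L * R := by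
    intro α
    have h1 := hm2 α
    have h2 := hm2 (α + π)
    rw [Real.cos_add_pi, Real.sin_add_pi] at h2
    rw [hAS] at h1 h2
    have h1 := le_of_mul_le_mul_left h1 hpi
    have h2 := le_of_mul_le_mul_left h2 hpi
    rw [abs_le]; constructor <;> linarith
  have hdir : ∀ θ, |D2 k c (circDir θ) (circDir θ)| ≤ S := by
    intro θ
    rw [hq]
    refine (abs_add_le _ _).trans ?_
    have := hm3 (2 * θ)
    have h2 : |(a + d) / 2| ≤ |lap k c| := by
      rw [← e0, abs_div, abs_two]; linarith [abs_nonneg (lap k c)]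
    linarith
  have hz : ∀ z, |D2 k c z z| ≤ S * ‖z‖ ^ 2 := by
    intro z
    obtain ⟨θ, hθ⟩ := exists_polar z
    conv_lhs => rw [hθ]
    simp only [map_smul, smul_apply, smul_eq_mul]
    rw [abs_mul, abs_mul, abs_norm]
    have := hdir θ
    calc ‖z‖ * (‖z‖ * |D2 k c (circDir θ) (circDir θ)|) ≤ ‖z‖ * (‖z‖ * S) := by gcongr
      _ = _ := by ring
  have hsym : ∀ y z, D2 k c y z = D2 k c z y := by
    have hca : ContDiffAt ℝ 2 k c := (hk c hcb).contDiffAt (isOpen_ball.mem_nhds hcb)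
    have := hca.isSymmSndFDerivAt (by simp)
    intro y z; exact this y z
  have hunit : ∀ y z, ‖y‖ = 1 → ‖z‖ = 1 → |D2 k c y z| ≤ S := by
    intro y z hy hzz
    have h1 := hz (y + z)
    have h2 := hz (y - z)
    have h3 : ‖y + z‖ ^ 2 + ‖y - z‖ ^ 2 = 4 := by
      have := parallelogram_law_with_norm ℝ y z
      rw [hy, hzz] at this; nlinarith
    have h4 : D2 k c (y + z) (y + z) - D2 k c (y - z) (y - z) = 4 * D2 k c y z := by
      simp only [map_add, map_sub, add_apply, sub_apply]
      rw [hsym z y]; ring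
    rw [abs_le] at h1 h2 ⊢
    constructor <;> nlinarith
  refine ContinuousLinearMap.opNorm_le_bound _ hS0 fun y => ?_
  refine ContinuousLinearMap.opNorm_le_bound _ (by positivity) fun z => ?_
  obtain ⟨θ, hθ⟩ := exists_polar z
  obtain ⟨φ, hφ⟩ := exists_polar y
  conv_lhs => rw [hθ, hφ]
  simp only [map_smul, smul_apply, smul_eq_mul]
  rw [norm_mul, norm_mul, norm_norm, norm_norm]
  have := hunit (circDir φ) (circDir θ) (norm_circDir _) (norm_circDir _)
  calc ‖z‖ * (‖y‖ * |D2 k c (circDir φ) (circDir θ)|) ≤ ‖z‖ * (‖y‖ * S) := by gcongr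
    _ = _ := by ring
end

lemma grad_alg (B : ℝ) : ∃ C > 0, ∀ q U w k E A Uz wz kz : ℝ, 1 ≤ q → |U| ≤ B → |w| ≤ B → |k| ≤ B → |E| ≤ B →
    |A| ≤ B → |Uz| ≤ B → |wz| ≤ B → |kz| ≤ B → 1 ≤ B → ∀ v G vz, v = U + w / q + k / q ^ 2 →
    G = A + A * (w - U ^ 2 / 2) / q + E / q ^ 2 → vz = Uz + wz / q + kz / q ^ 2 → 1 / 2 ≤ 1 + v / q →
    |q ^ 2 * (G / (1 + v / q) * vz - A * Uz) - q * (A * ((w - U ^ 2 / 2) * Uz + wz - U * Uz))| ≤ C := by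
  let f : (Fin 9 → ℝ) → ℝ := fun y =>
    let U := y 0; let w := y 1; let k := y 2; let E := y 3; let A := y 4; let Uz := y 5; let wz := y 6; let kz := y 7; let x := y 8
    (A * kz + A * (w - U ^ 2 / 2) * wz + E * Uz) + x * (A * (w - U ^ 2 / 2) * kz + E * wz) + x ^ 2 * E * kz
      - A * Uz * (w + x * k) - (U + x * w + x ^ 2 * k) * (A * ((w - U ^ 2 / 2) * Uz + wz - U * Uz))
  have hf : Continuous f := by fun_prop
  obtain ⟨C, hC⟩ := (isCompact_closedBall (0 : Fin 9 → ℝ) B).exists_bound_of_continuousOn hf.continuousOn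
  refine ⟨2 * (|C| + 1), by positivity, ?_⟩
  intro q U w k E A Uz wz kz hq hU hw hk hE hA hUz hwz hkz hB v G vz hv hG hvz hg
  have hq0 : q ≠ 0 := by positivity
  have hN := hC ![U, w, k, E, A, Uz, wz, kz, 1 / q] (by
    rw [mem_closedBall, dist_zero_right, pi_norm_le_iff_of_nonneg (by linarith)]
    intro i
    have h9 : |1 / q| ≤ B := by
      rw [abs_of_nonneg (by positivity)]
      exact (div_le_one₀ (by linarith)).2 hq |>.trans hB
    fin_cases i <;> simp [Real.norm_eq_abs] <;> first | assumption | simpa using h9)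
  have e : q ^ 2 * (G / (1 + v / q) * vz - A * Uz) - q * (A * ((w - U ^ 2 / 2) * Uz + wz - U * Uz)) =
      f ![U, w, k, E, A, Uz, wz, kz, 1 / q] / (1 + v / q) := by
    have hne : 1 + v / q ≠ 0 := by linarith
    rw [eq_div_iff hne]
    have : (q ^ 2 * (G / (1 + v / q) * vz - A * Uz) - q * (A * ((w - U ^ 2 / 2) * Uz + wz - U * Uz))) * (1 + v / q) =
      q ^ 2 * (G * vz - A * Uz * (1 + v / q)) - q * (A * ((w - U ^ 2 / 2) * Uz + wz - U * Uz)) * (1 + v / q) := by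
      have : G / (1 + v / q) * (1 + v / q) = G := div_mul_cancel₀ _ hne
      linear_combination q ^ 2 * vz * this
    rw [this, hG, hvz, hv]
    simp only [f, Matrix.cons_val]
    field_simp
    ring
  rw [e, abs_div, div_le_iff₀ (by rw [abs_of_pos (by linarith)]; linarith), abs_of_pos (by linarith : 0 < 1 + v / q)]
  rw [Real.norm_eq_abs] at hN
  have := le_abs_self C
  nlinarith [abs_nonneg C]

section
variable {p : ℕ → ℝ} {v : ℕ → E2 → ℝ} {w0 : E2 → ℝ}

lemma Core.bd0 (h : Core p v w0) (R : ℝ) : ∃ C > 0, ∀ᶠ n in atTop, ∀ z : E2, ‖z‖ ≤ R →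
    |kk (p n) (v n) w0 z| ≤ C ∧ |lap (kk (p n) (v n) w0) z| ≤ C := by
  obtain ⟨C1, hC1, h1⟩ := h.part1 (τ := 1/2) (by norm_num)
  obtain ⟨C2, hC2, h2⟩ := h.err 1
  set D := C1 * (1 + |R|) ^ (1/2:ℝ) with hD
  have hD0 : 0 ≤ D := by positivity
  refine ⟨C2 + 2 * D, by positivity, ?_⟩
  filter_upwards [h1, h2 1 one_pos, h.ev_ball (R + 1)] with n g1 g2 g3 z hz
  have hzb : z ∈ ball (0:E2) (p n) := by simp; linarith [g3.1]
  have a1 : |kk (p n) (v n) w0 z| ≤ D := by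
    refine (g1 z (g3.2.lo z hzb).le (g3.2.up z hzb)).trans ?_
    have := le_abs_self R
    rw [hD]; gcongr; linarith
  have a2 := g2 z (by rw [pow_one]; linarith [g3.1])
  have a3 : (1 + ‖z‖) ^ (-(5/2) : ℝ) ≤ 1 :=
    Real.rpow_le_one_of_one_le_of_nonpos (by linarith [norm_nonneg z]) (by norm_num)
  have a4 : Real.exp (Ustd z) ≤ 1 := Real.exp_le_one_iff.2 (Ustd_nonpos z)
  have a5 : |Real.exp (Ustd z) * kk (p n) (v n) w0 z| ≤ D := by
    rw [abs_mul, Real.abs_exp]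
    calc _ ≤ 1 * D := by gcongr
      _ = D := one_mul D
  have a6 : |lap (kk (p n) (v n) w0) z + Real.exp (Ustd z) * kk (p n) (v n) w0 z| ≤ (C2 + D) * 1 := by
    refine a2.trans ?_
    have : C2 + 1 * |kk (p n) (v n) w0 z| ≤ C2 + D := by linarith
    gcongr
  have a7 := abs_sub (lap (kk (p n) (v n) w0) z + Real.exp (Ustd z) * kk (p n) (v n) w0 z) (Real.exp (Ustd z) * kk (p n) (v n) w0 z)
  rw [add_sub_cancel_right] at a7
  constructor <;> linarith

lemma Core.bd1 (h : Core p v w0) (R : ℝ) : ∃ C > 0, ∀ᶠ n in atTop, ∀ z : E2, ‖z‖ ≤ R →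
    ‖fderiv ℝ (kk (p n) (v n) w0) z‖ ≤ C := by
  obtain ⟨C, hC, h1⟩ := h.bd0 (R + 1)
  refine ⟨2 * C / 1 + 2 * C * 1, by positivity, ?_⟩
  filter_upwards [h1, h.ev_ball (R + 2)] with n g1 g3 z hz
  have hsub : closedBall z 1 ⊆ {y : E2 | ‖y‖ ≤ R + 1} := by
    intro y hy
    rw [mem_closedBall, dist_eq_norm] at hy
    have := norm_le_norm_add_norm_sub' y z
    simp only [Set.mem_ofPred_eq]; linarith
  refine grad_est (R := 1) (R' := 2) ((kk_cd g3.2 h.w0c).mono ?_) one_pos (by norm_num)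
    (fun y hy => (g1 y (hsub hy)).1) (fun y hy => (g1 y (hsub hy)).2)
  apply ball_subset_ball'
  rw [dist_zero_right]; linarith [g3.1]

lemma Core.bdL (h : Core p v w0) (R : ℝ) : ∃ C > 0, ∀ᶠ n in atTop, ∀ y z : E2, ‖y‖ ≤ R → ‖z‖ ≤ R →
    |lap (kk (p n) (v n) w0) y - lap (kk (p n) (v n) w0) z| ≤ C * ‖y - z‖ := by
  obtain ⟨C0, hC0, h0⟩ := h.bd0 R
  obtain ⟨C1, hC1, h1⟩ := h.bd1 R
  obtain ⟨B1, hB1⟩ := (isCompact_closedBall (0:E2) R).exists_bound_of_continuousOn h.w0c.continuous.continuousOn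
  obtain ⟨B2, hB2⟩ := (isCompact_closedBall (0:E2) R).exists_bound_of_continuousOn
    (h.w0c.continuous_fderiv (by norm_num)).continuousOn
  obtain ⟨B3, hB3⟩ := (isCompact_closedBall (0:E2) R).exists_bound_of_continuousOn contDiff_Ustd.continuous.continuousOn
  obtain ⟨B4, hB4⟩ := (isCompact_closedBall (0:E2) R).exists_bound_of_continuousOn
    (contDiff_Ustd.continuous_fderiv (by norm_num)).continuousOn
  set B := 1 + C0 + C1 + |B1| + |B2| + |B3| + |B4| with hB
  obtain ⟨C, hC, hal⟩ := grad_alg B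
  have := abs_nonneg B1; have := abs_nonneg B2; have := abs_nonneg B3; have := abs_nonneg B4
  have := le_abs_self B1; have := le_abs_self B2; have := le_abs_self B3; have := le_abs_self B4
  refine ⟨C, hC, ?_⟩
  filter_upwards [h0, h1, h.ev_ball (R + 2), h.vU R one_pos, h.ptop.eventually_ge_atTop (2 * (B + 1)), h.ptop.eventually_ge_atTop 2] with n g0 g1 g3 g4 g5 g6 y z hy hz
  set q := p n with hq
  have hq0 : 0 < q := by linarith
  have hball : ∀ z ∈ closedBall (0:E2) R, z ∈ ball (0:E2) q := fun z hz => by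
    have : ‖z‖ ≤ R := by simpa using hz
    simp; linarith [g3.1]
  let F : E2 → ℝ := fun z => q ^ 2 * ((1 + v n z / q) ^ q - Real.exp (Ustd z)) - q * (Real.exp (Ustd z) * (w0 z - (Ustd z) ^ 2 / 2))
  have hF : ∀ z ∈ closedBall (0:E2) R, lap (kk q (v n) w0) z = - F z := by
    intro z hz
    have := lap_kk g3.2 h.w0c h.weq (hball z hz)
    simp only [F]; simp only [kk] at this ⊢; linarith
  let F' : E2 → E2 →L[ℝ] ℝ := fun z =>
    q ^ 2 • ((((q⁻¹ • fderiv ℝ (v n) z)) |> fun T => (q * (1 + v n z / q) ^ (q - 1)) • T) - Real.exp (Ustd z) • fderiv ℝ Ustd z)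
      - q • (Real.exp (Ustd z) • (fderiv ℝ w0 z - Ustd z • fderiv ℝ Ustd z) + (w0 z - (Ustd z) ^ 2 / 2) • (Real.exp (Ustd z) • fderiv ℝ Ustd z))
  have hder : ∀ z ∈ closedBall (0:E2) R, HasFDerivAt F (F' z) z := by
    intro z hz
    have hz' := hball z hz
    have dv := (c2_facts isOpen_ball g3.2.cd).2.2.2.1 z hz'
    have dU : HasFDerivAt Ustd (fderiv ℝ Ustd z) z := (contDiff_Ustd.differentiable (by norm_num) z).hasFDerivAt
    have dw : HasFDerivAt w0 (fderiv ℝ w0 z) z := (h.w0c.differentiable (by norm_num) z).hasFDerivAt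
    have d1 : HasFDerivAt (fun z => 1 + v n z / q) (q⁻¹ • fderiv ℝ (v n) z) z := by
      have := (dv.const_mul q⁻¹).const_add 1
      refine this.congr_of_eventuallyEq (Eventually.of_forall fun y => ?_)
      simp only []; ring
    have d2 := d1.rpow_const (p := q) (Or.inl (g3.2.gpos g6 hz').ne')
    have d3 := dU.exp
    have d4 : HasFDerivAt (fun z => w0 z - (Ustd z) ^ 2 / 2) (fderiv ℝ w0 z - Ustd z • fderiv ℝ Ustd z) z := by
      have := dw.sub ((dU.mul dU).const_mul (1/2))
      have e : fderiv ℝ w0 z - Ustd z • fderiv ℝ Ustd z = fderiv ℝ w0 z - (1 / 2:ℝ) • (Ustd z • fderiv ℝ Ustd z + Ustd z • fderiv ℝ Ustd z) := by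
        module
      rw [e]
      refine this.congr_of_eventuallyEq (Eventually.of_forall fun y => ?_)
      simp only [Pi.sub_apply, Pi.mul_apply]; ring
    exact ((d2.sub d3).const_mul (q ^ 2)).sub ((d3.mul d4).const_mul q)
  have hbd : ∀ z ∈ closedBall (0:E2) R, ‖F' z‖ ≤ C := by
    intro z hz
    have hz' := hball z hz
    have hzn : ‖z‖ ≤ R := by simpa using hz
    refine clm_norm_le hC.le fun α => ?_
    set e := circDir α with he
    have ap : ∀ T : E2 →L[ℝ] ℝ, |T e| ≤ ‖T‖ := fun T => by
      have := T.le_opNorm e; rwa [he, norm_circDir, mul_one] at this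
    have hg := g3.2.gpos g6 hz'
    have dk : fderiv ℝ (kk q (v n) w0) z = q • (q • (fderiv ℝ (v n) z - fderiv ℝ Ustd z) - fderiv ℝ w0 z) := by
      have dv := (c2_facts isOpen_ball g3.2.cd).2.2.2.1 z hz'
      have dU : HasFDerivAt Ustd (fderiv ℝ Ustd z) z := (contDiff_Ustd.differentiable (by norm_num) z).hasFDerivAt
      have dw : HasFDerivAt w0 (fderiv ℝ w0 z) z := (h.w0c.differentiable (by norm_num) z).hasFDerivAt
      exact ((((dv.sub dU).const_mul q).sub dw).const_mul q).fderiv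
    have dke : fderiv ℝ (kk q (v n) w0) z e = q * (q * (fderiv ℝ (v n) z e - fderiv ℝ Ustd z e) - fderiv ℝ w0 z e) := by
      rw [dk]; simp
    have b1 := (hB3 z hz); rw [Real.norm_eq_abs] at b1
    have b2 := (hB1 z hz); rw [Real.norm_eq_abs] at b2
    have b3 := (ap _).trans (hB4 z hz)
    have b4 := (ap _).trans (hB2 z hz)
    have b5 := (ap _).trans (g1 z hzn)
    have b6 := (g0 z hzn).2
    rw [hF z hz, abs_neg] at b6
    have b7 := (g4 z hzn).1
    have b8 : |v n z| ≤ B := by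
      have := abs_add_le (v n z - Ustd z) (Ustd z); rw [sub_add_cancel] at this; linarith
    have key := hal q (Ustd z) (w0 z) (kk q (v n) w0 z) (F z) (Real.exp (Ustd z)) (fderiv ℝ Ustd z e) (fderiv ℝ w0 z e)
      (fderiv ℝ (kk q (v n) w0) z e) (by linarith) (by linarith) (by linarith) (by linarith [(g0 z hzn).1]) (by linarith)
      (by rw [Real.abs_exp]; exact (Real.exp_le_one_iff.2 (Ustd_nonpos z)).trans (by linarith)) (by linarith) (by linarith) (by linarith)
      (by linarith) (v n z) ((1 + v n z / q) ^ q) (fderiv ℝ (v n) z e) (by simp only [kk]; field_simp; ring)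
      (by simp only [F]; field_simp; ring) (by rw [dke]; field_simp; ring) (by
        have : -(1/2) ≤ v n z / q := by
          rw [le_div_iff₀ hq0]; linarith [(abs_le.1 b8).1]
        linarith)
    refine le_trans (le_of_eq ?_) ((le_abs_self _).trans key)
    rw [← Real.rpow_sub_one hg.ne']
    simp only [F', sub_apply, smul_apply, add_apply, smul_eq_mul]
    field_simp
    ring
  rw [hF y (by simpa using hy), hF z (by simpa using hz)]
  have := (convex_closedBall (0:E2) R).norm_image_sub_le_of_norm_hasFDerivWithin_le (f := F) (f' := F')
    (fun z hz => (hder z hz).hasFDerivWithinAt) hbd (x := y) (y := z) (by simpa using hy) (by simpa using hz)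
  rw [Real.norm_eq_abs] at this
  rw [show -F y - -F z = F z - F y by ring, norm_sub_rev]; exact this

lemma Core.bd2 (h : Core p v w0) (R : ℝ) : ∃ C > 0, ∀ᶠ n in atTop, ∀ z : E2, ‖z‖ ≤ R →
    ‖D2 (kk (p n) (v n) w0) z‖ ≤ C := by
  obtain ⟨C, hC, h1⟩ := h.bd0 (R + 1)
  obtain ⟨L, hL, h2⟩ := h.bdL (R + 1)
  refine ⟨C + 4 * C / 1 ^ 2 + 4 * L * 1, by positivity, ?_⟩
  filter_upwards [h1, h2, h.ev_ball (R + 2)] with n g1 g2 g3 z hz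
  have hsub : closedBall z 1 ⊆ {y : E2 | ‖y‖ ≤ R + 1} := by
    intro y hy
    rw [mem_closedBall, dist_eq_norm] at hy
    have := norm_le_norm_add_norm_sub' y z
    simp only [Set.mem_ofPred_eq]; linarith
  have := hess_est (R := 1) (R' := 2) (c := z) ((kk_cd g3.2 h.w0c).mono ?_) one_pos (by norm_num) hL.le
    (fun y hy => (g1 y (hsub hy)).1) (fun y hy => g2 y z (hsub hy) (by linarith))
  · have := (g1 z (by linarith)).2
    linarith
  apply ball_subset_ball'
  rw [dist_zero_right]; linarith [g3.1]

lemma Core.part2 (h : Core p v w0) {K : Set E2} (hK : IsCompact K) : ∃ C > 0, ∀ᶠ n in atTop, ∀ z ∈ K, ∀ k : ℕ, k ≤ 2 →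
    ‖iteratedFDeriv ℝ k (fun y => v n y - Ustd y - w0 y / p n) z‖ ≤ C / (p n) ^ 2 := by
  obtain ⟨R, hR⟩ := hK.isBounded.subset_closedBall (0:E2)
  obtain ⟨C0, hC0, h0⟩ := h.bd0 R
  obtain ⟨C1, hC1, h1⟩ := h.bd1 R
  obtain ⟨C2, hC2, h2⟩ := h.bd2 R
  refine ⟨C0 + C1 + C2, by positivity, ?_⟩
  filter_upwards [h0, h1, h2, h.ev_ball (R + 2), h.ptop.eventually_gt_atTop 1] with n g0 g1 g2 g3 g4 z hz k hk
  have hz' : ‖z‖ ≤ R := by simpa using hR hz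
  have hzb : z ∈ ball (0:E2) (p n) := by simp; linarith [g3.1]
  have e : (fun y => v n y - Ustd y - w0 y / p n) = ((p n ^ 2)⁻¹) • (kk (p n) (v n) w0) := by
    funext y; simp only [kk, Pi.smul_apply, smul_eq_mul]; field_simp
  have hcd : ContDiffAt ℝ 2 (kk (p n) (v n) w0) z := (kk_cd g3.2 h.w0c z hzb).contDiffAt (isOpen_ball.mem_nhds hzb)
  rw [e, iteratedFDeriv_const_smul_apply (hcd.of_le (by exact_mod_cast hk)), norm_smul, Real.norm_of_nonneg (by positivity), div_eq_inv_mul]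
  have hp0 : 0 < p n := by linarith
  gcongr
  have a0 := (g0 z hz').1
  have a1 := g1 z hz'
  have a2 := g2 z hz'
  interval_cases k
  · rw [norm_iteratedFDeriv_zero, Real.norm_eq_abs]; linarith
  · rw [← norm_iteratedFDeriv_fderiv, norm_iteratedFDeriv_zero]; linarith
  · rw [← norm_iteratedFDeriv_fderiv, ← norm_iteratedFDeriv_fderiv, norm_iteratedFDeriv_zero]
    have : fderiv ℝ (fderiv ℝ (kk (p n) (v n) w0)) z = D2 (kk (p n) (v n) w0) z := rfl
    rw [this]; linarith
end

def hcut (δ s : ℝ) : ℝ := max 0 (min 1 ((s - δ) / δ))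
def phic (δ t : ℝ) : ℝ := ∫ s in (0:ℝ)..t, hcut δ s

lemma hcut_cont (δ : ℝ) : Continuous (hcut δ) := by unfold hcut; fun_prop
lemma hcut_nonneg (δ s : ℝ) : 0 ≤ hcut δ s := le_max_left _ _
lemma hcut_le (δ s : ℝ) : hcut δ s ≤ 1 := max_le zero_le_one (min_le_left _ _)
lemma hcut_zero {δ s : ℝ} (hδ : 0 < δ) (hs : s ≤ δ) : hcut δ s = 0 := by
  refine max_eq_left ((min_le_right _ _).trans ?_)
  exact div_nonpos_of_nonpos_of_nonneg (by linarith) hδ.le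
lemma hcut_one {δ s : ℝ} (hδ : 0 < δ) (hs : 2 * δ ≤ s) : hcut δ s = 1 := by
  have : 1 ≤ (s - δ) / δ := by rw [le_div_iff₀ hδ]; linarith
  rw [hcut, min_eq_left this, max_eq_right zero_le_one]

lemma phic_deriv (δ t : ℝ) : HasDerivAt (phic δ) (hcut δ t) t :=
  ((hcut_cont δ).integral_hasStrictDerivAt 0 t).hasDerivAt
lemma phic_zero {δ t : ℝ} (hδ : 0 < δ) (ht : t ≤ δ) : phic δ t = 0 := by
  have : Set.EqOn (hcut δ) (fun _ => 0) (Set.uIcc 0 t) := by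
    intro s hs
    refine hcut_zero hδ (hs.2.trans ?_)
    exact max_le hδ.le ht
  rw [phic, intervalIntegral.integral_congr this]; simp
lemma phic_nonneg {δ t : ℝ} (hδ : 0 < δ) : 0 ≤ phic δ t := by
  rcases le_total t δ with h | h
  · rw [phic_zero hδ h]
  · exact intervalIntegral.integral_nonneg (by linarith) fun s _ => hcut_nonneg δ s
lemma phic_le {δ t : ℝ} (ht : 0 ≤ t) : phic δ t ≤ t := by
  have := intervalIntegral.integral_mono_on (μ := volume) ht ((hcut_cont δ).intervalIntegrable _ _)
    (continuous_const.intervalIntegrable (μ := volume) (u := fun _ => (1:ℝ)) _ _) (fun s _ => hcut_le δ s)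
  simpa [phic] using this
lemma phic_ge {δ t : ℝ} (hδ : 0 < δ) : t - 2 * δ ≤ phic δ t := by
  rcases le_total t (2 * δ) with h | h
  · exact le_trans (by linarith) (phic_nonneg hδ)
  · have h1 : phic δ t = phic δ (2 * δ) + ∫ s in (2 * δ)..t, hcut δ s :=
      (intervalIntegral.integral_add_adjacent_intervals ((hcut_cont δ).intervalIntegrable _ _) ((hcut_cont δ).intervalIntegrable _ _)).symm
    have h2 : ∫ s in (2 * δ)..t, hcut δ s = ∫ s in (2 * δ)..t, (1:ℝ) := by
      refine intervalIntegral.integral_congr fun s hs => ?_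
      rw [Set.uIcc_of_le h] at hs
      exact hcut_one hδ hs.1
    rw [h1, h2, intervalIntegral.integral_const, smul_eq_mul, mul_one]
    linarith [phic_nonneg (t := 2 * δ) hδ]

/-- zero extension of truncation -/
def psiE (Ω : Set E2) (f : E2 → ℝ) (δ : ℝ) (y : E2) : ℝ := by
  classical exact if y ∈ Ω then phic δ (f y) else 0

section
variable {Ω : Set E2} {f : E2 → ℝ} {p δ : ℝ}

def Kset (Ω : Set E2) (f : E2 → ℝ) (δ : ℝ) : Set E2 := {x | x ∈ closure Ω ∧ δ ≤ f x}

lemma psiE_in {y : E2} (hy : y ∈ Ω) : psiE Ω f δ y = phic δ (f y) := by simp [psiE, hy]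

lemma Kset_compact (hb : IsBounded Ω) (hs : IsSolution Ω p f) : IsCompact (Kset Ω f δ) := by
  have hcl : IsClosed (Kset Ω f δ) := by
    have := hs.2.1.preimage_isClosed_of_isClosed isClosed_closure (isClosed_Ici (a := δ))
    exact this
  exact hb.isCompact_closure.of_isClosed_subset hcl fun x hx => hx.1

lemma Kset_sub (ho : IsOpen Ω) (hδ : 0 < δ) (hs : IsSolution Ω p f) : Kset Ω f δ ⊆ Ω := by
  intro x hx
  by_contra hxo
  have hfr : x ∈ frontier Ω := by rw [ho.frontier_eq]; exact ⟨hx.1, hxo⟩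
  have := hs.2.2.2 x hfr
  have := hx.2
  linarith

lemma psiE_off (hδ : 0 < δ) {y : E2} (hy : y ∉ Kset Ω f δ) : psiE Ω f δ y = 0 := by
  by_cases h : y ∈ Ω
  · rw [psiE_in h]
    refine phic_zero hδ ?_
    by_contra! hc
    exact hy ⟨subset_closure h, hc.le⟩
  · simp [psiE, h]

lemma psiE_fderiv (ho : IsOpen Ω) (hs : IsSolution Ω p f) {y : E2} (hy : y ∈ Ω) :
    HasFDerivAt (psiE Ω f δ) (hcut δ (f y) • fderiv ℝ f y) y := by
  have h1 := (c2_facts ho hs.1).2.2.2.1 y hy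
  have h2 := (phic_deriv δ (f y)).comp_hasFDerivAt y h1
  refine h2.congr_of_eventuallyEq ?_
  filter_upwards [ho.mem_nhds hy] with z hz
  exact psiE_in hz

lemma psiE_fderiv_off (hb : IsBounded Ω) (hs : IsSolution Ω p f) (hδ : 0 < δ) {y : E2} (hy : y ∉ Kset Ω f δ) :
    HasFDerivAt (psiE Ω f δ) (0 : E2 →L[ℝ] ℝ) y := by
  have : psiE Ω f δ =ᶠ[𝓝 y] fun _ => 0 := by
    filter_upwards [(Kset_compact hb hs).isClosed.isOpen_compl.mem_nhds hy] with z hz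
    exact psiE_off hδ hz
  exact (hasFDerivAt_const (0:ℝ) y).congr_of_eventuallyEq this

lemma psiE_diff (ho : IsOpen Ω) (hb : IsBounded Ω) (hs : IsSolution Ω p f) (hδ : 0 < δ) :
    Differentiable ℝ (psiE Ω f δ) := by
  intro y
  by_cases h : y ∈ Ω
  · exact (psiE_fderiv ho hs h).differentiableAt
  · exact (psiE_fderiv_off hb hs hδ fun hk => h (Kset_sub ho hδ hs hk)).differentiableAt

lemma psiE_contfd (ho : IsOpen Ω) (hb : IsBounded Ω) (hs : IsSolution Ω p f) (hδ : 0 < δ) :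
    Continuous (fderiv ℝ (psiE Ω f δ)) := by
  rw [continuous_iff_continuousAt]
  intro y
  by_cases h : y ∈ Ω
  · have c := c2_facts ho hs.1
    have h1 : ContinuousAt (fun y => hcut δ (f y) • fderiv ℝ f y) y :=
      ((hcut_cont δ).continuousAt.comp (c.1.continuousAt (ho.mem_nhds h))).smul (c.2.1.continuousAt (ho.mem_nhds h))
    refine h1.congr ?_
    filter_upwards [ho.mem_nhds h] with z hz
    exact (psiE_fderiv ho hs hz).fderiv.symm
  · have hk : y ∉ Kset Ω f δ := fun hk => h (Kset_sub ho hδ hs hk)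
    refine (continuousAt_const (y := (0 : E2 →L[ℝ] ℝ))).congr ?_
    filter_upwards [(Kset_compact hb hs).isClosed.isOpen_compl.mem_nhds hk] with z hz
    exact (psiE_fderiv_off hb hs hδ hz).fderiv.symm

/-- square gradient -/
def gsq (g : E2 → ℝ) (y : E2) : ℝ := ∑ j : Fin 2, (fderiv ℝ g y (EuclideanSpace.single j 1)) ^ 2

lemma int_of_cont {K : Set E2} {F : E2 → ℝ} (hK : IsCompact K) (hc : ContinuousOn F K) (h0 : ∀ y ∉ K, F y = 0) :
    Integrable F := by
  rw [← integrableOn_iff_integrable_of_support_subset (s := K)]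
  · exact hc.integrableOn_compact hK
  · intro y hy; by_contra h; exact hy (h0 y h)

lemma energy_int (hb : IsBounded Ω) (hs : IsSolution Ω p f) (hp : 1 < p) :
    IntegrableOn (fun y => (max (f y) 0) ^ (p + 1)) Ω := by
  have : ContinuousOn (fun y => (max (f y) 0) ^ (p + 1)) (closure Ω) :=
    ContinuousOn.rpow_const (hs.2.1.sup continuousOn_const) fun x _ => Or.inr (by linarith)
  exact (this.integrableOn_compact hb.isCompact_closure).mono_set subset_closure

lemma dirichlet_le (ho : IsOpen Ω) (hb : IsBounded Ω) (hs : IsSolution Ω p f) (hδ : 0 < δ) (hp : 1 < p) :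
    Integrable (gsq (psiE Ω f δ)) ∧ ∫ y, gsq (psiE Ω f δ) y ≤ ∫ y in Ω, (max (f y) 0) ^ (p + 1) := by
  set ψ := psiE Ω f δ with hψ
  obtain ⟨c0, c1, c2, c3, c4⟩ := c2_facts ho hs.1
  have hK := Kset_compact (δ := δ) hb hs
  have hKΩ := Kset_sub ho hδ hs
  have hfdc := psiE_contfd ho hb hs hδ
  have hψc : Continuous ψ := (psiE_diff ho hb hs hδ).continuous
  have hoff : ∀ y ∉ Kset Ω f δ, fderiv ℝ ψ y = 0 := fun y hy => (psiE_fderiv_off hb hs hδ hy).fderiv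
  have hts : tsupport ψ ⊆ Kset Ω f δ := by
    refine closure_minimal (fun y hy => ?_) hK.isClosed
    by_contra h; exact hy (psiE_off hδ h)
  let e : Fin 2 → E2 := fun j => EuclideanSpace.single j 1
  have hdd : ∀ j, ∀ y ∈ Ω, HasFDerivAt (fun y => fderiv ℝ f y (e j)) ((ContinuousLinearMap.apply ℝ ℝ (e j)).comp (D2 f y)) y := by
    intro j y hy
    exact (ContinuousLinearMap.apply ℝ ℝ (e j)).hasFDerivAt.comp y (c4 y hy)
  have hval : ∀ j, ∀ y ∈ Ω, fderiv ℝ (fun y => fderiv ℝ f y (e j)) y (e j) = D2 f y (e j) (e j) := by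
    intro j y hy; rw [(hdd j y hy).fderiv]; rfl
  have i1 : ∀ j, Integrable (fun y => fderiv ℝ ψ y (e j) * fderiv ℝ f y (e j)) := fun j => by
    refine int_of_cont hK ?_ fun y hy => by rw [hoff y hy]; simp
    have a : ContinuousOn (fun y => fderiv ℝ f y (e j)) (Kset Ω f δ) := (c1.mono hKΩ).clm_apply continuousOn_const
    have b : Continuous (fun y => fderiv ℝ ψ y (e j)) := hfdc.clm_apply continuous_const
    exact b.continuousOn.mul a
  have i2 : ∀ j, Integrable (fun y => ψ y * fderiv ℝ (fun y => fderiv ℝ f y (e j)) y (e j)) := fun j => by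
    refine int_of_cont hK ?_ fun y hy => by rw [hψ, psiE_off hδ hy, zero_mul]
    have a : ContinuousOn (fun y => fderiv ℝ (fun y => fderiv ℝ f y (e j)) y (e j)) (Kset Ω f δ) := by
      refine ContinuousOn.congr ?_ (fun y hy => hval j y (hKΩ hy))
      exact ((c2.mono hKΩ).clm_apply continuousOn_const).clm_apply continuousOn_const
    exact hψc.continuousOn.mul a
  have i3 : ∀ j, Integrable (fun y => ψ y * fderiv ℝ f y (e j)) := fun j => by
    refine int_of_cont hK ?_ fun y hy => by rw [hψ, psiE_off hδ hy, zero_mul]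
    exact hψc.continuousOn.mul ((c1.mono hKΩ).clm_apply continuousOn_const)
  have ibp : ∀ j, ∫ y, ψ y * fderiv ℝ (fun y => fderiv ℝ f y (e j)) y (e j) = - ∫ y, fderiv ℝ ψ y (e j) * fderiv ℝ f y (e j) :=
    fun j => integral_mul_fderiv_eq_neg_fderiv_mul_of_integrable (i1 j) (i2 j) (i3 j)
      (fun y _ => psiE_diff ho hb hs hδ y) (fun y hy => (hdd j y (hKΩ (hts hy))).differentiableAt)
  have hgi : Integrable (gsq ψ) := by
    refine int_of_cont hK ?_ fun y hy => by simp [gsq, hoff y hy]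
    have : Continuous (gsq ψ) := by
      unfold gsq
      exact continuous_finsetSum _ fun j _ => (hfdc.clm_apply continuous_const).pow 2
    exact this.continuousOn
  refine ⟨hgi, ?_⟩
  have s1 : ∫ y, gsq ψ y ≤ ∫ y, ∑ j : Fin 2, fderiv ℝ ψ y (e j) * fderiv ℝ f y (e j) := by
    refine integral_mono hgi (integrable_finsetSum _ fun j _ => i1 j) fun y => ?_
    refine Finset.sum_le_sum fun j _ => ?_
    by_cases hy : y ∈ Ω
    · rw [(psiE_fderiv ho hs hy).fderiv]
      simp only [smul_apply, smul_eq_mul]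
      have h1 := hcut_nonneg δ (f y)
      have h2 := hcut_le δ (f y)
      have h3 : (hcut δ (f y)) ^ 2 ≤ hcut δ (f y) := by nlinarith
      have h4 := mul_le_mul_of_nonneg_right h3 (sq_nonneg (fderiv ℝ f y (EuclideanSpace.single j 1)))
      simp only [e]; nlinarith
    · have : fderiv ℝ ψ y = 0 := hoff y fun hk => hy (hKΩ hk)
      simp [this]
  have s2 : ∫ y, ∑ j : Fin 2, fderiv ℝ ψ y (e j) * fderiv ℝ f y (e j) =
      ∫ y, -∑ j : Fin 2, ψ y * fderiv ℝ (fun y => fderiv ℝ f y (e j)) y (e j) := by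
    rw [integral_neg, integral_finsetSum _ (fun j _ => i1 j), integral_finsetSum _ (fun j _ => i2 j), ← Finset.sum_neg_distrib]
    refine Finset.sum_congr rfl fun j _ => ?_
    rw [ibp j, neg_neg]
  have s3 : ∀ y, -∑ j : Fin 2, ψ y * fderiv ℝ (fun y => fderiv ℝ f y (e j)) y (e j) ≤ Ω.indicator (fun y => (max (f y) 0) ^ (p + 1)) y := by
    intro y
    by_cases hy : y ∈ Ω
    · rw [Set.indicator_of_mem hy, ← Finset.mul_sum]
      have : ∑ j : Fin 2, fderiv ℝ (fun y => fderiv ℝ f y (e j)) y (e j) = lap f y := rfl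
      rw [this, ← mul_neg, hs.2.2.1 y hy, hψ, psiE_in hy]
      rcases le_total (f y) 0 with h | h
      · rw [phic_zero hδ (by linarith), zero_mul]; positivity
      · rw [max_eq_left h, abs_of_nonneg h]
        have e1 : f y ^ (p - 1) * f y = f y ^ p := by
          rcases h.eq_or_lt with h0 | h0
          · rw [← h0, mul_zero, Real.zero_rpow (by linarith)]
          · rw [← Real.rpow_add_one h0.ne']; ring_nf
        have e2 : f y ^ (p + 1) = f y * f y ^ p := by
          rcases h.eq_or_lt with h0 | h0
          · rw [← h0, zero_mul, Real.zero_rpow (by linarith)]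
          · rw [Real.rpow_add_one h0.ne', mul_comm]
        rw [e1, e2]
        exact mul_le_mul_of_nonneg_right (phic_le h) (by positivity)
    · rw [Set.indicator_of_notMem hy]
      have : ψ y = 0 := psiE_off hδ fun hk => hy (hKΩ hk)
      simp [this]
  calc ∫ y, gsq ψ y ≤ _ := s1
    _ = _ := s2
    _ ≤ ∫ y, Ω.indicator (fun y => (max (f y) 0) ^ (p + 1)) y := by
        refine integral_mono (integrable_finsetSum _ fun j _ => i2 j).neg ?_ s3
        rw [integrable_indicator_iff ho.measurableSet]
        exact energy_int hb hs hp
    _ = _ := integral_indicator ho.measurableSet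

lemma capacity {ψ : E2 → ℝ} (hd : Differentiable ℝ ψ) (hc : Continuous (fderiv ℝ ψ)) (hi : Integrable (gsq ψ))
    {c : E2} {ρ D m : ℝ} (hρ : 0 < ρ) (hD : ρ < D) (hm : 0 ≤ m) (h1 : ∀ θ, m ≤ ψ (c + ρ • circDir θ)) (h2 : ∀ θ, ψ (c + D • circDir θ) = 0) :
    2 * π * m ^ 2 / Real.log (D / ρ) ≤ ∫ y, gsq ψ y := by
  have hpi := Real.pi_pos
  have hcd := continuous_circDir
  have hgc : Continuous (gsq ψ) := by
    unfold gsq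
    exact continuous_finsetSum _ fun j _ => (hc.clm_apply continuous_const).pow 2
  have hΛ : 0 < Real.log (D / ρ) := Real.log_pos (by rw [lt_div_iff₀ hρ]; linarith)
  set Λ := Real.log (D / ρ) with hΛd
  set a := m / Λ with ha
  have ha0 : 0 ≤ a := by positivity
  let d : ℝ → ℝ := fun r => ∫ θ in (0:ℝ)..(2 * π), fderiv ℝ ψ (c + r • circDir θ) (circDir θ)
  have hcont2 : Continuous (Function.uncurry fun (r θ : ℝ) => fderiv ℝ ψ (c + r • circDir θ) (circDir θ)) := by
    unfold Function.uncurry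
    have e1 : Continuous fun q : ℝ × ℝ => fderiv ℝ ψ (c + q.1 • circDir q.2) := hc.comp (by fun_prop)
    exact e1.clm_apply (hcd.comp continuous_snd)
  have hder : ∀ r, HasDerivAt (circInt ψ c) (d r) r := by
    intro r
    refine hasDerivAt_param (G := fun r θ => ψ (c + r • circDir θ)) (G' := fun r θ => fderiv ℝ ψ (c + r • circDir θ) (circDir θ))
      (a := r - 1) (b := r + 1) ?_ ?_ hcont2.continuousOn ⟨by linarith, by linarith⟩ _ _
    · intro s _ θ
      have h3 : HasDerivAt (fun s : ℝ => c + s • circDir θ) (circDir θ) s := by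
        simpa using ((hasDerivAt_id s).smul_const (circDir θ)).const_add c
      exact (hd (c + s • circDir θ)).hasFDerivAt.comp_hasDerivAt s h3
    · have := hd.continuous
      unfold Function.uncurry
      exact Continuous.continuousOn (by fun_prop)
  have hdc : Continuous d := intervalIntegral.continuous_parametric_intervalIntegral_of_continuous' hcont2 0 (2 * π)
  have hpt : ∀ r ∈ Set.Icc ρ D, -2 * a * d r - 2 * π * a ^ 2 * r⁻¹ ≤ r * circInt (gsq ψ) c r := by
    intro r hr
    have hr0 : 0 < r := by linarith [hr.1]
    have ic : Continuous fun θ => fderiv ℝ ψ (c + r • circDir θ) (circDir θ) := hcont2.comp (Continuous.prodMk_right r)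
    have ig : Continuous fun θ => gsq ψ (c + r • circDir θ) := by fun_prop
    have e1 : -2 * a * d r - 2 * π * a ^ 2 * r⁻¹ = ∫ θ in (0:ℝ)..(2 * π), (-2 * a * fderiv ℝ ψ (c + r • circDir θ) (circDir θ) - a ^ 2 * r⁻¹) := by
      rw [intervalIntegral.integral_sub (Continuous.intervalIntegrable (by fun_prop) _ _) (continuous_const.intervalIntegrable _ _),
        intervalIntegral.integral_const_mul, intervalIntegral.integral_const, smul_eq_mul]
      simp only [d]; ring
    rw [e1, circInt, ← intervalIntegral.integral_const_mul]
    refine intervalIntegral.integral_mono_on (by positivity) (Continuous.intervalIntegrable (by fun_prop) _ _)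
      (Continuous.intervalIntegrable (by fun_prop) _ _) fun θ _ => ?_
    set T := fderiv ℝ ψ (c + r • circDir θ) with hT
    have h3 : (T (circDir θ)) ^ 2 ≤ gsq ψ (c + r • circDir θ) := by
      rw [gsq, Fin.sum_univ_two, ← hT, circDir_eq θ, map_add, map_smul, map_smul, smul_eq_mul, smul_eq_mul]
      set A := T (EuclideanSpace.single 0 1)
      set B := T (EuclideanSpace.single 1 1)
      have := Real.sin_sq_add_cos_sq θ
      have h4 : A ^ 2 + B ^ 2 - (Real.cos θ * A + Real.sin θ * B) ^ 2 = (Real.sin θ * A - Real.cos θ * B) ^ 2 := by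
        linear_combination -(A ^ 2 + B ^ 2) * this
      nlinarith [sq_nonneg (Real.sin θ * A - Real.cos θ * B)]
    set t := T (circDir θ)
    have h5 : r * t ^ 2 - (-2 * a * t - a ^ 2 * r⁻¹) = r * (t + a * r⁻¹) ^ 2 := by field_simp; ring
    have h6 : 0 ≤ r * (t + a * r⁻¹) ^ 2 := by positivity
    have h7 := mul_le_mul_of_nonneg_left h3 hr0.le
    linarith
  have hpa := polar_annulus (F := gsq ψ) (c := c) (R := D + 1) (a := ρ) (b := D) hgc.continuousOn hρ.le hD.le (by linarith)
  have hle : ∫ z in {z | ‖z - c‖ ∈ Set.Ioc ρ D}, gsq ψ z ≤ ∫ z, gsq ψ z :=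
    setIntegral_le_integral hi (Eventually.of_forall fun z => Finset.sum_nonneg fun j _ => sq_nonneg _)
  rw [hpa] at hle
  refine le_trans ?_ hle
  have hinv : ContinuousOn (fun r : ℝ => r⁻¹) (Set.uIcc ρ D) := by
    rw [Set.uIcc_of_le hD.le]
    exact continuousOn_inv₀.mono fun r hr => by
      have : 0 < r := by linarith [hr.1]
      exact this.ne'
  have e2 : ∫ r in ρ..D, (-2 * a * d r - 2 * π * a ^ 2 * r⁻¹) = -2 * a * (circInt ψ c D - circInt ψ c ρ) - 2 * π * a ^ 2 * Λ := by
    have q1 : IntervalIntegrable (fun r => -2 * a * d r) volume ρ D := (continuous_const.mul hdc).intervalIntegrable _ _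
    have q2 : IntervalIntegrable (fun r => 2 * π * a ^ 2 * r⁻¹) volume ρ D := (continuousOn_const.mul hinv).intervalIntegrable
    rw [intervalIntegral.integral_sub q1 q2,
      intervalIntegral.integral_const_mul, intervalIntegral.integral_const_mul, integral_inv_of_pos hρ (by linarith),
      intervalIntegral.integral_eq_sub_of_hasDerivAt (fun r _ => hder r) (hdc.intervalIntegrable _ _)]
  have e3 : circInt ψ c D = 0 := by simp [circInt, h2]
  have e4 : 2 * π * m ≤ circInt ψ c ρ := by
    have hψ := hd.continuous
    have := intervalIntegral.integral_mono_on (μ := volume) (a := 0) (b := 2 * π) (f := fun _ => m) (g := fun θ => ψ (c + ρ • circDir θ)) (by positivity)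
      (continuous_const.intervalIntegrable _ _) (Continuous.intervalIntegrable (by fun_prop) _ _) (fun θ _ => h1 θ)
    simpa [circInt] using this
  have e5 : 2 * π * m ^ 2 / Λ ≤ ∫ r in ρ..D, (-2 * a * d r - 2 * π * a ^ 2 * r⁻¹) := by
    rw [e2, e3]
    have : 2 * π * m ^ 2 / Λ = 2 * a * (2 * π * m) - 2 * π * a ^ 2 * Λ := by rw [ha]; field_simp; ring
    rw [this]
    nlinarith [mul_le_mul_of_nonneg_left e4 ha0]
  refine e5.trans (intervalIntegral.integral_mono_on hD.le ?_ ?_ hpt)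
  · exact ((continuous_const.mul hdc).intervalIntegrable _ _).sub ((continuousOn_const.mul hinv).intervalIntegrable)
  · have : Continuous (Function.uncurry fun (r θ : ℝ) => gsq ψ (c + r • circDir θ)) := by unfold Function.uncurry; fun_prop
    have h9 : Continuous (circInt (gsq ψ) c) := intervalIntegral.continuous_parametric_intervalIntegral_of_continuous' this 0 (2 * π)
    exact (continuous_id.mul h9).intervalIntegrable _ _

lemma energy_lower (ho : IsOpen Ω) (hb : IsBounded Ω) (hs : IsSolution Ω p f) (hp : 1 < p)
    {c : E2} {ρ D m : ℝ} (hρ : 0 < ρ) (hD : ρ < D) (hm : 0 ≤ m) (h1 : ∀ θ, c + ρ • circDir θ ∈ Ω ∧ m ≤ f (c + ρ • circDir θ))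
    (h2 : Ω ⊆ ball c D) :
    2 * π * m ^ 2 / Real.log (D / ρ) ≤ ∫ y in Ω, (max (f y) 0) ^ (p + 1) := by
  have key : ∀ δ > 0, 2 * δ < m → 2 * π * (m - 2 * δ) ^ 2 / Real.log (D / ρ) ≤ ∫ y in Ω, (max (f y) 0) ^ (p + 1) := by
    intro δ hδ hδm
    obtain ⟨a, b⟩ := dirichlet_le ho hb hs hδ hp
    refine (capacity (psiE_diff ho hb hs hδ) (psiE_contfd ho hb hs hδ) a hρ hD (c := c) (m := m - 2 * δ) (by linarith) ?_ ?_).trans b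
    · intro θ
      rw [psiE_in (h1 θ).1]
      linarith [(h1 θ).2, phic_ge (δ := δ) (t := f (c + ρ • circDir θ)) hδ]
    · intro θ
      have : c + D • circDir θ ∉ Ω := fun hh => by
        have := h2 hh
        rw [mem_ball, dist_eq_norm, add_sub_cancel_left, norm_smul_circDir (by linarith)] at this
        exact lt_irrefl _ this
      simp [psiE, this]
  rcases hm.eq_or_lt with h0 | h0
  · rw [← h0]; simp; exact integral_nonneg fun y => by positivity
  · have ht : Tendsto (fun δ : ℝ => 2 * π * (m - 2 * δ) ^ 2 / Real.log (D / ρ)) (𝓝[>] 0) (𝓝 (2 * π * (m - 2 * 0) ^ 2 / Real.log (D / ρ))) := by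
      refine Tendsto.mono_left ?_ nhdsWithin_le_nhds
      exact Continuous.tendsto (by fun_prop) 0
    rw [mul_zero, sub_zero] at ht
    refine le_of_tendsto ht ?_
    filter_upwards [Ioo_mem_nhdsGT (by linarith : 0 < m / 2)] with δ hδ
    exact key δ hδ.1 (by linarith [hδ.2])
end

/-- Data for one concentration point. -/
structure Side (Ω : Set E2) (p : ℕ → ℝ) (f : ℕ → E2 → ℝ) (xl : ℕ → E2) (x : E2) (ε : ℕ → ℝ) (v : ℕ → E2 → ℝ)
    (ϱ : ℝ) (N0 : ℕ) (w0 : E2 → ℝ) : Prop where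
  ho : IsOpen Ω
  hb : IsBounded Ω
  hp1 : ∀ n, 1 < p n
  ptop : Tendsto p atTop atTop
  sol : ∀ n, IsSolution Ω (p n) (f n)
  mem : ∀ n, xl n ∈ Ω
  mx : ∀ n, ∀ y ∈ closure Ω, f n y ≤ f n (xl n)
  pos : ∀ n, 0 < f n (xl n)
  xmem : x ∈ Ω
  xconv : Tendsto xl atTop (𝓝 x)
  epos : ∀ n, 0 < ε n
  edef : ∀ n, (ε n) ^ 2 * (p n * (f n (xl n)) ^ (p n - 1)) = 1
  hv : ∀ n z, v n z = (p n / f n (xl n)) * (f n (xl n + ε n • z) - f n (xl n))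
  rpos : 0 < ϱ
  sign : ∀ n ≥ N0, ∀ y ∈ ball x (2 * ϱ), 1 / p n ≤ f n y
  lim : TendstoC2LocOn Set.univ (fun n z => p n * (v n z - Ustd z)) w0
  weq : ∀ z : E2, -lap w0 z - Real.exp (Ustd z) * w0 z = -((Ustd z) ^ 2 / 2) * Real.exp (Ustd z)
  wgr : ∀ τ ∈ Set.Ioo (0:ℝ) 1, ∃ C > (0:ℝ), ∀ z : E2, |w0 z| ≤ C * (1 + ‖z‖) ^ τ

lemma conn_sub {Ω S : Set E2} (ho : IsOpen Ω) (hS : IsPreconnected S) (hne : (S ∩ Ω).Nonempty)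
    (h : ∀ y ∈ S, y ∉ frontier Ω) : S ⊆ Ω := by
  refine IsPreconnected.subset_left_of_subset_union ho isClosed_closure.isOpen_compl (v := (closure Ω)ᶜ) ?_ ?_ hne hS
  · exact Set.disjoint_left.2 fun y hy hy' => hy' (subset_closure hy)
  · intro y hy
    by_cases h1 : y ∈ closure Ω
    · left
      by_contra h2
      exact h y hy ⟨h1, by rwa [ho.interior_eq]⟩
    · right; exact h1

section
variable {Ω : Set E2} {p : ℕ → ℝ} {f : ℕ → E2 → ℝ} {xl : ℕ → E2} {x : E2} {ε : ℕ → ℝ} {v : ℕ → E2 → ℝ}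
    {ϱ : ℝ} {N0 : ℕ} {w0 : E2 → ℝ}

lemma Side.fv (h : Side Ω p f xl x ε v ϱ N0 w0) (n : ℕ) (z : E2) :
    f n (xl n + ε n • z) = f n (xl n) * (1 + v n z / p n) := by
  rw [h.hv]
  have h1 := (h.pos n).ne'
  have h2 : p n ≠ 0 := by linarith [h.hp1 n]
  field_simp
  ring

lemma Side.vclose (h : Side Ω p f xl x ε v ϱ N0 w0) (R : ℝ) (hR : 0 ≤ R) : ∃ C > 0, ∀ᶠ n in atTop, ∀ z : E2, ‖z‖ ≤ R →
    |v n z - Ustd z| ≤ C / p n ∧ -C ≤ v n z ∧ |Ustd z| ≤ C := by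
  obtain ⟨C, hC, hw⟩ := h.wgr (1/2) (by norm_num)
  set A := C * (1 + R) ^ (1/2:ℝ) + 1 with hA
  have hA1 : 1 ≤ A := by have : 0 ≤ C * (1 + R) ^ (1/2:ℝ) := by positivity
                         linarith
  set B := 4 * Real.log (1 + R) with hB
  have hB0 : 0 ≤ B := by have := Real.log_nonneg (show 1 ≤ 1 + R by linarith); linarith
  refine ⟨A + B, by linarith, ?_⟩
  have := h.lim (closedBall 0 R) (Set.subset_univ _) (isCompact_closedBall 0 R) 0 (by norm_num)
  rw [Metric.tendstoUniformlyOn_iff] at this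
  filter_upwards [this 1 one_pos] with n hn z hz
  have h1 := hn z (by simpa using hz)
  rw [dist_comm] at h1
  have h2 := (dist_d0 _ _ z).trans h1.le
  have hp := h.hp1 n
  have h3 : |w0 z| ≤ A - 1 := (hw z).trans (by rw [hA, add_sub_cancel_right]; gcongr)
  have h4 : |p n * (v n z - Ustd z)| ≤ A := by
    rw [abs_le] at *; constructor <;> linarith [h2.1, h2.2, h3.1, h3.2]
  rw [abs_mul, abs_of_pos (by linarith)] at h4
  have h5 : |v n z - Ustd z| ≤ A / p n := by rw [le_div_iff₀ (by linarith)]; linarith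
  have h6 : |Ustd z| ≤ B := (abs_Ustd_le z).trans (by
    have := Real.log_le_log (show 0 < 1 + ‖z‖ by positivity) (show 1 + ‖z‖ ≤ 1 + R by linarith)
    linarith)
  have h7 : A / p n ≤ A := div_le_self (by linarith) hp.le
  refine ⟨h5.trans (by gcongr; linarith), ?_, by linarith⟩
  rw [abs_le] at h5 h6
  linarith [h5.1, h6.1]

lemma Side.ball_in (h : Side Ω p f xl x ε v ϱ N0 w0) (R : ℝ) (hR : 0 ≤ R) : ∀ᶠ n in atTop, ∀ z : E2, ‖z‖ ≤ R →
    xl n + ε n • z ∈ Ω := by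
  obtain ⟨C, hC, hc⟩ := h.vclose R hR
  filter_upwards [hc, h.ptop.eventually_gt_atTop C] with n hn hpn
  have he := h.epos n
  have : closedBall (xl n) (ε n * R) ⊆ Ω := by
    refine conn_sub h.ho (convex_closedBall _ _).isPreconnected ⟨xl n, mem_closedBall_self (by positivity), h.mem n⟩ ?_
    intro y hy hf
    have h0 := (h.sol n).2.2.2 y hf
    set z := (ε n)⁻¹ • (y - xl n) with hz
    have hy' : y = xl n + ε n • z := by rw [hz, smul_inv_smul₀ he.ne']; abel
    have hzR : ‖z‖ ≤ R := by
      rw [mem_closedBall, dist_eq_norm] at hy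
      rw [hz, norm_smul, norm_inv, Real.norm_of_nonneg he.le, inv_mul_le_iff₀ he]; exact hy
    have h1 := (hn z hzR).2.1
    rw [hy', h.fv] at h0
    have h2 := (mul_eq_zero.1 h0).resolve_left (h.pos n).ne'
    have h3 : v n z = -p n := by
      have : p n ≠ 0 := by linarith [h.hp1 n]
      field_simp at h2; linarith
    linarith
  intro z hz
  apply this
  rw [mem_closedBall, dist_eq_norm, add_sub_cancel_left, norm_smul, Real.norm_of_nonneg he.le]
  gcongr

/-- the (positive part) energy -/
def en (Ω : Set E2) (p : ℝ) (f : E2 → ℝ) : ℝ := p * ∫ y in Ω, (max (f y) 0) ^ (p + 1)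

lemma Side.lower (h : Side Ω p f xl x ε v ϱ N0 w0) : ∃ (D : ℝ) (κ δ : ℕ → ℝ), 0 < D ∧ Tendsto κ atTop (𝓝 1) ∧ Tendsto δ atTop (𝓝 0) ∧
    ∀ᶠ n in atTop, 0 < Real.log (D / ε n) ∧
      8 * π * Real.exp 1 * κ n * (Real.exp (4 * Real.log (D / ε n) / p n - 1) / (4 * Real.log (D / ε n) / p n)) ≤ en Ω (p n) (f n) ∧
      Real.exp (4 * Real.log (D / ε n) / p n - δ n) ≤ f n (xl n) ^ 2 := by
  obtain ⟨C, hC, hc⟩ := h.vclose 1 zero_le_one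
  obtain ⟨D0, hD0⟩ := h.hb.subset_ball 0
  have hD0p : 0 < D0 := by
    have := hD0 h.xmem
    rw [mem_ball] at this
    exact dist_nonneg.trans_lt this
  set D := 2 * D0 with hD
  set δ : ℕ → ℝ := fun n => (4 * |Real.log D| + 2 * Real.log (p n)) / (p n - 1) with hδ
  have hδt : Tendsto δ atTop (𝓝 0) := by
    have : Tendsto (fun q : ℝ => (4 * |Real.log D| + 2 * Real.log q) / (q - 1)) atTop (𝓝 0) := by
      have t1 : Tendsto (fun q : ℝ => Real.log q / q) atTop (𝓝 0) := by
        have := Real.isLittleO_log_id_atTop.tendsto_div_nhds_zero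
        simpa using this
      have t2 : Tendsto (fun q : ℝ => 1 / q) atTop (𝓝 0) := by simpa using tendsto_inv_atTop_zero
      have t3 : Tendsto (fun q : ℝ => (4 * |Real.log D| * (1 / q) + 2 * (Real.log q / q)) / (1 - 1 / q)) atTop (𝓝 ((4 * |Real.log D| * 0 + 2 * 0) / (1 - 0))) :=
        ((t2.const_mul _).add (t1.const_mul _)).div (tendsto_const_nhds.sub t2) (by norm_num)
      rw [mul_zero, mul_zero, add_zero, zero_div] at t3
      refine t3.congr' ?_
      filter_upwards [eventually_gt_atTop 1] with q hq
      have h1 : q - 1 ≠ 0 := by linarith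
      have h2 : q ≠ 0 := by linarith
      field_simp
    exact this.comp h.ptop
  have hCt : Tendsto (fun n => 1 - C / p n) atTop (𝓝 1) := by
    have : Tendsto (fun n => C / p n) atTop (𝓝 0) := h.ptop.const_div_atTop C
    simpa using this.const_sub 1
  refine ⟨D, fun n => (1 - C / p n) ^ 2 * Real.exp (-δ n), δ, by positivity, ?_, hδt, ?_⟩
  · have := (hCt.pow 2).mul ((Real.continuous_exp.tendsto _).comp hδt.neg)
    simpa using this
  filter_upwards [hc, h.ball_in 1 zero_le_one, h.ptop.eventually_gt_atTop C] with n hn hin hpC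
  have hp := h.hp1 n
  have he := h.epos n
  set M := f n (xl n) with hM
  have hM0 : 0 < M := h.pos n
  have hsub : Ω ⊆ ball (xl n) D := by
    intro y hy
    have a := hD0 hy
    have b := hD0 (h.mem n)
    rw [mem_ball] at *
    have := dist_triangle_right y (xl n) 0
    linarith
  have hθ : ∀ θ, xl n + ε n • circDir θ ∈ Ω := fun θ => hin _ (norm_circDir θ).le
  have heD : ε n < D := by
    have := hsub (hθ 0)
    rwa [mem_ball, dist_eq_norm, add_sub_cancel_left, norm_smul_circDir he.le] at this
  have hC1 : 0 < 1 - C / p n := by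
    have : C / p n < 1 := by rw [div_lt_one (by linarith)]; exact hpC
    linarith
  have hE := energy_lower h.ho h.hb (h.sol n) hp (c := xl n) (ρ := ε n) (D := D) (m := M * (1 - C / p n)) he heD (by positivity)
    (fun θ => ⟨hθ θ, by
      rw [h.fv]
      have h1 := (hn (circDir θ) (norm_circDir θ).le).2.1
      have : -C / p n ≤ v n (circDir θ) / p n := by gcongr
      rw [neg_div] at this
      exact mul_le_mul_of_nonneg_left (by linarith) hM0.le⟩) hsub
  have hΛ : 0 < Real.log (D / ε n) := Real.log_pos (by rw [lt_div_iff₀ he]; linarith)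
  set Λ := Real.log (D / ε n) with hΛd
  have hle : Real.log (ε n) = Real.log D - Λ := by
    rw [hΛd, Real.log_div (by linarith) he.ne']; ring
  have hlog : 2 * Real.log (ε n) + (Real.log (p n) + (p n - 1) * Real.log M) = 0 := by
    have := congrArg Real.log (h.edef n)
    have hMp := Real.rpow_pos_of_pos hM0 (p n - 1)
    rw [Real.log_mul (by positivity) (mul_pos (by linarith) hMp).ne', Real.log_mul (by linarith) hMp.ne', Real.log_pow, Real.log_rpow hM0, Real.log_one] at this
    push_cast at this
    exact this
  have hM2 : Real.exp (4 * Λ / p n - δ n) ≤ M ^ 2 := by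
    have e1 : M ^ 2 = Real.exp (2 * Real.log M) := by
      rw [show 2 * Real.log M = Real.log M + Real.log M by ring, Real.exp_add, Real.exp_log hM0]; ring
    rw [e1, Real.exp_le_exp]
    have hq : 0 < p n - 1 := by linarith
    have e2 : 2 * Real.log M = (4 * Λ - 4 * Real.log D - 2 * Real.log (p n)) / (p n - 1) := by
      rw [eq_div_iff hq.ne']; rw [hle] at hlog; linarith
    have e3 : 4 * Λ / p n ≤ 4 * Λ / (p n - 1) := by gcongr; linarith
    have e4 : (4 * Λ - 4 * Real.log D - 2 * Real.log (p n)) / (p n - 1) = 4 * Λ / (p n - 1) - (4 * Real.log D + 2 * Real.log (p n)) / (p n - 1) := by ring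
    have e5 : (4 * Real.log D + 2 * Real.log (p n)) / (p n - 1) ≤ δ n := by
      simp only [hδ]; gcongr; exact le_abs_self _
    rw [e2, e4]; linarith
  refine ⟨hΛ, ?_, hM2⟩
  have hp0 : 0 < p n := by linarith
  have hen : p n * (2 * π * (M * (1 - C / p n)) ^ 2 / Λ) ≤ en Ω (p n) (f n) := mul_le_mul_of_nonneg_left hE hp0.le
  refine le_trans ?_ hen
  have e6 : Real.exp (4 * Λ / p n - 1) = Real.exp (4 * Λ / p n) / Real.exp 1 := Real.exp_sub _ _
  have e7 : Real.exp (4 * Λ / p n - δ n) = Real.exp (4 * Λ / p n) * Real.exp (- δ n) := by rw [← Real.exp_add]; ring_nf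
  rw [e7] at hM2
  rw [e6]
  have e8 : 8 * π * Real.exp 1 * ((1 - C / p n) ^ 2 * Real.exp (-δ n)) * (Real.exp (4 * Λ / p n) / Real.exp 1 / (4 * Λ / p n)) =
    p n * (2 * π * (1 - C / p n) ^ 2 / Λ) * (Real.exp (4 * Λ / p n) * Real.exp (-δ n)) := by
    have := (Real.exp_pos 1).ne'
    have := hΛ.ne'
    field_simp; norm_num
  have e9 : p n * (2 * π * (M * (1 - C / p n)) ^ 2 / Λ) = p n * (2 * π * (1 - C / p n) ^ 2 / Λ) * M ^ 2 := by ring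
  rw [e8, e9]
  have := Real.pi_pos
  exact mul_le_mul_of_nonneg_left hM2 (by positivity)

lemma Side.lemA (h : Side Ω p f xl x ε v ϱ N0 w0) {η : ℝ} (hη : 0 < η) : ∀ᶠ n in atTop, 8 * π * Real.exp 1 - η ≤ en Ω (p n) (f n) := by
  obtain ⟨D, κ, δ, hD, hκ, hδ, hl⟩ := h.lower
  have hpe : 0 < 8 * π * Real.exp 1 := by have := Real.pi_pos; positivity
  have hκ' : Tendsto (fun n => 8 * π * Real.exp 1 * κ n) atTop (𝓝 (8 * π * Real.exp 1 * 1)) := hκ.const_mul _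
  rw [mul_one] at hκ'
  filter_upwards [hl, hκ.eventually_const_lt (show (0:ℝ) < 1 by norm_num), hκ'.eventually_const_lt (show 8 * π * Real.exp 1 - η < 8 * π * Real.exp 1 by linarith)] with n hn h1 h2
  obtain ⟨a, b, -⟩ := hn
  refine le_trans ?_ b
  have hp : 0 < p n := by linarith [h.hp1 n]
  set t := 4 * Real.log (D / ε n) / p n
  have ht : 0 < t := by positivity
  have : 1 ≤ Real.exp (t - 1) / t := by
    rw [one_le_div ht]; linarith [Real.add_one_le_exp (t - 1)]
  nlinarith [mul_pos hpe h1]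

end

lemma lap_scale (f : E2 → ℝ) (A M ε : ℝ) (c z : E2) :
    lap (fun z => A * (f (c + ε • z) - M)) z = A * ε ^ 2 * lap f (c + ε • z) := by
  have h1 : ∀ (g : E2 → ℝ) (B N : ℝ) (y : E2), fderiv ℝ (fun z => B * (g (c + ε • z) - N)) y = (B * ε) • fderiv ℝ g (c + ε • y) := by
    intro g B N y
    have e1 : fderiv ℝ (fun z => g (c + ε • z) - N) y = ε • fderiv ℝ g (c + ε • y) := by
      rw [fderiv_sub_const, fderiv_comp_smul (f := fun y => g (c + y)) ε, fderiv_comp_add_left]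
    have e2 : (fun z => B * (g (c + ε • z) - N)) = B • (fun z => g (c + ε • z) - N) := by ext; simp
    rw [e2, fderiv_const_smul_field, Pi.smul_apply, e1, smul_smul]
  unfold lap
  rw [Finset.mul_sum]
  refine Finset.sum_congr rfl fun i _ => ?_
  have h2 : (fun y => (fderiv ℝ (fun z => A * (f (c + ε • z) - M)) y) (EuclideanSpace.single i 1)) =
      fun y => (A * ε) * ((fun y => fderiv ℝ f y (EuclideanSpace.single i 1)) (c + ε • y) - 0) := by
    ext y; rw [h1]; simp
  rw [h2, h1 (fun y => fderiv ℝ f y (EuclideanSpace.single i 1))]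
  simp only [smul_apply, smul_eq_mul]; ring

section
variable {Ω : Set E2} {p : ℕ → ℝ} {f : ℕ → E2 → ℝ} {xl : ℕ → E2} {x : E2} {ε : ℕ → ℝ} {v : ℕ → E2 → ℝ}
    {ϱ : ℝ} {N0 : ℕ} {w0 : E2 → ℝ}

lemma Side.big_in (h : Side Ω p f xl x ε v ϱ N0 w0) : ∀ᶠ n in atTop, ∀ z : E2, ‖z‖ ≤ ϱ / ε n →
    xl n + ε n • z ∈ Ω ∧ -p n < v n z ∧ v n z ≤ 0 := by
  filter_upwards [eventually_ge_atTop N0, (Metric.tendsto_nhds.1 h.xconv) ϱ h.rpos] with n hn hd z hz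
  have he := h.epos n
  have hp := h.hp1 n
  have hsub : ball x (2 * ϱ) ⊆ Ω := by
    refine conn_sub h.ho (convex_ball _ _).isPreconnected ⟨x, mem_ball_self (by linarith [h.rpos]), h.xmem⟩ ?_
    intro y hy hf
    have h1 := h.sign n hn y hy
    rw [(h.sol n).2.2.2 y hf] at h1
    have : 0 < 1 / p n := by positivity
    linarith
  have hm : xl n + ε n • z ∈ ball x (2 * ϱ) := by
    rw [mem_ball, dist_eq_norm] at *
    have h1 : ‖ε n • z‖ ≤ ϱ := by
      rw [norm_smul, Real.norm_of_nonneg he.le]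
      rw [le_div_iff₀ he] at hz; linarith
    have : xl n + ε n • z - x = (xl n - x) + ε n • z := by abel
    rw [this]
    linarith [norm_add_le (xl n - x) (ε n • z)]
  have hM := h.pos n
  refine ⟨hsub hm, ?_, ?_⟩
  · have h1 := h.sign n hn _ hm
    have h2 : 0 < 1 / p n := by positivity
    rw [h.fv] at h1
    have h3 : 0 < 1 + v n z / p n := by
      by_contra hh
      have := mul_nonpos_of_nonneg_of_nonpos hM.le (not_lt.1 hh)
      linarith
    have h4 : -1 < v n z / p n := by linarith
    rw [lt_div_iff₀ (by linarith)] at h4; linarith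
  · have h1 := h.mx n _ (subset_closure (hsub hm))
    rw [h.hv]
    exact mul_nonpos_of_nonneg_of_nonpos (by positivity) (by linarith)

lemma Side.solB (h : Side Ω p f xl x ε v ϱ N0 w0) : ∀ᶠ n in atTop, ∀ Q, Q ≤ ϱ / ε n → SolB (p n) (v n) Q := by
  filter_upwards [h.big_in] with n hn Q hQ
  have hz : ∀ z ∈ ball (0:E2) Q, ‖z‖ ≤ ϱ / ε n := fun z hz => by
    rw [mem_ball_zero_iff] at hz; linarith
  have hvf : v n = fun z => p n / f n (xl n) * (f n (xl n + ε n • z) - f n (xl n)) := funext (h.hv n)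
  have hM := h.pos n
  have hp := h.hp1 n
  refine ⟨?_, fun z hh => (hn z (hz z hh)).2.1, fun z hh => (hn z (hz z hh)).2.2, ?_⟩
  · rw [hvf]
    refine contDiffOn_const.mul (ContDiffOn.sub ?_ contDiffOn_const)
    exact (h.sol n).1.comp (by fun_prop) fun z hh => (hn z (hz z hh)).1
  · intro z hh
    obtain ⟨a, b, -⟩ := hn z (hz z hh)
    have e1 := (h.sol n).2.2.1 _ a
    have hg : 0 < 1 + v n z / p n := by
      have : -1 < v n z / p n := by rw [lt_div_iff₀ (by linarith)]; linarith
      linarith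
    have hf := h.fv n z
    have hfp : 0 < f n (xl n + ε n • z) := by rw [hf]; positivity
    have e2 : lap (v n) z = p n / f n (xl n) * ε n ^ 2 * lap (f n) (xl n + ε n • z) := by
      rw [hvf]; exact lap_scale _ _ _ _ _ _
    have e3 : |f n (xl n + ε n • z)| ^ (p n - 1) * f n (xl n + ε n • z) = f n (xl n) ^ (p n - 1) * f n (xl n) * (1 + v n z / p n) ^ (p n) := by
      rw [abs_of_pos hfp, ← Real.rpow_add_one hfp.ne', ← Real.rpow_add_one hM.ne', sub_add_cancel, hf, Real.mul_rpow hM.le hg.le]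
    rw [e3] at e1
    have e4 : lap (f n) (xl n + ε n • z) = -(f n (xl n) ^ (p n - 1) * f n (xl n) * (1 + v n z / p n) ^ (p n)) := by linarith
    have := h.edef n
    rw [e2, e4]
    calc -(p n / f n (xl n) * ε n ^ 2 * -(f n (xl n) ^ (p n - 1) * f n (xl n) * (1 + v n z / p n) ^ p n))
        = (ε n ^ 2 * (p n * f n (xl n) ^ (p n - 1))) * (1 + v n z / p n) ^ p n := by field_simp
      _ = _ := by rw [this, one_mul]

lemma Side.en_ge (h : Side Ω p f xl x ε v ϱ N0 w0) : ∀ᶠ n in atTop, ∀ Q, Q ≤ ϱ / ε n →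
    f n (xl n) ^ 2 * ∫ z in closedBall (0:E2) Q, (1 + v n z / p n) ^ (p n + 1) ≤ en Ω (p n) (f n) := by
  filter_upwards [h.big_in] with n hn Q hQ
  have hM := h.pos n
  have hp := h.hp1 n
  have he := h.epos n
  set F : E2 → ℝ := Ω.indicator (fun y => (max (f n y) 0) ^ (p n + 1)) with hF
  have hFi : Integrable F := by
    rw [hF, integrable_indicator_iff h.ho.measurableSet]
    exact energy_int h.hb (h.sol n) hp
  have hF0 : ∀ y, 0 ≤ F y := fun y => Set.indicator_nonneg (fun y _ => by positivity) y
  have e1 : ∫ z, F (xl n + ε n • z) = (ε n ^ 2)⁻¹ * ∫ y, F y := by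
    rw [Measure.integral_comp_smul volume (fun y => F (xl n + y)) (ε n), integral_add_left_eq_self]
    simp
  have hi : Integrable fun z => F (xl n + ε n • z) := (hFi.comp_add_left (xl n)).comp_smul he.ne'
  have e2 : ∫ z in closedBall (0:E2) Q, F (xl n + ε n • z) ≤ ∫ z, F (xl n + ε n • z) :=
    setIntegral_le_integral hi (Eventually.of_forall fun z => hF0 _)
  have e3 : ∫ z in closedBall (0:E2) Q, F (xl n + ε n • z) = ∫ z in closedBall (0:E2) Q, f n (xl n) ^ (p n + 1) * (1 + v n z / p n) ^ (p n + 1) := by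
    refine setIntegral_congr_fun measurableSet_closedBall fun z hz => ?_
    rw [mem_closedBall_zero_iff] at hz
    obtain ⟨a, b, -⟩ := hn z (hz.trans hQ)
    have hg : 0 < 1 + v n z / p n := by
      have : -1 < v n z / p n := by rw [lt_div_iff₀ (by linarith)]; linarith
      linarith
    simp only [hF, Set.indicator_of_mem a]
    rw [h.fv, max_eq_left (by positivity), Real.mul_rpow hM.le hg.le]
  rw [e3, integral_const_mul, e1] at e2
  have e4 : ∫ y, F y = ∫ y in Ω, (max (f n y) 0) ^ (p n + 1) := integral_indicator h.ho.measurableSet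
  rw [e4] at e2
  have hp0 : 0 < p n := by linarith
  have e5 := mul_le_mul_of_nonneg_left e2 (show 0 ≤ p n * ε n ^ 2 by positivity)
  unfold en
  have e6 : f n (xl n) ^ (p n + 1) = f n (xl n) ^ (p n - 1) * f n (xl n) ^ 2 := by
    rw [← Real.rpow_natCast (f n (xl n)) 2, ← Real.rpow_add hM]; congr 1; push_cast; ring
  have e7 := h.edef n
  set I := ∫ z in closedBall (0:E2) Q, (1 + v n z / p n) ^ (p n + 1)
  calc f n (xl n) ^ 2 * I = (ε n ^ 2 * (p n * f n (xl n) ^ (p n - 1))) * (f n (xl n) ^ 2 * I) := by rw [e7, one_mul]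
    _ = p n * ε n ^ 2 * (f n (xl n) ^ (p n + 1) * I) := by rw [e6]; ring
    _ ≤ _ := e5
    _ = _ := by field_simp

lemma int_expU {R : ℝ} (hR : 0 ≤ R) : ∫ z in {z : E2 | ‖z‖ ∈ Set.Ioc 0 R}, Real.exp (Ustd z) = 8 * π - 64 * π / (8 + R ^ 2) := by
  have hc : Continuous fun z : E2 => Real.exp (Ustd z) := Real.continuous_exp.comp contDiff_Ustd.continuous
  have h1 := polar_annulus (F := fun z => Real.exp (Ustd z)) (c := 0) (R := R + 1) (a := 0) (b := R) hc.continuousOn le_rfl hR (by linarith)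
  simp only [sub_zero] at h1
  rw [h1]
  have h2 : ∀ r ∈ Set.uIcc 0 R, HasDerivAt (fun r : ℝ => -64 * π * (8 + r ^ 2)⁻¹) (r * circInt (fun z => Real.exp (Ustd z)) 0 r) r := by
    intro r _
    have e1 : circInt (fun z => Real.exp (Ustd z)) 0 r = 2 * π * (64 / (8 + r ^ 2) ^ 2) := by
      simp only [circInt, expU, zero_add, norm_smul_circDir', sq_abs]
      simp; ring
    rw [e1]
    have hne : 8 + r ^ 2 ≠ 0 := by positivity
    have := (((hasDerivAt_pow 2 r).const_add 8).inv hne).const_mul (-64 * π)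
    convert! this using 1
    push_cast
    field_simp
  rw [intervalIntegral.integral_eq_sub_of_hasDerivAt h2]
  · field_simp; ring
  · have := (continuousOn_circInt (F := fun z : E2 => Real.exp (Ustd z)) (c := 0) (R := R + 1) hc.continuousOn)
    apply ContinuousOn.intervalIntegrable
    rw [Set.uIcc_of_le hR]
    exact continuousOn_id.mul (this.mono fun r hr => ⟨by linarith [hr.1], by linarith [hr.2]⟩)

lemma Side.inner_ge (h : Side Ω p f xl x ε v ϱ N0 w0) {R : ℝ} (hR : 0 ≤ R) {η : ℝ} (hη : 0 < η) : ∀ᶠ n in atTop,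
    R + 1 ≤ ϱ / ε n →
    8 * π - 64 * π / (8 + R ^ 2) - η ≤ ∫ z in {z : E2 | ‖z‖ ∈ Set.Ioc 0 R}, (1 + v n z / p n) ^ (p n + 1) := by
  obtain ⟨C, hC, hc⟩ := h.vclose R hR
  set C' := 2 * C + 4 * C ^ 2 with hC'
  have t1 : Tendsto (fun n => C' * (π * R ^ 2) / p n) atTop (𝓝 0) := h.ptop.const_div_atTop _
  filter_upwards [hc, h.solB, h.ptop.eventually_ge_atTop (2 * C + 2), t1.eventually_lt_const hη] with n hn hsol hpC hsm hR1
  have hs := hsol _ hR1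
  have hp0 : 0 < p n := by linarith
  have hsub : {z : E2 | ‖z‖ ∈ Set.Ioc 0 R} ⊆ closedBall 0 R := fun z hz => by simpa using hz.2
  have hpt : ∀ z ∈ {z : E2 | ‖z‖ ∈ Set.Ioc 0 R}, Real.exp (Ustd z) - C' / p n ≤ (1 + v n z / p n) ^ (p n + 1) := by
    intro z hz
    obtain ⟨a, b, d⟩ := hn z hz.2
    have hzb : z ∈ ball (0:E2) (R + 1) := by rw [mem_ball_zero_iff]; linarith [hz.2]
    have hup := hs.up z hzb
    set s := v n z / p n with hsd
    have hvs : v n z = p n * s := by rw [hsd]; field_simp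
    have hs1 : -(1/2) ≤ s := by rw [hsd, le_div_iff₀ hp0]; linarith
    have hs2 : s ≤ 0 := by rw [hsd]; exact div_nonpos_of_nonpos_of_nonneg hup hp0.le
    have hlog : s - 2 * s ^ 2 ≤ Real.log (1 + s) := by
      have h0 : 0 < 1 + s := by linarith
      have h1 := Real.one_sub_inv_le_log_of_pos h0
      have : 1 - (1 + s)⁻¹ = s / (1 + s) := by rw [eq_div_iff h0.ne', sub_mul, inv_mul_cancel₀ h0.ne']; ring
      rw [this] at h1
      refine le_trans ?_ h1
      rw [le_div_iff₀ h0]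
      nlinarith [mul_nonneg (sq_nonneg s) (show 0 ≤ 1 + 2 * s by linarith)]
    rw [Real.rpow_def_of_pos (by linarith)]
    have h1 : Ustd z - C' / p n ≤ Real.log (1 + s) * (p n + 1) := by
      have h2 : (s - 2 * s ^ 2) * (p n + 1) ≤ Real.log (1 + s) * (p n + 1) := by gcongr
      refine le_trans ?_ h2
      have h3 : Ustd z - C / p n ≤ v n z := by linarith [(abs_le.1 a).1]
      have h4 : |s| ≤ C / p n := by
        rw [abs_of_nonpos hs2, le_div_iff₀ hp0, hsd]; field_simp; linarith
      have h5 : s ^ 2 ≤ (C / p n) ^ 2 := by rw [← sq_abs]; gcongr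
      have h6 : -(C / p n) ≤ s := (abs_le.1 h4).1
      have h7 : (s - 2 * s ^ 2) * (p n + 1) = v n z + s - 2 * ((p n + 1) * s ^ 2) := by rw [hvs]; ring
      have h8 : (p n + 1) * s ^ 2 ≤ (2 * p n) * (C / p n) ^ 2 := by gcongr; linarith
      have h9 : (2 * p n) * (C / p n) ^ 2 = 2 * C ^ 2 / p n := by field_simp
      have h10 : C' / p n = C / p n + C / p n + 2 * (2 * C ^ 2 / p n) := by rw [hC']; ring
      linarith
    have h2 : Real.exp (Ustd z - C' / p n) ≤ Real.exp (Real.log (1 + s) * (p n + 1)) := Real.exp_le_exp.2 h1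
    refine le_trans ?_ h2
    have h3 : Real.exp (Ustd z) ≤ 1 := Real.exp_le_one_iff.2 (Ustd_nonpos z)
    have h4 : 0 ≤ C' / p n := by positivity
    rw [sub_eq_add_neg (Ustd z), Real.exp_add]
    have h5 := Real.add_one_le_exp (-(C' / p n))
    nlinarith [Real.exp_pos (Ustd z), mul_le_mul_of_nonneg_left h5 (Real.exp_pos (Ustd z)).le]
  have hc : Continuous fun z : E2 => Real.exp (Ustd z) := Real.continuous_exp.comp contDiff_Ustd.continuous
  have i1 : IntegrableOn (fun z : E2 => Real.exp (Ustd z)) {z : E2 | ‖z‖ ∈ Set.Ioc 0 R} :=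
    (hc.continuousOn.integrableOn_compact (isCompact_closedBall 0 R)).mono_set hsub
  have hvol : volume {z : E2 | ‖z‖ ∈ Set.Ioc 0 R} < ⊤ := (measure_mono hsub).trans_lt measure_closedBall_lt_top
  have i2 : IntegrableOn (fun z : E2 => C' / p n) {z : E2 | ‖z‖ ∈ Set.Ioc 0 R} := integrableOn_const hvol.ne
  have i3 : IntegrableOn (fun z : E2 => (1 + v n z / p n) ^ (p n + 1)) {z : E2 | ‖z‖ ∈ Set.Ioc 0 R} :=
    int_on_annulus (hs.contpow (by linarith) _) (show R < R + 1 by linarith) hsub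
  have hm := setIntegral_mono_on (i1.sub i2) i3 (annulus_meas 0 R) hpt
  have hm' : ∫ z in {z : E2 | ‖z‖ ∈ Set.Ioc 0 R}, (Real.exp (Ustd z) - C' / p n) ≤ ∫ z in {z : E2 | ‖z‖ ∈ Set.Ioc 0 R}, (1 + v n z / p n) ^ (p n + 1) := hm
  rw [integral_sub i1 i2, int_expU hR, setIntegral_const, smul_eq_mul] at hm'
  refine le_trans ?_ hm'
  have h1 : volume.real {z : E2 | ‖z‖ ∈ Set.Ioc 0 R} ≤ π * R ^ 2 := by
    rw [← vol_closedBall_E2 R hR]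
    exact ENNReal.toReal_mono measure_closedBall_lt_top.ne (measure_mono hsub)
  have h2 : 0 ≤ C' / p n := by positivity
  have h3 := mul_le_mul_of_nonneg_right h1 h2
  have h4 : C' * (π * R ^ 2) / p n = π * R ^ 2 * (C' / p n) := by ring
  linarith

end

section
variable {Ω : Set E2} {p : ℕ → ℝ} {f : ℕ → E2 → ℝ} {xl : ℕ → E2} {x : E2} {ε : ℕ → ℝ} {v : ℕ → E2 → ℝ}
    {ϱ : ℝ} {N0 : ℕ} {w0 : E2 → ℝ}

lemma Side.quant (h : Side Ω p f xl x ε v ϱ N0 w0) (hup : ∀ η > 0, ∀ᶠ n in atTop, en Ω (p n) (f n) ≤ 8 * π * Real.exp 1 * (1 + η)) :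
    (∀ K : ℕ, ∀ᶠ n in atTop, p n ^ K ≤ ϱ / ε n) ∧ ∀ a > 0, a < 1 → ∀ᶠ n in atTop, Real.exp 1 * (1 - a) ≤ f n (xl n) ^ 2 := by
  obtain ⟨D, κ, δ, hD, hκ, hδ, hl⟩ := h.lower
  have hpe : 0 < 8 * π * Real.exp 1 := by have := Real.pi_pos; positivity
  have ht : ∀ a > 0, a < 1 → ∀ᶠ n in atTop, 1 - a ≤ 4 * Real.log (D / ε n) / p n := by
    intro a ha ha1
    filter_upwards [hl, hup (a ^ 2 / 16) (by positivity), hκ.eventually_const_lt (show 1 - a ^ 2 / 16 < (1:ℝ) by have := pow_pos ha 2; linarith)] with n hn hu hk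
    obtain ⟨a1, a2, -⟩ := hn
    have hp : 0 < p n := by linarith [h.hp1 n]
    set t := 4 * Real.log (D / ε n) / p n
    have ht : 0 < t := by positivity
    by_contra hlt
    rw [not_le] at hlt
    have b1 := a2.trans hu
    rw [mul_assoc] at b1
    have b2 := le_of_mul_le_mul_left b1 hpe
    rw [← mul_div_assoc, div_le_iff₀ ht] at b2
    have b3 : t + a ^ 2 / 4 ≤ Real.exp (t - 1) := by
      have c1 := Real.add_one_le_exp ((t - 1) / 2)
      have c2 : Real.exp (t - 1) = Real.exp ((t - 1) / 2) ^ 2 := by rw [← Real.exp_nat_mul]; push_cast; ring_nf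
      have c3 : ((t - 1) / 2 + 1) ^ 2 ≤ Real.exp ((t - 1) / 2) ^ 2 := by gcongr; linarith
      have c4 : a ^ 2 ≤ (1 - t) ^ 2 := by gcongr; linarith
      rw [c2]; nlinarith
    have ha2 : a ^ 2 < 1 := by nlinarith
    have b4 : (1 - a ^ 2 / 16) * (t + a ^ 2 / 4) ≤ (1 + a ^ 2 / 16) * t := by
      refine le_trans ?_ b2
      exact mul_le_mul hk.le b3 (by positivity) (by linarith)
    nlinarith [pow_pos ha 2]
  constructor
  · intro K
    have hs : ∀ᶠ q : ℝ in atTop, q ^ K * (D * Real.exp (-(1/8) * q)) ≤ ϱ := by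
      have h2 := tendsto_rpow_mul_exp_neg_mul_atTop_nhds_zero K (1/8) (by norm_num)
      have h3 := h2.const_mul D
      rw [mul_zero] at h3
      filter_upwards [h3.eventually_lt_const h.rpos] with q hq
      rw [Real.rpow_natCast] at hq
      linarith
    filter_upwards [ht (1/2) (by norm_num) (by norm_num), h.ptop.eventually hs, hl] with n h1 h2 h3
    have he := h.epos n
    have hp : 0 < p n := by linarith [h.hp1 n]
    rw [le_div_iff₀ hp] at h1
    have h4 : Real.exp (p n / 8) ≤ D / ε n := by
      rw [← Real.exp_log (show 0 < D / ε n by positivity), Real.exp_le_exp]; linarith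
    rw [le_div_iff₀ he] at h4
    have h5 : ε n ≤ D * Real.exp (-(1/8) * p n) := by
      rw [show -(1/8) * p n = -(p n / 8) by ring, Real.exp_neg, ← div_eq_mul_inv, le_div_iff₀ (Real.exp_pos _)]; linarith
    rw [le_div_iff₀ he]
    exact (mul_le_mul_of_nonneg_left h5 (by positivity)).trans h2
  · intro a ha ha1
    filter_upwards [ht (a/2) (by linarith) (by linarith), hl, hδ.eventually_lt_const (show 0 < a / 2 by linarith)] with n h1 h2 h3
    refine le_trans ?_ h2.2.2
    have : Real.exp (1 + (-a)) ≤ Real.exp (4 * Real.log (D / ε n) / p n - δ n) := Real.exp_le_exp.2 (by linarith)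
    refine le_trans ?_ this
    rw [Real.exp_add]
    gcongr
    linarith [Real.add_one_le_exp (-a)]

lemma Side.core (h : Side Ω p f xl x ε v ϱ N0 w0) (hup : ∀ η > 0, ∀ᶠ n in atTop, en Ω (p n) (f n) ≤ 8 * π * Real.exp 1 * (1 + η)) :
    Core p v w0 := by
  obtain ⟨hK, hM⟩ := h.quant hup
  refine ⟨h.ptop, ?_, ?_, h.lim, ?_, h.weq, h.wgr⟩
  · intro K
    filter_upwards [hK K, h.solB] with n h1 h2
    exact h2 _ h1
  · intro n; rw [h.hv]; simp
  · refine ⟨200, by norm_num, fun K => ?_⟩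
    filter_upwards [hK K, hK (K + 1), h.solB, h.en_ge, h.inner_ge (R := 200) (by norm_num) (show (0:ℝ) < 1/1000 by norm_num),
      hM (1/10000) (by norm_num) (by norm_num), hup (1/10000) (by norm_num), hK 1, h.ptop.eventually_ge_atTop 300] with n k1 k2 hs he hi hm hu k3 hp
    set q := p n with hq
    set Q := q ^ K with hQ
    have hQ0 : 0 < Q := by positivity
    have hQQ : Q < q ^ (K + 1) := by rw [pow_succ]; nlinarith
    have hS := hs _ k2
    have e1 := he Q k1
    have e2 := hi (by rw [pow_one] at k3; linarith)
    have hnn : ∀ z ∈ closedBall (0:E2) Q, 0 ≤ (1 + v n z / q) ^ (q + 1) := fun z hz =>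
      Real.rpow_nonneg (hS.gpos (by linarith) (closedBall_subset_ball hQQ hz)).le _
    have hint : IntegrableOn (fun z => (1 + v n z / q) ^ (q + 1)) (closedBall (0:E2) Q) :=
      int_on_annulus (hS.contpow (by linarith) _) hQQ subset_rfl
    rcases le_or_gt Q 200 with hc | hc
    · have : {z : E2 | ‖z‖ ∈ Set.Ioc 200 Q} = ∅ := by
        ext z; simp only [Set.mem_ofPred_eq, Set.mem_Ioc, Set.mem_empty_iff_false, iff_false]
        intro hz; linarith [hz.1, hz.2]
      rw [this]; simp
    have hsub1 : {z : E2 | ‖z‖ ∈ Set.Ioc 0 200} ⊆ closedBall 0 Q := fun z hz => by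
      rw [mem_closedBall_zero_iff]; exact hz.2.trans hc.le
    have hsub2 : {z : E2 | ‖z‖ ∈ Set.Ioc 200 Q} ⊆ closedBall 0 Q := fun z hz => by
      rw [mem_closedBall_zero_iff]; exact hz.2
    have hdis : Disjoint {z : E2 | ‖z‖ ∈ Set.Ioc 0 200} {z : E2 | ‖z‖ ∈ Set.Ioc 200 Q} :=
      Set.disjoint_left.2 fun z h1 h2 => by linarith [h1.2, h2.1]
    have e3 := setIntegral_union hdis (annulus_meas 200 Q) (hint.mono_set hsub1) (hint.mono_set hsub2)
    have e4 := setIntegral_mono_set hint (ae_restrict_of_forall_mem measurableSet_closedBall hnn) (Set.union_subset hsub1 hsub2).eventuallyLE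
    rw [e3] at e4
    set I1 := ∫ z in {z : E2 | ‖z‖ ∈ Set.Ioc 0 200}, (1 + v n z / q) ^ (q + 1)
    set I2 := ∫ z in {z : E2 | ‖z‖ ∈ Set.Ioc 200 Q}, (1 + v n z / q) ^ (q + 1)
    set I := ∫ z in closedBall (0:E2) Q, (1 + v n z / q) ^ (q + 1)
    have hI0 : 0 ≤ I := setIntegral_nonneg measurableSet_closedBall hnn
    have hex := Real.exp_pos 1
    have e5 : Real.exp 1 * ((1 - 1/10000) * I) ≤ Real.exp 1 * (8 * π * (1 + 1/10000)) := by
      calc _ = (Real.exp 1 * (1 - 1/10000)) * I := by ring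
        _ ≤ f n (xl n) ^ 2 * I := by gcongr
        _ ≤ _ := e1
        _ ≤ _ := hu
        _ = _ := by ring
    have e6 := le_of_mul_le_mul_left e5 hex
    have hpi := Real.pi_lt_d2
    norm_num at e2 e6
    linarith

end

lemma sol_neg {Ω : Set E2} {p : ℝ} {u : E2 → ℝ} (hs : IsSolution Ω p u) : IsSolution Ω p (fun y => -u y) := by
  obtain ⟨a, b, c, d⟩ := hs
  refine ⟨a.neg, b.neg, fun x hx => ?_, fun x hx => by simp [d x hx]⟩
  have h1 : lap (fun y => -u y) x = -lap u x := by
    have := lap_scale u (-1) 0 1 0 x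
    simp only [one_smul, zero_add, sub_zero, neg_mul, one_mul, one_pow] at this
    simpa using this
  rw [h1, abs_neg]
  linarith [c x hx]

lemma en_add {Ω : Set E2} {p : ℝ} {u : E2 → ℝ} (ho : IsOpen Ω) (hb : IsBounded Ω) (hp : 1 < p) (hs : IsSolution Ω p u) :
    en Ω p u + en Ω p (fun y => -u y) = p * ∫ x in Ω, |u x| ^ (p + 1) := by
  unfold en
  rw [← mul_add, ← integral_add (energy_int hb hs hp) (energy_int hb (sol_neg hs) hp)]
  congr 2
  ext y
  rcases le_total 0 (u y) with h | h
  · rw [max_eq_left h, max_eq_right (by linarith), abs_of_nonneg h, Real.zero_rpow (by linarith), add_zero]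
  · rw [max_eq_right h, max_eq_left (by linarith), abs_of_nonpos h, Real.zero_rpow (by linarith), zero_add]

theorem second_order_expansion_k
    (Ω : Set E2) (hΩo : IsOpen Ω) (hΩb : IsBounded Ω) (hΩne : Ω.Nonempty)
    (p : ℕ → ℝ) (hp1 : ∀ n, 1 < p n) (hptop : Tendsto p atTop atTop)
    (u : ℕ → E2 → ℝ)
    (hsol : ∀ n, IsSolution Ω (p n) (u n))
    (hnod : ∀ n, IsNodal Ω (u n))
    (hlow : Tendsto (fun n => p n * ∫ x in Ω, |u n x| ^ (p n + 1)) atTop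
      (𝓝 (16 * π * Real.exp 1)))
    (xl : Fin 2 → ℕ → E2)
    (hmax : ∀ n, xl 0 n ∈ Ω ∧ ∀ y ∈ closure Ω, u n y ≤ u n (xl 0 n))
    (hmin : ∀ n, xl 1 n ∈ Ω ∧ ∀ y ∈ closure Ω, u n (xl 1 n) ≤ u n y)
    (x : Fin 2 → E2) (hx : ∀ i, x i ∈ Ω) (hxne : x 0 ≠ x 1)
    (hxconv : ∀ i, Tendsto (fun n => xl i n) atTop (𝓝 (x i)))
    (ε : Fin 2 → ℕ → ℝ) (hεpos : ∀ i n, 0 < ε i n)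
    (hεdef : ∀ i n, (ε i n) ^ 2 * (p n * |u n (xl i n)| ^ (p n - 1)) = 1)
    (v : Fin 2 → ℕ → E2 → ℝ)
    (hv : ∀ i n z, v i n z =
      (p n / u n (xl i n)) * (u n (xl i n + ε i n • z) - u n (xl i n)))
    (r0 : ℝ) (hr0 : 0 < r0)
    (hdisj : Disjoint (ball (x 0) (2 * r0)) (ball (x 1) (2 * r0)))
    (ϱ0 : ℝ) (hϱ0 : ϱ0 ∈ Set.Ioo (0:ℝ) (r0 / 2)) (N0 : ℕ)
    (hsign : ∀ n ≥ N0,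
      (∀ y ∈ ball (x 0) (2 * ϱ0), 1 / p n ≤ u n y) ∧
      (∀ y ∈ ball (x 1) (2 * ϱ0), u n y ≤ -(1 / p n)))
    (w0 : E2 → ℝ)
    (hw0lim : ∀ i : Fin 2,
      TendstoC2LocOn Set.univ (fun n z => p n * (v i n z - Ustd z)) w0)
    (hw0eq : ∀ z : E2, -lap w0 z - Real.exp (Ustd z) * w0 z
        = -((Ustd z) ^ 2 / 2) * Real.exp (Ustd z))
    (hw0gr : ∀ τ ∈ Set.Ioo (0:ℝ) 1, ∃ C > (0:ℝ), ∀ z : E2, |w0 z| ≤ C * (1 + ‖z‖) ^ τ) :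
    (∀ τ ∈ Set.Ioo (0:ℝ) 1, ∃ C > (0:ℝ), ∃ N : ℕ, ∀ n ≥ N, ∀ i : Fin 2, ∀ z : E2,
        ‖z‖ ≤ ϱ0 / ε i n →
          |p n * (p n * (v i n z - Ustd z) - w0 z)| ≤ C * (1 + ‖z‖) ^ τ) ∧
    (∀ K : Set E2, IsCompact K → ∃ C > (0:ℝ), ∃ N : ℕ, ∀ n ≥ N, ∀ i : Fin 2,
        ∀ z ∈ K, ∀ k : ℕ, k ≤ 2 →
          ‖iteratedFDeriv ℝ k (fun y => v i n y - Ustd y - w0 y / p n) z‖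
            ≤ C / (p n) ^ 2) := by
  have pos0 : ∀ n, 0 < u n (xl 0 n) := fun n => by
    obtain ⟨y, hy, hy0⟩ := (hnod n).1
    exact hy0.trans_le ((hmax n).2 y (subset_closure hy))
  have pos1 : ∀ n, 0 < -u n (xl 1 n) := fun n => by
    obtain ⟨y, hy, hy0⟩ := (hnod n).2
    have := (hmin n).2 y (subset_closure hy)
    linarith
  have S0 : Side Ω p u (xl 0) (x 0) (ε 0) (v 0) ϱ0 N0 w0 :=
    { ho := hΩo, hb := hΩb, hp1 := hp1, ptop := hptop, sol := hsol, mem := fun n => (hmax n).1, mx := fun n => (hmax n).2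
      pos := pos0, xmem := hx 0, xconv := hxconv 0, epos := hεpos 0
      edef := fun n => by have := hεdef 0 n; rwa [abs_of_pos (pos0 n)] at this
      hv := hv 0, rpos := hϱ0.1, sign := fun n hn => (hsign n hn).1, lim := hw0lim 0, weq := hw0eq, wgr := hw0gr }
  have S1 : Side Ω p (fun n y => -u n y) (xl 1) (x 1) (ε 1) (v 1) ϱ0 N0 w0 :=
    { ho := hΩo, hb := hΩb, hp1 := hp1, ptop := hptop, sol := fun n => sol_neg (hsol n), mem := fun n => (hmin n).1
      mx := fun n y hy => neg_le_neg ((hmin n).2 y hy)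
      pos := pos1, xmem := hx 1, xconv := hxconv 1, epos := hεpos 1
      edef := fun n => by
        have := hεdef 1 n
        rwa [abs_of_neg (by linarith [pos1 n])] at this
      hv := fun n z => by
        rw [hv 1 n z]
        have : u n (xl 1 n) ≠ 0 := by linarith [pos1 n]
        field_simp
        ring
      rpos := hϱ0.1, sign := fun n hn y hy => by linarith [(hsign n hn).2 y hy], lim := hw0lim 1, weq := hw0eq, wgr := hw0gr }
  have hpe : 0 < 8 * π * Real.exp 1 := by have := Real.pi_pos; positivity
  have hup : ∀ η > 0, ∀ᶠ n in atTop, en Ω (p n) (u n) ≤ 8 * π * Real.exp 1 * (1 + η) ∧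
      en Ω (p n) (fun y => -u n y) ≤ 8 * π * Real.exp 1 * (1 + η) := by
    intro η hη
    have hη' : 0 < 8 * π * Real.exp 1 * η / 2 := by positivity
    filter_upwards [S0.lemA hη', S1.lemA hη', hlow.eventually_lt_const (show 16 * π * Real.exp 1 < 16 * π * Real.exp 1 + 8 * π * Real.exp 1 * η / 2 by linarith)]
      with n h0 h1 h2
    rw [← en_add hΩo hΩb (hp1 n) (hsol n)] at h2
    constructor <;> linarith
  have C0 := S0.core fun η hη => (hup η hη).mono fun n h => h.1
  have C1 := S1.core fun η hη => (hup η hη).mono fun n h => h.2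
  constructor
  · intro τ hτ
    obtain ⟨A, hA, a⟩ := C0.part1 hτ
    obtain ⟨B, hB, b⟩ := C1.part1 hτ
    obtain ⟨N, hN⟩ := eventually_atTop.1 ((a.and b).and (S0.big_in.and S1.big_in))
    refine ⟨max A B, lt_max_of_lt_left hA, N, fun n hn i z hz => ?_⟩
    obtain ⟨⟨h1, h2⟩, h3, h4⟩ := hN n hn
    match i with
    | 0 =>
      obtain ⟨-, l, r⟩ := h3 z hz
      refine (h1 z l.le r).trans ?_
      gcongr; exact le_max_left _ _
    | 1 =>
      obtain ⟨-, l, r⟩ := h4 z hz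
      refine (h2 z l.le r).trans ?_
      gcongr; exact le_max_right _ _
  · intro K hK
    obtain ⟨A, hA, a⟩ := C0.part2 hK
    obtain ⟨B, hB, b⟩ := C1.part2 hK
    obtain ⟨N, hN⟩ := eventually_atTop.1 (a.and b)
    refine ⟨max A B, lt_max_of_lt_left hA, N, fun n hn i z hz k hk => ?_⟩
    obtain ⟨h1, h2⟩ := hN n hn
    match i with
    | 0 =>
      refine (h1 z hz k hk).trans ?_
      gcongr; exact le_max_left _ _
    | 1 =>
      refine (h2 z hz k hk).trans ?_
      gcongr; exact le_max_right _ _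

end
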